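/- Let α ∈ [1/2,1) and set δ_α = (1-α)·α^{α/(1-α)}. Then the function θ_α is monotone decreasing on (0,∞) with θ_α(t) → α as t → 0+ and θ_α(t) → 1/2 as t → +∞; moreover, for every x > 0 the value G_α(x) is a positive real number and the function x ↦ e^{-δ_α x}/Re(G_α(x)), defined on (0,∞), is hyperbolically completely monotone (HCM). -/

import Mathlib

open MeasureTheory Complex Set Filter

/-- The function `G_α` from Fourati's paper: for `z` in the slit plane,
`G_α(z) = (2πi)⁻¹ ∫_0^∞ (exp(-e^{-iπα} y^α z^{1-α}) - exp(-e^{iπα} y^α z^{1-α})) z⁻¹ e^{-y} dy`,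
all complex powers being principal branches. -/
noncomputable def Galpha (α : ℝ) (z : ℂ) : ℂ :=
  (2 * Real.pi * Complex.I)⁻¹ *
    ∫ y in Set.Ioi (0:ℝ),
      ((Complex.exp (-(Complex.exp (-(Real.pi * α : ℂ) * Complex.I)) * (y:ℂ) ^ (α:ℂ) * z ^ (1 - (α:ℂ))) -
        Complex.exp (-(Complex.exp ((Real.pi * α : ℂ) * Complex.I)) * (y:ℂ) ^ (α:ℂ) * z ^ (1 - (α:ℂ)))) / z) *
      Complex.exp (-(y:ℂ))

/-- The upper boundary value `G_α(-r^+)`. -/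
noncomputable def GalphaPlus (α r : ℝ) : ℂ :=
  (2 * Real.pi * Complex.I)⁻¹ *
    ∫ y in Set.Ioi (0:ℝ),
      ((Complex.exp ((r:ℂ) ^ (1 - (α:ℂ)) * (y:ℂ) ^ (α:ℂ)) -
        Complex.exp (Complex.exp (-(2 * Real.pi * α : ℂ) * Complex.I) * (r:ℂ) ^ (1 - (α:ℂ)) * (y:ℂ) ^ (α:ℂ))) / (r:ℂ)) *
      Complex.exp (-(y:ℂ))

/-- `θ_α(r) = -arg(G_α(-r^+))/π`. -/
noncomputable def thetaFun (α r : ℝ) : ℝ := -(GalphaPlus α r).arg / Real.pi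

/-- Zolotarev's integral formula for the density of the strictly `α`-stable
distribution with positivity parameter `ρ` (the integral is a real number; we take
the real part). -/
noncomputable def stableDensity (α ρ x : ℝ) : ℝ :=
  ((2 * Real.pi * Complex.I)⁻¹ *
    ∫ y in Set.Ioi (0:ℝ),
      ((Complex.exp (-(Complex.exp (-(Real.pi * ρ * α : ℂ) * Complex.I)) * (y:ℂ) ^ (α:ℂ) * (x:ℂ) ^ (-(α:ℂ))) -
        Complex.exp (-(Complex.exp ((Real.pi * ρ * α : ℂ) * Complex.I)) * (y:ℂ) ^ (α:ℂ) * (x:ℂ) ^ (-(α:ℂ)))) / (x:ℂ)) *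
      Complex.exp (-(y:ℂ))).re

/-- A function is completely monotone (on `(0,∞)`) if it is infinitely differentiable
there and `(-1)^n f^{(n)}(x) ≥ 0` for all `n` and `x > 0`. -/
def CompletelyMonotone (φ : ℝ → ℝ) : Prop :=
  ContDiffOn ℝ (⊤ : ℕ∞) φ (Set.Ioi 0) ∧
  ∀ (n : ℕ) (x : ℝ), 0 < x → 0 ≤ (-1 : ℝ) ^ n * iteratedDeriv n φ x

/-- A function `H` on `(0,∞)` is hyperbolically completely monotone if for every `u > 0`
the function `v ↦ H(uv)H(u/v)` is a completely monotone function of `v + 1/v`. -/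
def HCM (H : ℝ → ℝ) : Prop :=
  ∀ u : ℝ, 0 < u → ∃ φ : ℝ → ℝ, CompletelyMonotone φ ∧
    ∀ v : ℝ, 0 < v → H (u * v) * H (u / v) = φ (v + 1 / v)

open scoped Topology

/-- `J_α(q) = ∫_0^∞ exp(q y^α - y) dy`. -/
noncomputable def expPowInt (α : ℝ) (q : ℂ) : ℂ :=
  ∫ y in Ioi (0:ℝ), exp (q * ((y ^ α : ℝ) : ℂ) - y)

lemma mul_rpow_le_linear {α : ℝ} (h0 : 0 < α) (h1 : α < 1) (a : ℝ) {ε : ℝ} (hε : 0 < ε) :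
    ∃ C : ℝ, 0 ≤ C ∧ ∀ y : ℝ, 0 ≤ y → a * y ^ α ≤ ε * y + C := by
  set Y : ℝ := (|a| / ε) ^ (1 / (1 - α)) with hY
  have hY0 : 0 ≤ Y := by positivity
  refine ⟨|a| * Y ^ α, by positivity, fun y hy => ?_⟩
  have ha : a * y ^ α ≤ |a| * y ^ α :=
    mul_le_mul_of_nonneg_right (le_abs_self a) (by positivity)
  rcases le_total y Y with h | h
  · have : y ^ α ≤ Y ^ α := Real.rpow_le_rpow hy h h0.le
    have := mul_le_mul_of_nonneg_left this (abs_nonneg a)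
    have : 0 ≤ ε * y := by positivity
    linarith
  · rcases hy.eq_or_lt with rfl | hy'
    · rw [Real.zero_rpow h0.ne']
      have : 0 ≤ |a| * Y ^ α := by positivity
      linarith
    have h3 : |a| / ε ≤ y ^ (1 - α) := by
      have := Real.rpow_le_rpow hY0 h (by linarith : 0 ≤ 1 - α)
      rwa [hY, ← Real.rpow_mul (by positivity), one_div_mul_cancel (by linarith), Real.rpow_one]
        at this
    have h4 : |a| ≤ ε * y ^ (1 - α) := by
      rw [div_le_iff₀ hε] at h3; linarith
    have h5 : |a| * y ^ α ≤ ε * y := by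
      calc |a| * y ^ α ≤ ε * y ^ (1 - α) * y ^ α :=
            mul_le_mul_of_nonneg_right h4 (by positivity)
        _ = ε * y := by rw [mul_assoc, ← Real.rpow_add hy']; simp
    have : 0 ≤ |a| * Y ^ α := by positivity
    linarith

lemma continuous_rpow_cast {α : ℝ} (h0 : 0 < α) : Continuous fun y : ℝ => ((y ^ α : ℝ) : ℂ) :=
  continuous_ofReal.comp (Real.continuous_rpow_const h0.le)

lemma integrableOn_rpow_mul_exp {α : ℝ} (h0 : 0 < α) (h1 : α < 1) (a : ℝ) {s : ℝ} (hs : 0 ≤ s) :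
    IntegrableOn (fun y : ℝ => y ^ s * Real.exp (a * y ^ α - y)) (Ioi 0) := by
  obtain ⟨C, -, hC⟩ := mul_rpow_le_linear h0 h1 a (show (0:ℝ) < 1/2 by norm_num)
  have hi := (integrableOn_rpow_mul_exp_neg_mul_rpow (p := 1) (s := s) (b := 1/2)
    (by linarith) one_pos (by norm_num)).const_mul (Real.exp C)
  refine hi.mono' ?_ ?_
  · exact (((Real.continuous_rpow_const hs).mul (Real.continuous_exp.comp
      ((continuous_const.mul (Real.continuous_rpow_const h0.le)).sub
        continuous_id))).aestronglyMeasurable)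
  · refine (ae_restrict_iff' measurableSet_Ioi).2 (Eventually.of_forall fun y hy => ?_)
    have hy' : (0:ℝ) < y := hy
    have h2 := hC y hy'.le
    rw [Real.norm_of_nonneg (by positivity)]
    calc y ^ s * Real.exp (a * y ^ α - y) ≤ y ^ s * Real.exp (C + -(1/2) * y ^ (1:ℝ)) := by
          gcongr
          rw [Real.rpow_one]; linarith
      _ = _ := by rw [Real.exp_add]; ring

lemma norm_expPow_integrand (α : ℝ) (q : ℂ) (y : ℝ) :
    ‖exp (q * ((y ^ α : ℝ) : ℂ) - y)‖ = Real.exp (q.re * y ^ α - y) := by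
  rw [norm_exp]; simp

lemma integrableOn_expPow {α : ℝ} (h0 : 0 < α) (h1 : α < 1) (q : ℂ) :
    IntegrableOn (fun y : ℝ => exp (q * ((y ^ α : ℝ) : ℂ) - y)) (Ioi 0) := by
  have hi := integrableOn_rpow_mul_exp h0 h1 q.re le_rfl
  simp only [Real.rpow_zero, one_mul] at hi
  refine hi.mono' ?_ (Eventually.of_forall fun y => (norm_expPow_integrand α q y).le)
  have := continuous_rpow_cast h0
  exact Continuous.aestronglyMeasurable (by fun_prop)

lemma hasDerivAt_expPowInt {α : ℝ} (h0 : 0 < α) (h1 : α < 1) (q : ℂ) :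
    HasDerivAt (expPowInt α)
      (∫ y in Ioi (0:ℝ), ((y ^ α : ℝ) : ℂ) * exp (q * ((y ^ α : ℝ) : ℂ) - y)) q := by
  have hc := continuous_rpow_cast h0
  refine (hasDerivAt_integral_of_dominated_loc_of_deriv_le
    (F := fun q (y : ℝ) => exp (q * ((y ^ α : ℝ) : ℂ) - y))
    (F' := fun q (y : ℝ) => ((y ^ α : ℝ) : ℂ) * exp (q * ((y ^ α : ℝ) : ℂ) - y))
    (bound := fun y : ℝ => y ^ α * Real.exp ((‖q‖ + 1) * y ^ α - y))
    (Metric.ball_mem_nhds q one_pos) ?_ (integrableOn_expPow h0 h1 q) ?_ ?_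
    (integrableOn_rpow_mul_exp h0 h1 _ h0.le) ?_).2
  · exact Eventually.of_forall fun p => (integrableOn_expPow h0 h1 p).aestronglyMeasurable
  · exact Continuous.aestronglyMeasurable (by fun_prop)
  · refine (ae_restrict_iff' measurableSet_Ioi).2 (Eventually.of_forall fun y hy p hp => ?_)
    have hy' : (0:ℝ) < y := hy
    rw [norm_mul, norm_expPow_integrand, norm_real, Real.norm_of_nonneg (by positivity)]
    have h3 : p.re ≤ ‖q‖ + 1 := by
      have h4 := re_le_norm p
      have h5 : ‖p - q‖ < 1 := by simpa [dist_eq_norm] using hp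
      have h6 := norm_sub_norm_le p q
      linarith
    gcongr
  · refine Eventually.of_forall fun y p _ => ?_
    have := (((hasDerivAt_id p).mul_const ((y ^ α : ℝ) : ℂ)).sub_const (y:ℂ)).cexp
    simpa [mul_comm] using this

lemma differentiable_expPowInt {α : ℝ} (h0 : 0 < α) (h1 : α < 1) :
    Differentiable ℂ (expPowInt α) := fun q => (hasDerivAt_expPowInt h0 h1 q).differentiableAt

lemma expPowInt_conj (α : ℝ) (q : ℂ) :
    expPowInt α (starRingEnd ℂ q) = starRingEnd ℂ (expPowInt α q) := by
  unfold expPowInt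
  rw [← integral_conj]
  congr 1
  ext y
  rw [← exp_conj]
  simp

lemma expPowInt_ofReal (α x : ℝ) :
    expPowInt α x = ((∫ y in Ioi (0:ℝ), Real.exp (x * y ^ α - y) : ℝ) : ℂ) := by
  unfold expPowInt
  rw [← integral_complex_ofReal]
  congr 1
  ext y
  push_cast
  rfl

lemma norm_expPowInt_le {α : ℝ} (h0 : 0 < α) (h1 : α < 1) {q : ℂ} {x : ℝ} (hq : q.re ≤ x) :
    ‖expPowInt α q‖ ≤ (expPowInt α x).re := by
  rw [expPowInt_ofReal, ofReal_re]
  have hi := integrableOn_rpow_mul_exp h0 h1 x le_rfl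
  simp only [Real.rpow_zero, one_mul] at hi
  refine norm_integral_le_of_norm_le hi ?_
  refine (ae_restrict_iff' measurableSet_Ioi).2 (Eventually.of_forall fun y hy => ?_)
  have hy' : (0:ℝ) < y := hy
  rw [norm_expPow_integrand]
  gcongr

lemma expPowInt_re_mono {α : ℝ} (h0 : 0 < α) (h1 : α < 1) {x y : ℝ} (hxy : x ≤ y) :
    (expPowInt α x).re ≤ (expPowInt α y).re :=
  (re_le_norm _).trans (norm_expPowInt_le h0 h1 (by simpa using hxy))

lemma expPowInt_re_lt {α : ℝ} (h0 : 0 < α) (h1 : α < 1) {q : ℂ} {x : ℝ} (hq : q.re < x) :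
    (expPowInt α q).re < (expPowInt α x).re := by
  have hi := integrableOn_expPow h0 h1 q
  have hj := integrableOn_expPow h0 h1 (x:ℂ)
  rw [← sub_pos, ← sub_re]
  unfold expPowInt
  rw [← integral_sub hj hi]
  have hre : (∫ y in Ioi (0:ℝ), (exp ((x:ℂ) * ((y ^ α : ℝ) : ℂ) - y) -
      exp (q * ((y ^ α : ℝ) : ℂ) - y))).re = ∫ y in Ioi (0:ℝ),
      (exp ((x:ℂ) * ((y ^ α : ℝ) : ℂ) - y) - exp (q * ((y ^ α : ℝ) : ℂ) - y)).re :=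
    (integral_re (hj.sub hi)).symm
  have hpos : ∀ y : ℝ, 0 < y → 0 < (exp ((x:ℂ) * ((y ^ α : ℝ) : ℂ) - y) -
      exp (q * ((y ^ α : ℝ) : ℂ) - y)).re := by
    intro y hy
    have h2 : (exp (q * ((y ^ α : ℝ) : ℂ) - y)).re ≤ Real.exp (q.re * y ^ α - y) :=
      (re_le_norm _).trans (norm_expPow_integrand α q y).le
    have h3 : (exp ((x:ℂ) * ((y ^ α : ℝ) : ℂ) - y)).re = Real.exp (x * y ^ α - y) := by
      rw [← ofReal_mul, ← ofReal_sub, exp_ofReal_re]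
    have h4 : Real.exp (q.re * y ^ α - y) < Real.exp (x * y ^ α - y) := by
      have : 0 < y ^ α := by positivity
      gcongr
    rw [sub_re]; linarith
  rw [hre, setIntegral_pos_iff_support_of_nonneg_ae]
  · have : Ioi (0:ℝ) ⊆ Function.support (fun y : ℝ => (exp ((x:ℂ) * ((y ^ α : ℝ) : ℂ) - y) -
      exp (q * ((y ^ α : ℝ) : ℂ) - y)).re) ∩ Ioi 0 := fun y hy => ⟨(hpos y hy).ne', hy⟩
    exact lt_of_lt_of_le (by simp) (measure_mono this)
  · exact (ae_restrict_iff' measurableSet_Ioi).2 (Eventually.of_forall fun y hy => (hpos y hy).le)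
  · exact (hj.sub hi).re

/-- The rescaling `y = r t`. -/
lemma expPowInt_scale {α : ℝ} {r : ℝ} (hr : 0 < r) (q : ℂ) :
    expPowInt α (q * ((r ^ (1 - α) : ℝ) : ℂ)) =
      r * ∫ t in Ioi (0:ℝ), exp (-r * (t - q * ((t ^ α : ℝ) : ℂ))) := by
  have h := integral_comp_mul_left_Ioi
    (fun y : ℝ => exp (q * ((r ^ (1 - α) : ℝ) : ℂ) * ((y ^ α : ℝ) : ℂ) - y)) 0 hr
  rw [mul_zero] at h
  have h2 : ∫ t in Ioi (0:ℝ), exp (-r * (t - q * ((t ^ α : ℝ) : ℂ))) =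
      ∫ x in Ioi (0:ℝ), exp (q * ((r ^ (1 - α) : ℝ) : ℂ) * (((r * x) ^ α : ℝ) : ℂ) -
        ((r * x : ℝ) : ℂ)) := by
    refine setIntegral_congr_fun measurableSet_Ioi fun x hx => ?_
    have hx' : (0:ℝ) < x := hx
    have h3 : r ^ (1 - α) * r ^ α = r := by rw [← Real.rpow_add hr]; simp
    have h4 : ((r ^ (1 - α) : ℝ) : ℂ) * ((r ^ α : ℝ) : ℂ) = r := by
      rw [← ofReal_mul, h3]
    rw [Real.mul_rpow hr.le hx'.le]
    congr 1
    push_cast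
    linear_combination (-q * ((x ^ α : ℝ) : ℂ)) * h4
  rw [h2, h]
  unfold expPowInt
  have : (r:ℂ) ≠ 0 := by exact_mod_cast hr.ne'
  simp [this]

lemma expPowInt_deriv_zero_pos {α : ℝ} (h0 : 0 < α) (h1 : α < 1) :
    ∃ c : ℝ, 0 < c ∧ HasDerivAt (expPowInt α) (c:ℂ) 0 := by
  refine ⟨∫ y in Ioi (0:ℝ), y ^ α * Real.exp (-y), ?_, ?_⟩
  · have h := Real.Gamma_eq_integral (s := α + 1) (by linarith)
    have h2 : ∫ y in Ioi (0:ℝ), y ^ α * Real.exp (-y) = Real.Gamma (α + 1) := by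
      rw [h]; congr 1; ext y; rw [mul_comm]; simp
    rw [h2]
    exact Real.Gamma_pos_of_pos (by linarith)
  · have h := hasDerivAt_expPowInt h0 h1 0
    convert h using 1
    rw [← integral_complex_ofReal]
    congr 1
    ext y
    push_cast
    simp

/-- The integrand `exp(-r(t - ζ t^α)) dt` in the logarithmic coordinate `t = e^ℓ`. -/
noncomputable def logKernel (α r : ℝ) (ζ l : ℂ) : ℂ :=
  exp (l - r * (exp l - ζ * exp (α * l)))

lemma differentiable_logKernel (α r : ℝ) (ζ : ℂ) : Differentiable ℂ (logKernel α r ζ) := by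
  unfold logKernel; fun_prop

lemma exp_mul_log_cast {t : ℝ} (ht : 0 < t) (α : ℝ) :
    exp (α * (Real.log t : ℝ)) = ((t ^ α : ℝ) : ℂ) := by
  rw [Real.rpow_def_of_pos ht, mul_comm (Real.log t)]; push_cast; rfl

lemma exp_log_cast {t : ℝ} (ht : 0 < t) : exp (Real.log t : ℝ) = (t : ℂ) := by
  rw [← ofReal_exp, Real.exp_log ht]

lemma exists_logKernel_primitive {α : ℝ} (h0 : 0 < α) (h1 : α < 1) {r : ℝ} (hr : 0 < r) (ζ : ℂ) :
    ∃ P : ℂ → ℂ, (∀ l, HasDerivAt P (logKernel α r ζ l) l) ∧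
      Tendsto (fun σ : ℝ => P σ) atBot (𝓝 0) ∧
      Tendsto (fun σ : ℝ => P σ) atTop (𝓝 (expPowInt α (ζ * ((r ^ (1 - α) : ℝ) : ℂ)) / r)) ∧
      ∀ σ : ℝ, P σ = ∫ t in (0:ℝ)..(Real.exp σ), exp (-r * (t - ζ * ((t ^ α : ℝ) : ℂ))) := by
  obtain ⟨P₀, hP₀⟩ := (differentiable_logKernel α r ζ).isExactOn_univ
  have hr' : (r:ℂ) ≠ 0 := by exact_mod_cast hr.ne'
  set h : ℝ → ℂ := fun t => exp (-r * (t - ζ * ((t ^ α : ℝ) : ℂ))) with hh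
  have hcr := continuous_rpow_cast h0
  have hc : Continuous h := by fun_prop
  have hint : IntegrableOn h (Ioi 0) := by
    have h2 := (integrableOn_Ioi_comp_mul_left_iff
      (fun y : ℝ => exp (ζ * ((r ^ (1 - α) : ℝ) : ℂ) * ((y ^ α : ℝ) : ℂ) - y)) 0 hr).2
      (by rw [mul_zero]; exact integrableOn_expPow h0 h1 _)
    refine h2.congr_fun (fun x hx => ?_) measurableSet_Ioi
    have hx' : (0:ℝ) < x := hx
    have h3 : r ^ (1 - α) * r ^ α = r := by rw [← Real.rpow_add hr]; simp
    have h4 : ((r ^ (1 - α) : ℝ) : ℂ) * ((r ^ α : ℝ) : ℂ) = r := by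
      rw [← ofReal_mul, h3]
    simp only [hh]
    rw [Real.mul_rpow hr.le hx'.le]
    congr 1
    push_cast
    linear_combination (ζ * ((x ^ α : ℝ) : ℂ)) * h4
  have hI : expPowInt α (ζ * ((r ^ (1 - α) : ℝ) : ℂ)) / r = ∫ t in Ioi (0:ℝ), h t := by
    rw [expPowInt_scale hr, mul_div_cancel_left₀ _ hr']
  have hval : ∀ σ : ℝ, P₀ σ - P₀ 0 + ∫ t in (0:ℝ)..1, h t = ∫ t in (0:ℝ)..(Real.exp σ), h t := by
    intro σ
    have hii : ∀ a b : ℝ, IntervalIntegrable h volume a b := fun a b => hc.intervalIntegrable a b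
    have hftc : ∫ t in (1:ℝ)..(Real.exp σ), h t =
        P₀ (Real.log (Real.exp σ) : ℝ) - P₀ (Real.log 1 : ℝ) := by
      refine intervalIntegral.integral_eq_sub_of_hasDerivAt (f := fun t : ℝ => P₀ (Real.log t : ℝ))
        (fun t ht => ?_) (hii _ _)
      have ht' : 0 < t := lt_of_lt_of_le (lt_min one_pos (Real.exp_pos σ)) (by simpa using ht.1)
      have hl : HasDerivAt (fun t : ℝ => ((Real.log t : ℝ) : ℂ)) ((t⁻¹ : ℝ) : ℂ) t :=
        (Real.hasDerivAt_log ht'.ne').ofReal_comp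
      have := (hP₀ (Real.log t : ℝ) (mem_univ _)).comp t hl
      refine this.congr_deriv ?_
      have ht0 : (t:ℂ) ≠ 0 := by exact_mod_cast ht'.ne'
      simp only [hh, logKernel]
      rw [exp_sub, exp_log_cast ht', exp_mul_log_cast ht', neg_mul, exp_neg]
      push_cast
      field_simp
    rw [← intervalIntegral.integral_add_adjacent_intervals (hii 0 1) (hii 1 (Real.exp σ)), hftc]
    simp
    ring
  refine ⟨fun l => P₀ l - P₀ 0 + ∫ t in (0:ℝ)..1, h t, fun l => ?_, ?_, ?_, hval⟩
  · exact ((hP₀ l (mem_univ _)).sub_const _).add_const _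
  · simp_rw [hval]
    have h2 : Continuous fun x : ℝ => ∫ t in (0:ℝ)..x, h t :=
      intervalIntegral.continuous_primitive (fun a b => hc.intervalIntegrable a b) 0
    have := (h2.tendsto 0).comp Real.tendsto_exp_atBot
    simpa [Function.comp_def] using this
  · simp_rw [hval]
    rw [hI]
    exact intervalIntegral_tendsto_integral_Ioi 0 hint Real.tendsto_exp_atTop

lemma norm_primitive_sub_le {P f : ℂ → ℂ} (hP : ∀ l, HasDerivAt P (f l) l) {z w : ℂ} {C : ℝ}
    (hC : ∀ x ∈ segment ℝ z w, ‖f x‖ ≤ C) : ‖P w - P z‖ ≤ C * ‖w - z‖ :=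
  (convex_segment z w).norm_image_sub_le_of_norm_hasDerivWithin_le
    (fun x _ => (hP x).hasDerivWithinAt) hC (left_mem_segment _ _ _) (right_mem_segment _ _ _)

lemma norm_logKernel (α r : ℝ) (ζ l : ℂ) : ‖logKernel α r ζ l‖ =
    Real.exp (l.re - r * (Real.exp l.re * Real.cos l.im - (ζ * exp (α * l)).re)) := by
  unfold logKernel
  rw [norm_exp]
  simp [exp_re]

lemma norm_logKernel_le {α r : ℝ} (hr : 0 ≤ r) (ζ l : ℂ) : ‖logKernel α r ζ l‖ ≤
    Real.exp (l.re - r * (Real.exp l.re * Real.cos l.im - ‖ζ‖ * Real.exp (α * l.re))) := by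
  rw [norm_logKernel]
  gcongr
  refine (re_le_norm _).trans ?_
  rw [norm_mul, norm_exp]
  simp

lemma mem_segment_re_vertical {l x : ℂ} (hx : x ∈ segment ℝ (l.re : ℂ) l) :
    x.re = l.re ∧ ∃ a ∈ Icc (0:ℝ) 1, x.im = a * l.im := by
  obtain ⟨a, b, ha, hb, hab, rfl⟩ := hx
  refine ⟨?_, b, ⟨hb, by linarith⟩, ?_⟩
  · simp [← add_mul, hab]
  · simp

lemma tendsto_primitive_left {α : ℝ} (h0 : 0 < α) {r : ℝ} (hr : 0 < r) {ζ : ℂ} {P : ℂ → ℂ}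
    (hP : ∀ l, HasDerivAt P (logKernel α r ζ l) l)
    (hl : Tendsto (fun σ : ℝ => P σ) atBot (𝓝 0)) {ι : Type*} {F : Filter ι} {p : ι → ℂ}
    (hre : Tendsto (fun i => (p i).re) F atBot) {V : ℝ} (him : ∀ i, |(p i).im| ≤ V) :
    Tendsto (fun i => P (p i)) F (𝓝 0) := by
  have hE : Tendsto (fun σ : ℝ => Real.exp (σ + r * (Real.exp σ + ‖ζ‖ * Real.exp (α * σ))) * V)
      atBot (𝓝 0) := by
    rw [show (0:ℝ) = 0 * V by ring]
    refine Tendsto.mul_const V (Real.tendsto_exp_atBot.comp ?_)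
    refine tendsto_atBot_add_right_of_ge' _ (r * (1 + ‖ζ‖ * 1)) tendsto_id ?_
    filter_upwards [eventually_le_atBot 0] with σ hσ
    gcongr
    · exact Real.exp_le_one_iff.2 hσ
    · exact Real.exp_le_one_iff.2 (mul_nonpos_of_nonneg_of_nonpos h0.le hσ)
  have hd : Tendsto (fun i => P (p i) - P ((p i).re : ℂ)) F (𝓝 0) := by
    refine squeeze_zero_norm (fun i => ?_) (hE.comp hre)
    refine (norm_primitive_sub_le hP (C := Real.exp ((p i).re + r * (Real.exp (p i).re +
      ‖ζ‖ * Real.exp (α * (p i).re)))) fun x hx => ?_).trans ?_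
    · refine (norm_logKernel_le hr.le ζ x).trans ?_
      rw [(mem_segment_re_vertical hx).1]
      have hc := Real.neg_one_le_cos x.im
      have he := Real.exp_pos (p i).re
      have : -(Real.exp (p i).re * Real.cos x.im - ‖ζ‖ * Real.exp (α * (p i).re)) ≤
        Real.exp (p i).re + ‖ζ‖ * Real.exp (α * (p i).re) := by nlinarith
      have := mul_le_mul_of_nonneg_left this hr.le
      apply Real.exp_le_exp.2
      linarith
    · simp only [Function.comp]
      gcongr
      have : p i - ((p i).re : ℂ) = (p i).im * I := by
        apply Complex.ext <;> simp
      rw [this]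
      simpa using him i
  simpa using hd.add (hl.comp hre)

lemma tendsto_primitive_right {f : ℂ → ℂ} {P : ℂ → ℂ} {L : ℂ}
    (hP : ∀ l, HasDerivAt P (f l) l)
    (hl : Tendsto (fun σ : ℝ => P σ) atTop (𝓝 L)) {ι : Type*} {F : Filter ι} {p : ι → ℂ}
    (hre : Tendsto (fun i => (p i).re) F atTop) {V : ℝ} (him : ∀ i, |(p i).im| ≤ V)
    {E : ι → ℝ} (hE : Tendsto E F (𝓝 0))
    (hb : ∀ᶠ i in F, ∀ x ∈ segment ℝ ((p i).re : ℂ) (p i), ‖f x‖ ≤ E i) :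
    Tendsto (fun i => P (p i)) F (𝓝 L) := by
  have hd : Tendsto (fun i => P (p i) - P ((p i).re : ℂ)) F (𝓝 0) := by
    refine squeeze_zero_norm' ?_ (by simpa using hE.mul_const V)
    filter_upwards [hb] with i hi
    refine (norm_primitive_sub_le hP hi).trans ?_
    have : p i - ((p i).re : ℂ) = (p i).im * I := by
      apply Complex.ext <;> simp
    rw [this]
    have hE0 : 0 ≤ E i := (norm_nonneg _).trans (hi _ (left_mem_segment _ _ _))
    gcongr
    simpa using him i
  simpa using hd.add (hl.comp hre)

/-- The exponential rate `δ_α`. -/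
noncomputable def decayRate (α : ℝ) : ℝ := (1 - α) * α ^ (α / (1 - α))

lemma decayRate_pos {α : ℝ} (h0 : 0 < α) (h1 : α < 1) : 0 < decayRate α := by
  unfold decayRate
  have : 0 < 1 - α := by linarith
  positivity

/-- The minimiser of `t - t^α`. -/
noncomputable def critPt (α : ℝ) : ℝ := α ^ (1 / (1 - α))

lemma critPt_pos {α : ℝ} (h0 : 0 < α) : 0 < critPt α := by unfold critPt; positivity

lemma critPt_rpow {α : ℝ} (h0 : 0 < α) : critPt α ^ α = α ^ (α / (1 - α)) := by
  unfold critPt; rw [← Real.rpow_mul h0.le]; congr 1; ring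

lemma critPt_eq {α : ℝ} (h0 : 0 < α) (h1 : α < 1) : critPt α = α * critPt α ^ α := by
  rw [critPt_rpow h0]
  unfold critPt
  have h : 1 - α ≠ 0 := by linarith
  rw [show 1 / (1 - α) = 1 + α / (1 - α) by field_simp; ring, Real.rpow_add h0, Real.rpow_one]

lemma critPt_sub {α : ℝ} (h0 : 0 < α) (h1 : α < 1) :
    critPt α - critPt α ^ α = -decayRate α := by
  have h := critPt_eq h0 h1
  rw [critPt_rpow h0] at *
  unfold decayRate
  linarith

lemma sub_rpow_add_decayRate_nonneg {α : ℝ} (h0 : 0 < α) (h1 : α < 1) {t : ℝ} (ht : 0 ≤ t) :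
    0 ≤ t - t ^ α + decayRate α := by
  have hs := critPt_pos h0
  have he := critPt_eq h0 h1
  have hd := critPt_sub h0 h1
  have hb := rpow_one_add_le_one_add_mul_self (s := t / critPt α - 1)
    (by have : 0 ≤ t / critPt α := by positivity
        linarith) h0.le h1.le
  rw [add_sub_cancel, Real.div_rpow ht hs.le] at hb
  have hp : 0 < critPt α ^ α := by positivity
  rw [div_le_iff₀ hp] at hb
  have h2 : (1 + α * (t / critPt α - 1)) * critPt α ^ α = (1 - α) * critPt α ^ α + t := by
    have : α * (t / critPt α) * critPt α ^ α = t := by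
      rw [mul_right_comm, ← he]; field_simp
    linear_combination this
  rw [h2] at hb
  linarith

lemma exists_expPowInt_re_le {α : ℝ} (h0 : 0 < α) (h1 : α < 1) : ∃ C : ℝ, 0 ≤ C ∧
    ∀ r : ℝ, 0 < r →
      (expPowInt α ((r ^ (1 - α) : ℝ) : ℂ)).re ≤ C * (1 + r) * Real.exp (decayRate α * r) := by
  have hJ1 : 0 ≤ (expPowInt α 1).re := by
    have := norm_expPowInt_le h0 h1 (q := 1) (x := 1) (by simp)
    rw [ofReal_one] at this
    exact (norm_nonneg _).trans this
  have hδ := decayRate_pos h0 h1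
  refine ⟨(expPowInt α 1).re, hJ1, fun r hr => ?_⟩
  rcases le_total r 1 with hr1 | hr1
  · have h2 : (expPowInt α ((r ^ (1 - α) : ℝ) : ℂ)).re ≤ (expPowInt α ((1:ℝ):ℂ)).re :=
      expPowInt_re_mono h0 h1 (Real.rpow_le_one hr.le hr1 (by linarith))
    rw [ofReal_one] at h2
    have h3 : 1 ≤ Real.exp (decayRate α * r) := Real.one_le_exp (by positivity)
    have h4 : 1 ≤ (1 + r) * Real.exp (decayRate α * r) := by nlinarith
    nlinarith
  · have hs := expPowInt_scale (α := α) hr 1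
    rw [one_mul] at hs
    have hs1 := expPowInt_scale (α := α) one_pos 1
    simp only [one_mul, Real.one_rpow, ofReal_one] at hs1
    have hkey : ‖∫ t in Ioi (0:ℝ), exp (-r * (t - 1 * ((t ^ α : ℝ) : ℂ)))‖ ≤
        ∫ t in Ioi (0:ℝ), Real.exp (decayRate α * r) * Real.exp (1 * t ^ α - t) := by
      have hi := integrableOn_rpow_mul_exp h0 h1 1 le_rfl
      simp only [Real.rpow_zero, one_mul] at hi
      simp only [one_mul]
      refine norm_integral_le_of_norm_le (hi.const_mul _) ?_
      refine (ae_restrict_iff' measurableSet_Ioi).2 (Eventually.of_forall fun t ht => ?_)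
      have ht' : (0:ℝ) < t := ht
      rw [norm_exp, ← Real.exp_add]
      apply Real.exp_le_exp.2
      have := sub_rpow_add_decayRate_nonneg h0 h1 ht'.le
      simp only [mul_re, neg_re, ofReal_re, sub_re, neg_im, ofReal_im, sub_im, neg_zero, zero_mul,
        sub_zero]
      nlinarith
    rw [integral_const_mul] at hkey
    have hJ : (expPowInt α 1).re = ∫ t in Ioi (0:ℝ), Real.exp (1 * t ^ α - t) := by
      have := expPowInt_ofReal α 1
      rw [ofReal_one] at this
      rw [this, ofReal_re]
    rw [← hJ] at hkey
    calc (expPowInt α ((r ^ (1 - α) : ℝ) : ℂ)).re ≤ ‖expPowInt α ((r ^ (1 - α) : ℝ) : ℂ)‖ :=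
          re_le_norm _
      _ = r * ‖∫ t in Ioi (0:ℝ), exp (-r * (t - 1 * ((t ^ α : ℝ) : ℂ)))‖ := by
          rw [hs, norm_mul, norm_real, Real.norm_of_nonneg hr.le]
      _ ≤ r * (Real.exp (decayRate α * r) * (expPowInt α 1).re) := by gcongr
      _ ≤ _ := by
          have : 0 ≤ Real.exp (decayRate α * r) * (expPowInt α 1).re := by positivity
          nlinarith

/-! Rotation to the vertical line through the critical point. -/

lemma re_exp_mul_log (α : ℝ) (s : ℂ) :
    (exp (α * log s)).re = Real.exp (α * Real.log ‖s‖) * Real.cos (α * s.arg) := by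
  rw [exp_re]; simp [log_re, log_im]

lemma arg_vertical {a τ : ℝ} (ha : 0 < a) (hτ : 0 ≤ τ) :
    0 ≤ ((a:ℂ) + τ * I).arg ∧ ((a:ℂ) + τ * I).arg < Real.pi / 2 := by
  constructor
  · rw [arg_nonneg_iff]; simpa
  · have := (abs_arg_lt_pi_div_two_iff (z := (a:ℂ) + τ * I)).2 (Or.inl (by simpa))
    exact (abs_lt.1 this).2

lemma vertical_mem_slitPlane {a : ℝ} (ha : 0 < a) (τ : ℝ) : (a:ℂ) + τ * I ∈ slitPlane :=
  Or.inl (by simpa)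

lemma hasDerivAt_log_vertical {a : ℝ} (ha : 0 < a) (τ : ℝ) :
    HasDerivAt (fun τ : ℝ => log ((a:ℂ) + τ * I)) (I / ((a:ℂ) + τ * I)) τ := by
  have h : HasDerivAt (fun τ : ℝ => (a:ℂ) + τ * I) I τ := by
    simpa using ((hasDerivAt_id τ).ofReal_comp.mul_const I).const_add (a:ℂ)
  exact h.clog_real (vertical_mem_slitPlane ha τ)

lemma re_cpow_vertical_ge_left {α : ℝ} (h0 : 0 < α) (h1 : α < 1) {a : ℝ} (ha : 0 < a) {τ : ℝ}
    (hτ : 0 ≤ τ) : a ^ α ≤ (exp (α * log ((a:ℂ) + τ * I))).re := by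
  have hmono : MonotoneOn (fun τ : ℝ => (exp (α * log ((a:ℂ) + τ * I))).re) (Ici 0) := by
    have hd : ∀ τ : ℝ, HasDerivAt (fun τ : ℝ => (exp (α * log ((a:ℂ) + τ * I))).re)
        (exp (α * log ((a:ℂ) + τ * I)) * (α * (I / ((a:ℂ) + τ * I)))).re τ := by
      intro τ
      have := (((hasDerivAt_log_vertical ha τ).const_mul (α:ℂ)).cexp)
      exact (Complex.reCLM.hasFDerivAt.comp_hasDerivAt τ this)
    refine monotoneOn_of_deriv_nonneg (convex_Ici 0)
      (fun τ _ => (hd τ).continuousAt.continuousWithinAt)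
      (fun τ _ => (hd τ).differentiableAt.differentiableWithinAt) fun τ hτ => ?_
    rw [interior_Ici] at hτ
    have hτ' : 0 < τ := hτ
    rw [(hd τ).deriv]
    set s : ℂ := (a:ℂ) + τ * I with hs
    have hs0 : s ≠ 0 := slitPlane_ne_zero (vertical_mem_slitPlane ha τ)
    have h2 : exp (α * log s) * (α * (I / s)) = α * (I * exp (((α - 1 : ℝ) : ℂ) * log s)) := by
      have : exp (((α - 1 : ℝ) : ℂ) * log s) = exp (α * log s) / s := by
        push_cast
        rw [sub_mul, one_mul, exp_sub, exp_log hs0]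
      rw [this]; field_simp
    rw [h2, re_ofReal_mul]
    refine mul_nonneg h0.le ?_
    rw [I_mul_re, exp_im, neg_nonneg]
    refine mul_nonpos_of_nonneg_of_nonpos (Real.exp_pos _).le ?_
    have harg := arg_vertical ha hτ'.le
    rw [← hs] at harg
    apply Real.sin_nonpos_of_nonpos_of_neg_pi_le
    · rw [im_ofReal_mul, log_im]
      nlinarith
    · rw [im_ofReal_mul, log_im]
      nlinarith [Real.pi_pos]
  have h := hmono (by simp : (0:ℝ) ∈ Ici (0:ℝ)) (hτ : τ ∈ Ici (0:ℝ)) hτ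
  refine le_trans (le_of_eq ?_) h
  simp only [ofReal_zero, zero_mul, add_zero]
  rw [← ofReal_log ha.le, exp_mul_log_cast ha, ofReal_re]

lemma re_cpow_vertical_ge_rpow {α : ℝ} (h0 : 0 < α) (h1 : α < 1) {a : ℝ} (ha : 0 < a) {τ : ℝ}
    (hτ : 0 < τ) :
    Real.cos (α * (Real.pi / 2)) * τ ^ α ≤ (exp (α * log ((a:ℂ) + τ * I))).re := by
  rw [re_exp_mul_log, mul_comm]
  have harg := arg_vertical ha hτ.le
  have hp := Real.pi_pos
  have hn : τ ≤ ‖(a:ℂ) + τ * I‖ := by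
    have := im_le_norm ((a:ℂ) + τ * I)
    simpa using this
  have h2 : τ ^ α ≤ Real.exp (α * Real.log ‖(a:ℂ) + τ * I‖) := by
    rw [Real.rpow_def_of_pos hτ, mul_comm]
    gcongr
  have h3 : Real.cos (α * (Real.pi / 2)) ≤ Real.cos (α * ((a:ℂ) + τ * I).arg) := by
    apply Real.cos_le_cos_of_nonneg_of_le_pi
    · exact mul_nonneg h0.le harg.1
    · nlinarith
    · exact mul_le_mul_of_nonneg_left harg.2.le h0.le
  have h4 : 0 ≤ Real.cos (α * (Real.pi / 2)) := by
    apply Real.cos_nonneg_of_neg_pi_div_two_le_of_le <;> nlinarith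
  exact mul_le_mul h2 h3 h4 (Real.exp_pos _).le

/-- The kernel on the rotated ray, expressed through `s = e^{l + iπ}`. -/
lemma logKernel_shift (α x : ℝ) (l : ℂ) :
    logKernel α x (-exp (Real.pi * α * I)) (l - Real.pi * I) =
      -exp (l + x * (exp l - exp (α * l))) := by
  unfold logKernel
  have h1 : exp (l - Real.pi * I) = -exp l := by
    rw [exp_sub, exp_pi_mul_I]; ring
  have h2 : exp (Real.pi * α * I) * exp (α * (l - Real.pi * I)) = exp (α * l) := by
    rw [← exp_add]; congr 1; ring
  rw [h1, neg_mul, h2, show l - Real.pi * I - x * (-exp l - -exp (α * l)) =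
    l + x * (exp l - exp (α * l)) - Real.pi * I by ring, exp_sub, exp_pi_mul_I]
  ring

lemma norm_logKernel_shift (α x σ v : ℝ) :
    ‖logKernel α x (-exp (Real.pi * α * I)) ((σ + v * I) - Real.pi * I)‖ =
      Real.exp (σ + x * (Real.exp σ * Real.cos v - Real.exp (α * σ) * Real.cos (α * v))) := by
  rw [logKernel_shift, norm_neg, norm_exp]
  congr 1
  simp [exp_re]

lemma tendsto_exp_sub_exp_atBot {x c : ℝ} (hx : 0 < x) (hc : 0 < c) {β : ℝ} (hβ : 0 < β) (k : ℝ) :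
    Tendsto (fun σ : ℝ => Real.exp (σ + x * (k - c * Real.exp (β * σ)))) atTop (𝓝 0) := by
  apply Real.tendsto_exp_atBot.comp
  have h1 : Tendsto (fun σ : ℝ => Real.exp (β * σ) / (β * σ)) atTop atTop := by
    have := (Real.tendsto_exp_div_pow_atTop 1).comp (tendsto_id.const_mul_atTop hβ)
    simpa [Function.comp_def] using this
  have h2 : Tendsto (fun σ : ℝ => σ * (1 - x * c * β * (Real.exp (β * σ) / (β * σ)))) atTop
      atBot := by
    apply tendsto_id.atTop_mul_atBot₀
    have := tendsto_atBot_add_const_left atTop (1:ℝ)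
      (tendsto_neg_atTop_atBot.comp (h1.const_mul_atTop (show 0 < x * c * β by positivity)))
    simpa [Function.comp_def, sub_eq_add_neg] using this
  have h3 := tendsto_atBot_add_const_right atTop (x * k) h2
  refine h3.congr' ?_
  filter_upwards [eventually_gt_atTop 0] with σ hσ
  field_simp
  ring

lemma tendsto_exp_sub_exp_atBot' {α : ℝ} (h0 : 0 < α) (h1 : α < 1) {x c : ℝ} (hx : 0 < x)
    (hc : 0 < c) :
    Tendsto (fun σ : ℝ => Real.exp (σ + x * (Real.exp (α * σ) - c * Real.exp σ))) atTop (𝓝 0) := by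
  obtain ⟨C, -, hC⟩ := mul_rpow_le_linear h0 h1 1 (show 0 < c / 2 by positivity)
  refine squeeze_zero (fun σ => (Real.exp_pos _).le) (fun σ => ?_)
    (tendsto_exp_sub_exp_atBot hx (show 0 < c / 2 by positivity) one_pos C)
  have := hC (Real.exp σ) (Real.exp_pos _).le
  rw [← Real.exp_mul, mul_comm σ α] at this
  rw [one_mul]
  apply Real.exp_le_exp.2
  have h7 : Real.exp (α * σ) - c * Real.exp σ ≤ C - c / 2 * Real.exp σ := by linarith
  have := mul_le_mul_of_nonneg_left h7 hx.le
  linarith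

lemma exists_im_expPowInt_le {α : ℝ} (h0 : 1 / 2 ≤ α) (h1 : α < 1) : ∃ C : ℝ, 0 ≤ C ∧
    ∀ x : ℝ, 1 ≤ x → |(expPowInt α (-exp (Real.pi * α * I) * ((x ^ (1 - α) : ℝ) : ℂ))).im| ≤
      C * x * Real.exp (-decayRate α * x) := by
  have hα : 0 < α := by linarith
  have hp := Real.pi_pos
  set a := critPt α with ha
  have ha0 : 0 < a := critPt_pos hα
  set g : ℝ → ℝ := fun τ => Real.exp (a ^ α - (exp (α * log ((a:ℂ) + τ * I))).re) with hg
  have hlogc : Continuous fun τ : ℝ => log ((a:ℂ) + τ * I) :=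
    continuous_iff_continuousAt.2 fun τ => (hasDerivAt_log_vertical ha0 τ).continuousAt
  have hgc : Continuous g := by
    have := continuous_re
    fun_prop
  have hκ : 0 < Real.cos (α * (Real.pi / 2)) :=
    Real.cos_pos_of_mem_Ioo ⟨by nlinarith, by nlinarith⟩
  have hgi : IntegrableOn g (Ioi 0) := by
    have hi := (integrableOn_rpow_mul_exp_neg_mul_rpow (p := α) (s := 0)
      (b := Real.cos (α * (Real.pi / 2))) (by norm_num) hα hκ).const_mul (Real.exp (a ^ α))
    refine hi.mono' hgc.aestronglyMeasurable ?_
    refine (ae_restrict_iff' measurableSet_Ioi).2 (Eventually.of_forall fun τ hτ => ?_)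
    have := re_cpow_vertical_ge_rpow hα h1 ha0 hτ
    rw [Real.norm_of_nonneg (Real.exp_pos _).le, Real.rpow_zero, one_mul, ← Real.exp_add]
    apply Real.exp_le_exp.2
    linarith
  refine ⟨∫ τ in Ioi (0:ℝ), g τ, integral_nonneg fun τ => (Real.exp_pos _).le, fun x hx => ?_⟩
  have hx0 : 0 < x := by linarith
  obtain ⟨P, hP, hP0, hPI, -⟩ := exists_logKernel_primitive hα h1 hx0 (-exp (Real.pi * α * I))
  set K := expPowInt α (-exp (Real.pi * α * I) * ((x ^ (1 - α) : ℝ) : ℂ)) with hK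
  -- the primitive is real on the line `Im = -π`
  have hreal : ∀ σ : ℝ, (P (σ - Real.pi * I)).im = 0 := by
    have hd : ∀ σ : ℝ, HasDerivAt (fun σ : ℝ => (P (σ - Real.pi * I)).im) 0 σ := by
      intro σ
      have h2 : HasDerivAt (fun σ : ℝ => (σ:ℂ) - Real.pi * I) 1 σ := by
        simpa using (hasDerivAt_id σ).ofReal_comp.sub_const ((Real.pi:ℂ) * I)
      have h3 := (hP (σ - Real.pi * I)).comp σ h2
      have h4 := Complex.imCLM.hasFDerivAt.comp_hasDerivAt σ h3
      refine h4.congr_deriv ?_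
      rw [mul_one, logKernel_shift]
      have : (σ:ℂ) + x * (exp σ - exp (α * σ)) =
          ((σ + x * (Real.exp σ - Real.exp (α * σ)) : ℝ) : ℂ) := by push_cast; rfl
      rw [this, ← ofReal_exp, imCLM_apply, neg_im, ofReal_im, neg_zero]
    have hconst : ∀ σ σ' : ℝ, (P (σ - Real.pi * I)).im = (P (σ' - Real.pi * I)).im :=
      is_const_of_deriv_eq_zero (fun σ => (hd σ).differentiableAt) fun σ => (hd σ).deriv
    have hlim := tendsto_primitive_left hα hx0 hP hP0 (F := atBot)
      (p := fun σ : ℝ => (σ:ℂ) - Real.pi * I) (V := Real.pi)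
      (tendsto_id.congr fun σ => by simp) (fun i => by simp [abs_of_pos hp])
    intro σ
    have h5 := (continuous_im.tendsto _).comp hlim
    have h6 : Tendsto (fun _ : ℝ => (P (σ - Real.pi * I)).im) atBot (𝓝 (0:ℂ).im) :=
      h5.congr fun σ' => hconst σ' σ
    simpa using tendsto_nhds_unique tendsto_const_nhds h6
  set p : ℝ → ℂ := fun τ => log ((a:ℂ) + τ * I) - Real.pi * I with hpdef
  have hpd : ∀ τ : ℝ, HasDerivAt p (I / ((a:ℂ) + τ * I)) τ := fun τ =>
    (hasDerivAt_log_vertical ha0 τ).sub_const _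
  have hPd : ∀ τ : ℝ, HasDerivAt (fun τ => P (p τ))
      (-(I * exp (x * ((a + τ * I) - exp (α * log ((a:ℂ) + τ * I)))))) τ := by
    intro τ
    refine ((hP (p τ)).comp τ (hpd τ)).congr_deriv ?_
    have hs0 := slitPlane_ne_zero (vertical_mem_slitPlane ha0 τ)
    simp only [hpdef]
    rw [logKernel_shift, exp_add, exp_log hs0]
    field_simp
  have hnorm : ∀ τ : ℝ, 0 ≤ τ → ‖-(I * exp (x * ((a + τ * I) - exp (α * log ((a:ℂ) + τ * I)))))‖ ≤
      Real.exp (-decayRate α * x) * g τ := by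
    intro τ hτ
    rw [norm_neg, norm_mul, norm_I, one_mul, norm_exp, ← Real.exp_add]
    apply Real.exp_le_exp.2
    have h3 := re_cpow_vertical_ge_left hα h1 ha0 hτ
    have h4 := critPt_sub hα h1
    rw [← ha] at h4
    rw [re_ofReal_mul, sub_re, add_re, ofReal_re]
    simp only [re_ofReal_mul, I_re, mul_zero, add_zero]
    nlinarith
  have hbound : ∀ τ : ℝ, 0 ≤ τ → |(P (p τ)).im| ≤
      Real.exp (-decayRate α * x) * ∫ τ in Ioi (0:ℝ), g τ := by
    intro τ hτ
    have hp0 : (P (p 0)).im = 0 := by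
      have := hreal (Real.log a)
      rw [ofReal_log ha0.le] at this
      simpa [hpdef] using this
    have hftc : ∫ t in (0:ℝ)..τ, -(I * exp (x * ((a + t * I) - exp (α * log ((a:ℂ) + t * I))))) =
        P (p τ) - P (p 0) :=
      intervalIntegral.integral_eq_sub_of_hasDerivAt (fun t _ => hPd t)
        (Continuous.intervalIntegrable (by fun_prop) _ _)
    have h5 : ‖P (p τ) - P (p 0)‖ ≤ ∫ t in (0:ℝ)..τ, Real.exp (-decayRate α * x) * g t := by
      rw [← hftc]
      refine intervalIntegral.norm_integral_le_of_norm_le hτ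
        (Eventually.of_forall fun t ht => hnorm t ht.1.le)
        ((hgc.const_mul _).intervalIntegrable _ _)
    have h6 : (P (p τ)).im = (P (p τ) - P (p 0)).im := by rw [sub_im, hp0, sub_zero]
    rw [h6]
    refine (abs_im_le_norm _).trans (h5.trans ?_)
    rw [intervalIntegral.integral_const_mul]
    refine mul_le_mul_of_nonneg_left ?_ (Real.exp_pos _).le
    rw [intervalIntegral.integral_of_le hτ]
    exact setIntegral_mono_set hgi (Eventually.of_forall fun t => (Real.exp_pos _).le)
      Ioc_subset_Ioi_self.eventuallyLE
  -- the far end of the contour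
  have hnormtop : Tendsto (fun τ : ℝ => ‖(a:ℂ) + τ * I‖) atTop atTop := by
    refine tendsto_atTop_mono (fun τ => ?_) tendsto_id
    have := im_le_norm ((a:ℂ) + τ * I)
    simpa using this
  have hretop : Tendsto (fun τ => (p τ).re) atTop atTop := by
    have := Real.tendsto_log_atTop.comp hnormtop
    refine this.congr fun τ => ?_
    simp [hpdef, log_re]
  have hlim : Tendsto (fun τ : ℝ => P (p τ)) atTop (𝓝 (K / x)) := by
    set v1 : ℝ := (Real.pi / 2 + Real.pi / (2 * α)) / 2 with hv1
    have hlt : Real.pi / 2 < Real.pi / (2 * α) := by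
      apply div_lt_div_of_pos_left hp (by linarith) (by linarith)
    have hle : Real.pi / (2 * α) ≤ Real.pi := by
      apply div_le_self hp.le; linarith
    have hv1a : Real.pi / 2 < v1 := by linarith
    have hv1b : v1 < Real.pi / (2 * α) := by linarith
    have hv1c : α * v1 < Real.pi / 2 := by
      rw [lt_div_iff₀ (by positivity)] at hv1b; linarith
    have hc1 : 0 < Real.cos (α * v1) := Real.cos_pos_of_mem_Ioo ⟨by nlinarith, hv1c⟩
    have hc2 : 0 < -Real.cos v1 := by
      have := Real.cos_neg_of_pi_div_two_lt_of_lt hv1a (by linarith)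
      linarith
    -- comparison for the two ranges of the angle
    have hE2 := tendsto_exp_sub_exp_atBot' hα h1 hx0 hc2
    have hE := ((tendsto_exp_sub_exp_atBot hx0 hc1 hα a).add hE2).comp hretop
    rw [add_zero] at hE
    refine tendsto_primitive_right hP hPI hretop (V := 2 * Real.pi) (fun τ => ?_) hE ?_
    · have h8 := neg_pi_lt_arg ((a:ℂ) + τ * I)
      have h9 := arg_le_pi ((a:ℂ) + τ * I)
      simp only [hpdef, sub_im, log_im, im_ofReal_mul, I_im, mul_one]
      rw [abs_le]; constructor <;> linarith
    · filter_upwards [eventually_ge_atTop 0] with τ hτ z hz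
      obtain ⟨hzre, b, hb, hzim⟩ := mem_segment_re_vertical hz
      have harg := arg_vertical ha0 hτ
      set w := ((a:ℂ) + τ * I).arg with hw
      set v : ℝ := z.im + Real.pi with hv
      have hpim : (p τ).im = w - Real.pi := by simp [hpdef, log_im, hw]
      have hvw : w ≤ v := by
        rw [hv, hzim, hpim]; nlinarith [hb.1, hb.2]
      have hvp : v ≤ Real.pi := by
        rw [hv, hzim, hpim]; nlinarith [hb.1, hb.2]
      have hzeq : z = (((p τ).re : ℂ) + v * I) - Real.pi * I := by
        apply Complex.ext
        · simp [hzre]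
        · simp [hv]
      rw [hzeq, norm_logKernel_shift]
      set σ := (p τ).re with hσ
      have hea : Real.exp σ * Real.cos w = a := by
        have h9 : Real.exp σ = ‖(a:ℂ) + τ * I‖ := by
          simp only [hσ, hpdef, sub_re, log_re, re_ofReal_mul, I_re, mul_zero, sub_zero]
          exact Real.exp_log (norm_pos_iff.2 (slitPlane_ne_zero (vertical_mem_slitPlane ha0 τ)))
        rw [h9, norm_mul_cos_arg]
        simp
      have hcosle : Real.cos v ≤ Real.cos w :=
        Real.cos_le_cos_of_nonneg_of_le_pi harg.1 hvp hvw
      have hv0 : 0 ≤ v := harg.1.trans hvw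
      have hes := Real.exp_pos σ
      have hesα := Real.exp_pos (α * σ)
      simp only [Function.comp]
      rcases le_total v v1 with hvv | hvv
      · have h10 : Real.cos (α * v1) ≤ Real.cos (α * v) := by
          apply Real.cos_le_cos_of_nonneg_of_le_pi
          · positivity
          · linarith
          · gcongr
        refine le_trans (Real.exp_le_exp.2 ?_) (le_add_of_nonneg_right (Real.exp_pos _).le)
        have h11 : Real.exp σ * Real.cos v - Real.exp (α * σ) * Real.cos (α * v) ≤
          a - Real.cos (α * v1) * Real.exp (α * σ) := by nlinarith
        have := mul_le_mul_of_nonneg_left h11 hx0.le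
        linarith
      · have h10 : Real.cos v ≤ Real.cos v1 :=
          Real.cos_le_cos_of_nonneg_of_le_pi (by linarith) hvp hvv
        refine le_trans (Real.exp_le_exp.2 ?_) (le_add_of_nonneg_left (Real.exp_pos _).le)
        have h12 := Real.neg_one_le_cos (α * v)
        have h11 : Real.exp σ * Real.cos v - Real.exp (α * σ) * Real.cos (α * v) ≤
          Real.exp (α * σ) - -Real.cos v1 * Real.exp σ := by nlinarith
        have := mul_le_mul_of_nonneg_left h11 hx0.le
        linarith
  have hfin : |(K / x).im| ≤ Real.exp (-decayRate α * x) * ∫ τ in Ioi (0:ℝ), g τ := by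
    have h := ((continuous_abs.comp continuous_im).tendsto _).comp hlim
    refine le_of_tendsto h ?_
    filter_upwards [eventually_ge_atTop 0] with τ hτ using hbound τ hτ
  have hKx : K.im = x * (K / x).im := by
    rw [div_ofReal_im]; field_simp
  rw [hKx, abs_mul, abs_of_pos hx0]
  calc x * |(K / x).im| ≤ x * (Real.exp (-decayRate α * x) * ∫ τ in Ioi (0:ℝ), g τ) := by gcongr
    _ = _ := by ring

lemma exists_continuous_inverse {f : ℝ → ℝ} {S : Set ℝ} (hS : IsOpen S)
    (hm : StrictMonoOn f S) (hsurj : ∀ y, ∃ x ∈ S, f x = y) :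
    ∃ g : ℝ → ℝ, Continuous g ∧ StrictMono g ∧ (∀ y, g y ∈ S ∧ f (g y) = y) ∧
      ∀ x ∈ S, g (f x) = x := by
  choose g hgS hg using hsurj
  have hleft : ∀ x ∈ S, g (f x) = x := fun x hx => hm.injOn (hgS _) hx (hg _)
  have hmono : StrictMono g := by
    intro a b hab
    rw [← hm.lt_iff_lt (hgS a) (hgS b), hg, hg]; exact hab
  refine ⟨g, continuous_iff_continuousAt.2 fun y => ?_, hmono, fun y => ⟨hgS y, hg y⟩, hleft⟩
  refine continuousAt_of_monotoneOn_of_image_mem_nhds (hmono.monotone.monotoneOn univ)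
    univ_mem ?_
  have : g '' univ = S := by
    ext x; constructor
    · rintro ⟨y, -, rfl⟩; exact hgS y
    · intro hx; exact ⟨f x, mem_univ _, hleft x hx⟩
  rw [this]
  exact hS.mem_nhds (hgS y)

lemma surj_of_tendsto_Ioo {f : ℝ → ℝ} {a b : ℝ} (hab : a < b) (hf : ContinuousOn f (Ioo a b))
    (ha : Tendsto f (𝓝[>] a) atBot) (hb : Tendsto f (𝓝[<] b) atTop) (y : ℝ) :
    ∃ x ∈ Ioo a b, f x = y := by
  obtain ⟨x₁, hx₁, h₁⟩ := ((ha.eventually_le_atBot y).and (Ioo_mem_nhdsGT hab)).exists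
  obtain ⟨x₂, hx₂, h₂⟩ := ((hb.eventually_ge_atTop y).and (Ioo_mem_nhdsLT hab)).exists
  exact isPreconnected_Ioo.intermediate_value h₁ h₂ hf ⟨hx₁, hx₂⟩

lemma surj_of_tendsto_Ioi {f : ℝ → ℝ} {a : ℝ} (hf : ContinuousOn f (Ioi a))
    (ha : Tendsto f (𝓝[>] a) atBot) (hb : Tendsto f atTop atTop) (y : ℝ) :
    ∃ x ∈ Ioi a, f x = y := by
  obtain ⟨x₁, hx₁, h₁⟩ := ((ha.eventually_le_atBot y).and self_mem_nhdsWithin).exists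
  obtain ⟨x₂, hx₂, h₂⟩ := ((hb.eventually_ge_atTop y).and (Ioi_mem_atTop a)).exists
  exact isPreconnected_Ioi.intermediate_value h₁ h₂ hf ⟨hx₁, hx₂⟩

/-- A continuous right inverse of `l ↦ e^l - ζ e^{αl}` along the positive reals is differentiable. -/
lemma hasDerivAt_level_curve {α : ℝ} {ζ : ℂ} {p : ℝ → ℂ} (hp : ContinuousOn p (Ioi 0))
    (hu : ∀ w, 0 < w → exp (p w) - ζ * exp (α * p w) = w)
    (hne : ∀ w : ℝ, 0 < w → (1 - α) * exp (p w) + α * w ≠ 0) {w : ℝ} (hw : 0 < w) :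
    HasDerivAt p ((1 - α) * exp (p w) + α * w)⁻¹ w := by
  set u : ℂ → ℂ := fun l => exp l - ζ * exp (α * l) with hudef
  have hsd : HasStrictDerivAt u ((1 - α) * exp (p w) + α * w) (p w) := by
    have h1 : HasStrictDerivAt u (exp (p w) - ζ * (exp (α * p w) * (α * 1))) (p w) :=
      (Complex.hasStrictDerivAt_exp _).sub
        ((((hasStrictDerivAt_id (p w)).const_mul (α:ℂ)).cexp).const_mul ζ)
    convert h1 using 1
    linear_combination (-(α:ℂ)) * hu w hw
  have hloc := hsd.to_localInverse (hne w hw)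
  have hleft := hsd.eventually_left_inverse (hne w hw)
  have hpc : ContinuousAt p w := hp.continuousAt (Ioi_mem_nhds hw)
  have huw : u (p w) = w := hu w hw
  rw [huw] at hloc
  refine hloc.hasDerivAt.comp_ofReal.congr_of_eventuallyEq ?_
  filter_upwards [hpc.eventually hleft, Ioi_mem_nhds hw] with v hv hv0
  rw [← hv]
  congr 1
  exact hu v hv0

lemma norm_exp_level_curve_le {α : ℝ} (h0 : 0 < α) (h1 : α < 1) : ∃ C : ℝ, 0 ≤ C ∧
    ∀ (ζ l : ℂ) (w : ℝ), ‖ζ‖ = 1 → 0 < w → exp l - ζ * exp (α * l) = w →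
      ‖exp l‖ ≤ C * (1 + w) := by
  obtain ⟨C, hC0, hC⟩ := mul_rpow_le_linear h0 h1 1 (show (0:ℝ) < 1 / 2 by norm_num)
  refine ⟨2 * C + 2, by linarith, fun ζ l w hζ hw h => ?_⟩
  have h2 : ‖exp (α * l)‖ = ‖exp l‖ ^ α := by
    rw [norm_exp, norm_exp, ← Real.exp_mul, re_ofReal_mul, mul_comm]
  have h3 : ‖exp l‖ ≤ w + ‖exp l‖ ^ α := by
    have : exp l = w + ζ * exp (α * l) := by rw [← h]; ring
    calc ‖exp l‖ = ‖w + ζ * exp (α * l)‖ := by rw [← this]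
      _ ≤ ‖(w:ℂ)‖ + ‖ζ * exp (α * l)‖ := norm_add_le _ _
      _ = _ := by rw [norm_mul, hζ, h2, one_mul, norm_real, Real.norm_of_nonneg hw.le]
  have h4 := hC ‖exp l‖ (norm_nonneg _)
  nlinarith

lemma integrableOn_one_add_mul_exp {r : ℝ} (hr : 0 < r) :
    IntegrableOn (fun w : ℝ => (1 + w) * Real.exp (-r * w)) (Ioi 0) := by
  have h1 := integrableOn_rpow_mul_exp_neg_mul_rpow (p := 1) (s := 0) (b := r)
    (by norm_num) one_pos hr
  have h2 := integrableOn_rpow_mul_exp_neg_mul_rpow (p := 1) (s := 1) (b := r)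
    (by norm_num) one_pos hr
  refine (h1.add h2).congr_fun (fun w _ => ?_) measurableSet_Ioi
  simp only [Pi.add_apply, Real.rpow_zero, Real.rpow_one]
  ring

lemma integrableOn_mul_exp_of_norm_le {f : ℝ → ℂ} (hf : ContinuousOn f (Ioi 0)) {C : ℝ}
    (hC : ∀ w, 0 < w → ‖f w‖ ≤ C * (1 + w)) {r : ℝ} (hr : 0 < r) :
    IntegrableOn (fun w : ℝ => f w * exp (-r * w)) (Ioi 0) := by
  refine ((integrableOn_one_add_mul_exp hr).const_mul C).mono' ?_ ?_
  · refine ContinuousOn.aestronglyMeasurable (hf.mul (by fun_prop)) measurableSet_Ioi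
  · refine (ae_restrict_iff' measurableSet_Ioi).2 (Eventually.of_forall fun w hw => ?_)
    rw [norm_mul, norm_exp]
    have : (-(r:ℂ) * w).re = -r * w := by simp
    rw [this, ← mul_assoc]
    gcongr
    exact hC w hw

/-- Laplace representation obtained by integrating along a level curve. -/
lemma integral_level_curve {α : ℝ} (h0 : 0 < α) (h1 : α < 1) {ζ : ℂ} (hζ : ‖ζ‖ = 1) {p : ℝ → ℂ}
    (hp : ContinuousOn p (Ioi 0))
    (hu : ∀ w, 0 < w → exp (p w) - ζ * exp (α * p w) = w)
    (hne : ∀ w : ℝ, 0 < w → (1 - α) * exp (p w) + α * w ≠ 0) {r : ℝ} (hr : 0 < r) {P : ℂ → ℂ}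
    (hP : ∀ l, HasDerivAt P (logKernel α r ζ l) l) {P₀ P₁ t₀ : ℂ}
    (hl : Tendsto (fun w => P (p w)) (𝓝[>] 0) (𝓝 P₀))
    (ht : Tendsto (fun w => exp (p w)) (𝓝[>] 0) (𝓝 t₀))
    (hR : Tendsto (fun w => P (p w)) atTop (𝓝 P₁)) :
    r * ∫ w in Ioi (0:ℝ), exp (p w) * exp (-r * w) = P₁ - P₀ + t₀ := by
  obtain ⟨C, hC0, hC⟩ := norm_exp_level_curve_le h0 h1
  set f : ℝ → ℂ := fun w => P (p w) - exp (p w) * exp (-r * w) with hf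
  have hlim0 : Tendsto f (𝓝[>] 0) (𝓝 (P₀ - t₀)) := by
    have he : Tendsto (fun w : ℝ => exp (-r * (w:ℂ))) (𝓝[>] 0) (𝓝 1) := by
      have : Continuous fun w : ℝ => exp (-r * (w:ℂ)) := by fun_prop
      have := (this.tendsto 0).mono_left (nhdsWithin_le_nhds (s := Ioi 0))
      simpa using this
    simpa [hf] using hl.sub (ht.mul he)
  have hlim1 : Tendsto f atTop (𝓝 P₁) := by
    have he : Tendsto (fun w : ℝ => exp (p w) * exp (-r * (w:ℂ))) atTop (𝓝 0) := by
      have hb : Tendsto (fun w : ℝ => C * (1 * Real.exp (-r * w) + w * Real.exp (-r * w))) atTop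
          (𝓝 0) := by
        have h2 : Tendsto (fun w : ℝ => Real.exp (-r * w)) atTop (𝓝 0) :=
          Real.tendsto_exp_atBot.comp (tendsto_id.const_mul_atTop_of_neg (by linarith))
        have h3 : Tendsto (fun w : ℝ => w * Real.exp (-r * w)) atTop (𝓝 0) := by
          have := (Real.tendsto_pow_mul_exp_neg_atTop_nhds_zero 1).comp
            (tendsto_id.const_mul_atTop hr)
          have := this.const_mul r⁻¹
          rw [mul_zero] at this
          refine this.congr fun w => ?_
          simp only [Function.comp, id, pow_one]
          field_simp
        simpa using ((h2.const_mul 1).add h3).const_mul C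
      refine squeeze_zero_norm' ?_ hb
      filter_upwards [eventually_gt_atTop 0] with w hw
      rw [norm_mul, norm_exp (-(r:ℂ) * w)]
      have : (-(r:ℂ) * w).re = -r * w := by simp
      rw [this]
      have := mul_le_mul_of_nonneg_right (hC ζ (p w) w hζ hw (hu w hw)) (Real.exp_pos (-r * w)).le
      linarith
    simpa [hf] using hR.sub he
  have hder : ∀ w ∈ Ioi (0:ℝ), HasDerivAt (Function.update f 0 (P₀ - t₀))
      (r * (exp (p w) * exp (-r * w))) w := by
    intro w hw
    have hw0 : (0:ℝ) < w := hw
    have hpd := hasDerivAt_level_curve hp hu hne hw0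
    have h2 := (hP (p w)).comp w hpd
    have h3 : HasDerivAt (fun w : ℝ => exp (-r * (w:ℂ))) (exp (-r * w) * (-r)) w := by
      simpa using (((hasDerivAt_id w).ofReal_comp).const_mul (-(r:ℂ))).cexp
    have h4 := h2.sub (hpd.cexp.mul h3)
    have h5 : HasDerivAt f (r * (exp (p w) * exp (-r * w))) w := by
      refine h4.congr_deriv ?_
      have : logKernel α r ζ (p w) = exp (p w) * exp (-r * w) := by
        unfold logKernel
        rw [hu w hw0, sub_eq_add_neg, exp_add]
        congr 2; ring
      rw [this]; ring
    refine h5.congr_of_eventuallyEq ?_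
    filter_upwards [Ioi_mem_nhds hw0] with v hv
    exact Function.update_of_ne (ne_of_gt hv) _ _
  have hcont : ContinuousWithinAt (Function.update f 0 (P₀ - t₀)) (Ici 0) 0 := by
    rw [continuousWithinAt_update_same]
    rwa [Ici_sdiff_left]
  have hint := (integrableOn_mul_exp_of_norm_le (f := fun w => exp (p w))
    (continuous_exp.comp_continuousOn hp)
    (fun w hw => hC ζ (p w) w hζ hw (hu w hw)) hr).const_mul (r:ℂ)
  have h6 := integral_Ioi_of_hasDerivAt_of_tendsto hcont hder hint (hlim1.congr' (by
    filter_upwards [eventually_gt_atTop 0] with v hv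
    exact (Function.update_of_ne (ne_of_gt hv) _ _).symm))
  rw [integral_const_mul] at h6
  rw [h6, Function.update_self]
  ring

/-- The endpoint `2π - π/α` of the range of angles of the level curve. -/
noncomputable def maxAngle (α : ℝ) : ℝ := 2 * Real.pi - Real.pi / α

/-- The auxiliary angle `π(2α-1) - αγ`. -/
noncomputable def auxAngle (α γ : ℝ) : ℝ := Real.pi * (2 * α - 1) - α * γ

lemma angle_facts {α : ℝ} (h0 : 1 / 2 < α) (h1 : α < 1) :
    0 < maxAngle α ∧ maxAngle α < Real.pi ∧ auxAngle α (maxAngle α) = 0 ∧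
    ∀ γ, 0 < γ → γ < maxAngle α → 0 < auxAngle α γ ∧ auxAngle α γ + γ < Real.pi := by
  have hp := Real.pi_pos
  have hα : 0 < α := by linarith
  have he : α * maxAngle α = Real.pi * (2 * α - 1) := by unfold maxAngle; field_simp
  have h2 : 0 < maxAngle α := by
    have : 0 < α * maxAngle α := by rw [he]; apply mul_pos hp; linarith
    exact pos_of_mul_pos_right this hα.le
  have h3 : maxAngle α < Real.pi := by
    have : α * maxAngle α < α * Real.pi := by rw [he]; nlinarith
    exact lt_of_mul_lt_mul_left this hα.le
  refine ⟨h2, h3, by unfold auxAngle; linarith, fun γ hγ hγ' => ⟨?_, ?_⟩⟩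
  · unfold auxAngle; nlinarith
  · unfold auxAngle; nlinarith

/-- `(α-1)` times the logarithm of the level `w`, as a function of the angle. -/
noncomputable def angleLevel (α γ : ℝ) : ℝ :=
  -α * Real.log (Real.sin (auxAngle α γ)) + Real.log (Real.sin γ) -
    (1 - α) * Real.log (Real.sin (auxAngle α γ + γ))

lemma sin_angle_pos {α : ℝ} (h0 : 1 / 2 < α) (h1 : α < 1) {γ : ℝ} (hγ : γ ∈ Ioo 0 (maxAngle α)) :
    0 < Real.sin γ ∧ 0 < Real.sin (auxAngle α γ) ∧ 0 < Real.sin (auxAngle α γ + γ) := by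
  obtain ⟨-, h3, -, h5⟩ := angle_facts h0 h1
  obtain ⟨h6, h7⟩ := h5 γ hγ.1 hγ.2
  have := hγ.1
  have := hγ.2
  refine ⟨?_, ?_, ?_⟩ <;> apply Real.sin_pos_of_pos_of_lt_pi <;> linarith

lemma angleLevel_deriv_identity {α a b s d g c : ℝ} (ha : a ≠ 0) (hs : s ≠ 0) (hg : g ≠ 0)
    (hgd : g = s * b - d * a) (hcd : c = d * b + s * a) :
    α ^ 2 * (b / a) + c / g - (1 - α) ^ 2 * (d / s) =
      a * s / g * ((α * (b / a) + (1 - α) * (d / s)) ^ 2 + 1) := by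
  field_simp
  rw [hgd, hcd]
  ring

lemma hasDerivAt_angleLevel {α : ℝ} (h0 : 1 / 2 < α) (h1 : α < 1) {γ : ℝ}
    (hγ : γ ∈ Ioo 0 (maxAngle α)) : ∃ c, 0 < c ∧ HasDerivAt (angleLevel α) c γ := by
  obtain ⟨hg, hx, hs⟩ := sin_angle_pos h0 h1 hγ
  set x := auxAngle α γ with hxd
  have hdx : HasDerivAt (auxAngle α) (-α) γ := by
    exact (((hasDerivAt_id γ).const_mul α).const_sub (Real.pi * (2 * α - 1))).congr_deriv
      (by ring)
  have hA := (hdx.sin.log hx.ne').const_mul (-α)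
  have hB := (Real.hasDerivAt_sin γ).log hg.ne'
  have hC := (((hdx.add (hasDerivAt_id γ)).sin.log hs.ne').const_mul (1 - α))
  have hD := (hA.add hB).sub hC
  refine ⟨_, ?_, hD⟩
  have e1 : Real.sin γ = Real.sin (x + γ) * Real.cos x - Real.cos (x + γ) * Real.sin x := by
    rw [← Real.sin_sub]; congr 1; ring
  have e2 : Real.cos γ = Real.cos (x + γ) * Real.cos x + Real.sin (x + γ) * Real.sin x := by
    rw [← Real.cos_sub]; congr 1; ring
  have hid := angleLevel_deriv_identity (α := α) hx.ne' hs.ne' hg.ne' e1 e2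
  have hpos : 0 < Real.sin x * Real.sin (x + γ) / Real.sin γ *
      ((α * (Real.cos x / Real.sin x) +
        (1 - α) * (Real.cos (x + γ) / Real.sin (x + γ))) ^ 2 + 1) := by positivity
  rw [← hid] at hpos
  convert hpos using 1
  simp only [Pi.add_apply, id, ← hxd]
  ring

lemma tendsto_log_sin_zero {F : Filter ℝ} {f : ℝ → ℝ} (hf : Tendsto f F (𝓝[>] 0)) :
    Tendsto (fun i => Real.log (Real.sin (f i))) F atBot := by
  apply Real.tendsto_log_nhdsGT_zero.comp
  refine tendsto_nhdsWithin_iff.2 ⟨?_, ?_⟩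
  · have := (Real.continuous_sin.tendsto 0).comp (tendsto_nhdsWithin_iff.1 hf).1
    simpa [Function.comp_def] using this
  · have h2 := hf.eventually (Ioo_mem_nhdsGT Real.pi_pos)
    filter_upwards [h2] with i hi using Real.sin_pos_of_pos_of_lt_pi hi.1 hi.2

lemma tendsto_log_sin {F : Filter ℝ} {f : ℝ → ℝ} {a : ℝ} (hf : Tendsto f F (𝓝 a)) (h0 : 0 < a)
    (h1 : a < Real.pi) :
    Tendsto (fun i => Real.log (Real.sin (f i))) F (𝓝 (Real.log (Real.sin a))) :=
  ((Real.continuous_sin.tendsto a).comp hf).log (Real.sin_pos_of_pos_of_lt_pi h0 h1).ne'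

lemma continuous_auxAngle (α : ℝ) : Continuous (auxAngle α) := by unfold auxAngle; fun_prop

lemma tendsto_auxAngle_max {α : ℝ} (h0 : 1 / 2 < α) (h1 : α < 1) :
    Tendsto (auxAngle α) (𝓝[<] maxAngle α) (𝓝[>] 0) := by
  obtain ⟨h2, h3, h4, h5⟩ := angle_facts h0 h1
  refine tendsto_nhdsWithin_iff.2 ⟨?_, ?_⟩
  · have := ((continuous_auxAngle α).tendsto (maxAngle α)).mono_left
      (nhdsWithin_le_nhds (s := Iio (maxAngle α)))
    rwa [h4] at this
  · filter_upwards [Ioo_mem_nhdsLT h2] with γ hγ using (h5 γ hγ.1 hγ.2).1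

lemma auxAngle_zero_mem {α : ℝ} (h0 : 1 / 2 < α) (h1 : α < 1) :
    0 < auxAngle α 0 ∧ auxAngle α 0 < Real.pi := by
  have := Real.pi_pos
  unfold auxAngle
  constructor <;> nlinarith

lemma tendsto_angleLevel_zero {α : ℝ} (h0 : 1 / 2 < α) (h1 : α < 1) :
    Tendsto (angleLevel α) (𝓝[>] 0) atBot := by
  obtain ⟨ha, hb⟩ := auxAngle_zero_mem h0 h1
  have hx : Tendsto (auxAngle α) (𝓝[>] 0) (𝓝 (auxAngle α 0)) :=
    ((continuous_auxAngle α).tendsto 0).mono_left nhdsWithin_le_nhds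
  have hi : Tendsto (fun γ : ℝ => γ) (𝓝[>] 0) (𝓝 0) := tendsto_id.mono_left nhdsWithin_le_nhds
  have h2 := (tendsto_log_sin hx ha hb).const_mul (-α)
  have h3 := tendsto_log_sin_zero (F := 𝓝[>] 0) (f := fun γ => γ) tendsto_id
  have h4 := (tendsto_log_sin (hx.add hi) (by simpa using ha) (by simpa using hb)).const_mul (1 - α)
  refine ((h3.atBot_add (h2.sub h4)).congr fun γ => ?_)
  unfold angleLevel; ring

lemma tendsto_angleLevel_max {α : ℝ} (h0 : 1 / 2 < α) (h1 : α < 1) :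
    Tendsto (angleLevel α) (𝓝[<] (maxAngle α)) atTop := by
  obtain ⟨h2, h3, h4, h5⟩ := angle_facts h0 h1
  have hx := tendsto_auxAngle_max h0 h1
  have hi : Tendsto (fun γ : ℝ => γ) (𝓝[<] (maxAngle α)) (𝓝 (maxAngle α)) :=
    tendsto_id.mono_left nhdsWithin_le_nhds
  have h6 := (tendsto_log_sin_zero hx).const_mul_atBot_of_neg (show -α < 0 by linarith)
  have h7 := tendsto_log_sin hi h2 h3
  have h8 := (tendsto_log_sin ((tendsto_nhdsWithin_iff.1 hx).1.add hi) (by simpa using h2)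
    (by simpa using h3)).const_mul (1 - α)
  refine ((h6.atTop_add (h7.sub h8)).congr fun γ => ?_)
  unfold angleLevel; ring

/-- Logarithm of the modulus on the level curve, as a function of the angle. -/
noncomputable def angleLogRadius (α γ : ℝ) : ℝ :=
  (Real.log (Real.sin (auxAngle α γ)) - Real.log (Real.sin γ)) / (1 - α)

lemma level_equation {α : ℝ} (h0 : 1 / 2 < α) (h1 : α < 1) {γ : ℝ} (hγ : γ ∈ Ioo 0 (maxAngle α))
    {w : ℝ} (hw : 0 < w) (hwγ : angleLevel α γ = -(1 - α) * Real.log w) :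
    Real.exp (angleLogRadius α γ) * Real.sin γ =
      Real.exp (α * angleLogRadius α γ) * Real.sin (auxAngle α γ) ∧
    Real.exp (angleLogRadius α γ) * Real.cos γ +
      Real.exp (α * angleLogRadius α γ) * Real.cos (auxAngle α γ) = w := by
  obtain ⟨hg, hx, hs⟩ := sin_angle_pos h0 h1 hγ
  have h1α : 1 - α ≠ 0 := by linarith
  set x := auxAngle α γ with hxd
  set σ := angleLogRadius α γ with hσ
  have hσ' : (1 - α) * σ = Real.log (Real.sin x) - Real.log (Real.sin γ) := by
    rw [hσ]; unfold angleLogRadius; field_simp; rfl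
  have e1 : Real.exp σ * Real.sin γ = Real.exp (α * σ) * Real.sin x := by
    conv_lhs => rw [← Real.exp_log hg, ← Real.exp_add]
    conv_rhs => rw [← Real.exp_log hx, ← Real.exp_add]
    congr 1; linarith
  refine ⟨e1, ?_⟩
  have hlw : Real.log w = σ + Real.log (Real.sin (x + γ)) - Real.log (Real.sin x) := by
    unfold angleLevel at hwγ
    rw [← hxd] at hwγ
    apply mul_left_cancel₀ h1α
    linear_combination hwγ - hσ'
  have hw' : w * Real.sin x = Real.exp σ * Real.sin (x + γ) := by
    conv_lhs => rw [← Real.exp_log hw, ← Real.exp_log hx, ← Real.exp_add]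
    conv_rhs => rw [← Real.exp_log hs, ← Real.exp_add]
    congr 1; linarith
  apply mul_right_cancel₀ hx.ne'
  rw [hw', Real.sin_add]
  linear_combination (-Real.cos x) * e1

lemma exists_level_curve {α : ℝ} (h0 : 1 / 2 < α) (h1 : α < 1) : ∃ σ γ : ℝ → ℝ,
    ContinuousOn σ (Ioi 0) ∧ ContinuousOn γ (Ioi 0) ∧ StrictAntiOn γ (Ioi 0) ∧
    (∀ w, 0 < w → γ w ∈ Ioo 0 (maxAngle α) ∧
      Real.exp (σ w) * Real.sin (γ w) = Real.exp (α * σ w) * Real.sin (auxAngle α (γ w)) ∧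
      Real.exp (σ w) * Real.cos (γ w) + Real.exp (α * σ w) * Real.cos (auxAngle α (γ w)) = w) ∧
    Tendsto σ (𝓝[>] 0) atBot ∧ Tendsto σ atTop atTop ∧ Tendsto γ atTop (𝓝 0) := by
  obtain ⟨h2, h3, h4, h5⟩ := angle_facts h0 h1
  have hcont : ContinuousOn (angleLevel α) (Ioo 0 (maxAngle α)) := fun γ hγ => by
    obtain ⟨c, -, hd⟩ := hasDerivAt_angleLevel h0 h1 hγ
    exact hd.continuousAt.continuousWithinAt
  have hmono : StrictMonoOn (angleLevel α) (Ioo 0 (maxAngle α)) := by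
    refine strictMonoOn_of_deriv_pos (convex_Ioo _ _) hcont fun γ hγ => ?_
    rw [interior_Ioo] at hγ
    obtain ⟨c, hc, hd⟩ := hasDerivAt_angleLevel h0 h1 hγ
    rwa [hd.deriv]
  obtain ⟨G, hGc, hGm, hG, hGl⟩ := exists_continuous_inverse isOpen_Ioo hmono
    (surj_of_tendsto_Ioo h2 hcont (tendsto_angleLevel_zero h0 h1) (tendsto_angleLevel_max h0 h1))
  have hGbot : Tendsto G atBot (𝓝[>] 0) := by
    refine tendsto_nhdsWithin_iff.2 ⟨?_, Eventually.of_forall fun y => (hG y).1.1⟩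
    refine tendsto_order.2 ⟨fun a ha => Eventually.of_forall fun y => ha.trans (hG y).1.1,
      fun a ha => ?_⟩
    have hc : min a (maxAngle α / 2) ∈ Ioo 0 (maxAngle α) :=
      ⟨lt_min ha (by linarith), (min_le_right _ _).trans_lt (by linarith)⟩
    filter_upwards [eventually_lt_atBot (angleLevel α (min a (maxAngle α / 2)))] with y hy
    have := hGm hy
    rw [hGl _ hc] at this
    exact this.trans_le (min_le_left _ _)
  have hGtop : Tendsto G atTop (𝓝[<] (maxAngle α)) := by
    refine tendsto_nhdsWithin_iff.2 ⟨?_, Eventually.of_forall fun y => (hG y).1.2⟩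
    refine tendsto_order.2 ⟨fun a ha => ?_,
      fun a ha => Eventually.of_forall fun y => (hG y).1.2.trans ha⟩
    have hc : max a (maxAngle α / 2) ∈ Ioo 0 (maxAngle α) :=
      ⟨lt_max_of_lt_right (by linarith), max_lt ha (by linarith)⟩
    filter_upwards [eventually_gt_atTop (angleLevel α (max a (maxAngle α / 2)))] with y hy
    have := hGm hy
    rw [hGl _ hc] at this
    exact (le_max_left _ _).trans_lt this
  set γ : ℝ → ℝ := fun w => G (-(1 - α) * Real.log w) with hγdef
  have hγmem : ∀ w, γ w ∈ Ioo 0 (maxAngle α) := fun w => (hG _).1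
  have hγc : ContinuousOn γ (Ioi 0) := by
    refine hGc.comp_continuousOn (continuousOn_const.mul ?_)
    exact Real.continuousOn_log.mono fun w hw => ne_of_gt hw
  have hγ0 : Tendsto γ (𝓝[>] 0) (𝓝[<] (maxAngle α)) :=
    hGtop.comp (Real.tendsto_log_nhdsGT_zero.const_mul_atBot_of_neg (by linarith))
  have hγ1 : Tendsto γ atTop (𝓝[>] 0) :=
    hGbot.comp (Real.tendsto_log_atTop.const_mul_atTop_of_neg (by linarith))
  have h1α : 0 < 1 - α := by linarith
  refine ⟨fun w => angleLogRadius α (γ w), γ, ?_, hγc, ?_, fun w hw => ⟨hγmem w, ?_⟩, ?_, ?_,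
    (tendsto_nhdsWithin_iff.1 hγ1).1⟩
  · refine ContinuousOn.div_const (ContinuousOn.sub ?_ ?_) _
    · exact (Real.continuous_sin.comp_continuousOn
        ((continuous_auxAngle α).comp_continuousOn hγc)).log
        fun w _ => (sin_angle_pos h0 h1 (hγmem w)).2.1.ne'
    · exact (Real.continuous_sin.comp_continuousOn hγc).log
        fun w _ => (sin_angle_pos h0 h1 (hγmem w)).1.ne'
  · intro a ha b hb hab
    apply hGm
    have := Real.log_lt_log ha hab
    nlinarith
  · exact level_equation h0 h1 (hγmem w) hw (hG _).2
  · have h6 := tendsto_log_sin_zero ((tendsto_auxAngle_max h0 h1).comp hγ0)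
    have h7 := tendsto_log_sin (tendsto_nhdsWithin_iff.1 hγ0).1 h2 h3
    have := (h6.atBot_add h7.neg).atBot_div_const h1α
    exact this.congr fun w => by simp [angleLogRadius, sub_eq_add_neg]
  · obtain ⟨ha, hb⟩ := auxAngle_zero_mem h0 h1
    have h6 := tendsto_log_sin (((continuous_auxAngle α).tendsto 0).comp
      (tendsto_nhdsWithin_iff.1 hγ1).1) ha hb
    have h7 := tendsto_neg_atBot_atTop.comp (tendsto_log_sin_zero hγ1)
    have := (h6.add_atTop h7).atTop_div_const h1α
    exact this.congr fun w => by simp [angleLogRadius, sub_eq_add_neg]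

/-- The phase `e^{-2iπα}`. -/
noncomputable def turnPhase (α : ℝ) : ℂ := exp (-(2 * Real.pi * α : ℂ) * I)

lemma norm_turnPhase (α : ℝ) : ‖turnPhase α‖ = 1 := by
  unfold turnPhase
  have : (-(2 * Real.pi * α : ℂ) * I) = ((-(2 * Real.pi * α) : ℝ) : ℂ) * I := by push_cast; ring
  rw [this, norm_exp_ofReal_mul_I]

lemma turnPhase_mul_exp (α σ γ : ℝ) : turnPhase α * exp (α * (σ + γ * I)) =
    Real.exp (α * σ) * (-Real.cos (auxAngle α γ) + Real.sin (auxAngle α γ) * I) := by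
  have h : (α:ℂ) * (σ + γ * I) + -(2 * Real.pi * α : ℂ) * I =
      ((α * σ : ℝ) : ℂ) + ((-auxAngle α γ - Real.pi : ℝ) : ℂ) * I := by
    unfold auxAngle; push_cast; ring
  unfold turnPhase
  rw [← exp_add, add_comm, h, exp_add, exp_mul_I, ← ofReal_exp, ← ofReal_cos, ← ofReal_sin,
    Real.cos_sub_pi, Real.sin_sub_pi, Real.cos_neg, Real.sin_neg]
  push_cast; ring

lemma exists_real_level {α : ℝ} (h0 : 0 < α) (h1 : α < 1) : ∃ p : ℝ → ℝ,
    ContinuousOn p (Ioi 0) ∧ (∀ w, 0 < w → 1 < p w ∧ p w - p w ^ α = w) ∧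
    Tendsto p (𝓝[>] 0) (𝓝 1) ∧ Tendsto p atTop atTop := by
  have h1α : 0 < 1 - α := by linarith
  set M : ℝ → ℝ := fun t => α * Real.log t + Real.log (t ^ (1 - α) - 1) with hM
  have hpos : ∀ t : ℝ, 1 < t → 0 < t ^ (1 - α) - 1 := fun t ht => by
    have := Real.one_lt_rpow ht h1α; linarith
  have hcont : ContinuousOn M (Ioi 1) := by
    refine ContinuousOn.add (continuousOn_const.mul (Real.continuousOn_log.mono fun t ht => ?_)) ?_
    · exact ne_of_gt (one_pos.trans ht)
    · exact (((Real.continuous_rpow_const h1α.le).sub continuous_const).continuousOn).log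
        fun t ht => (hpos t ht).ne'
  have hmono : StrictMonoOn M (Ioi 1) := by
    intro a ha b hb hab
    have ha0 : (0:ℝ) < a := one_pos.trans ha
    have h2 := Real.log_lt_log ha0 hab
    have h3 := Real.rpow_lt_rpow ha0.le hab h1α
    have h4 := Real.log_lt_log (hpos a ha) (by linarith : a ^ (1 - α) - 1 < b ^ (1 - α) - 1)
    simp only [hM]
    nlinarith
  have hlim1 : Tendsto M (𝓝[>] 1) atBot := by
    have h2 : Tendsto (fun t : ℝ => α * Real.log t) (𝓝[>] 1) (𝓝 (α * Real.log 1)) :=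
      ((Real.continuousAt_log one_ne_zero).tendsto.mono_left nhdsWithin_le_nhds).const_mul α
    have h3 : Tendsto (fun t : ℝ => t ^ (1 - α) - 1) (𝓝[>] 1) (𝓝[>] 0) := by
      refine tendsto_nhdsWithin_iff.2 ⟨?_, ?_⟩
      · have : Continuous fun t : ℝ => t ^ (1 - α) - 1 :=
          (Real.continuous_rpow_const h1α.le).sub continuous_const
        have := (this.tendsto 1).mono_left (nhdsWithin_le_nhds (s := Ioi 1))
        simpa using this
      · filter_upwards [self_mem_nhdsWithin] with t ht using hpos t ht
    exact h2.add_atBot (Real.tendsto_log_nhdsGT_zero.comp h3)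
  have hlim2 : Tendsto M atTop atTop := by
    have h2 := Real.tendsto_log_atTop.const_mul_atTop h0
    have h3 : Tendsto (fun t : ℝ => t ^ (1 - α) - 1) atTop atTop :=
      tendsto_atTop_add_const_right _ (-1) (tendsto_rpow_atTop h1α)
    exact h2.atTop_add_atTop (Real.tendsto_log_atTop.comp h3)
  obtain ⟨G, hGc, hGm, hG, hGl⟩ := exists_continuous_inverse isOpen_Ioi hmono
    (surj_of_tendsto_Ioi hcont hlim1 hlim2)
  have heq : ∀ w, 0 < w → 1 < G (Real.log w) ∧ G (Real.log w) - G (Real.log w) ^ α = w := by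
    intro w hw
    obtain ⟨ha, hb⟩ := hG (Real.log w)
    have ha' : 1 < G (Real.log w) := ha
    set t := G (Real.log w) with ht
    have ht0 : 0 < t := one_pos.trans ha'
    refine ⟨ha', ?_⟩
    have h2 : t - t ^ α = t ^ α * (t ^ (1 - α) - 1) := by
      rw [mul_sub, ← Real.rpow_add ht0]; simp
    rw [h2]
    apply Real.log_injOn_pos (mem_Ioi.2 (mul_pos (by positivity) (hpos t ha'))) hw
    rw [Real.log_mul (by positivity) (hpos t ha').ne', Real.log_rpow ht0]
    exact hb
  refine ⟨fun w => G (Real.log w), ?_, heq, ?_, ?_⟩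
  · exact hGc.comp_continuousOn (Real.continuousOn_log.mono fun w hw => ne_of_gt hw)
  · have hGbot : Tendsto G atBot (𝓝 1) := by
      refine tendsto_order.2 ⟨fun a ha => Eventually.of_forall fun y => ha.trans (hG y).1,
        fun a ha => ?_⟩
      filter_upwards [eventually_lt_atBot (M a)] with y hy
      have := hGm hy
      rwa [hGl _ ha] at this
    exact hGbot.comp Real.tendsto_log_nhdsGT_zero
  · refine tendsto_atTop_mono' _ ?_ tendsto_id
    filter_upwards [eventually_gt_atTop 0] with w hw
    obtain ⟨h2, h3⟩ := heq w hw
    have : 0 < G (Real.log w) ^ α := by positivity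
    simp only [id]; linarith

lemma laplace_real_level {α : ℝ} (h0 : 0 < α) (h1 : α < 1) {p : ℝ → ℝ}
    (hc : ContinuousOn p (Ioi 0)) (hp : ∀ w, 0 < w → 1 < p w ∧ p w - p w ^ α = w)
    (hp0 : Tendsto p (𝓝[>] 0) (𝓝 1)) (hp1 : Tendsto p atTop atTop) {r : ℝ} (hr : 0 < r) :
    expPowInt α ((r ^ (1 - α) : ℝ) : ℂ) / r = r * (∫ w in Ioi (0:ℝ), (p w : ℂ) * exp (-r * w)) +
      ((∫ t in (0:ℝ)..1, (Real.exp (-r * (t - t ^ α)) - 1) : ℝ) : ℂ) := by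
  obtain ⟨P, hP, hPl, hPr, hPv⟩ := exists_logKernel_primitive h0 h1 hr 1
  rw [one_mul] at hPr
  have hpp : ∀ w, 0 < w → 0 < p w := fun w hw => one_pos.trans (hp w hw).1
  have hlogc : ContinuousOn (fun w => ((Real.log (p w) : ℝ) : ℂ)) (Ioi 0) :=
    continuous_ofReal.comp_continuousOn (hc.log fun w hw => (hpp w hw).ne')
  have key := integral_level_curve h0 h1 (ζ := 1) (by simp)
    (p := fun w => ((Real.log (p w) : ℝ) : ℂ)) hlogc (fun w hw => ?_) (fun w hw => ?_) hr hP
    (P₀ := P 0) (t₀ := 1) ?_ ?_ (hPr.comp (Real.tendsto_log_atTop.comp hp1))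
  · have h2 : ∫ w in Ioi (0:ℝ), exp (Real.log (p w) : ℝ) * exp (-r * w) =
        ∫ w in Ioi (0:ℝ), (p w : ℂ) * exp (-r * w) := by
      refine setIntegral_congr_fun measurableSet_Ioi fun w hw => ?_
      simp only [exp_log_cast (hpp w hw)]
    rw [h2] at key
    have h3 : P 0 - 1 = ((∫ t in (0:ℝ)..1, (Real.exp (-r * (t - t ^ α)) - 1) : ℝ) : ℂ) := by
      have hcr := Real.continuous_rpow_const h0.le
      rw [intervalIntegral.integral_sub (Continuous.intervalIntegrable (by fun_prop) _ _)
        (by simp)]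
      have := hPv 0
      rw [ofReal_zero, Real.exp_zero] at this
      rw [this, ofReal_sub, ← intervalIntegral.integral_ofReal]
      simp
    rw [key, ← h3]; ring
  · simp only [one_mul]
    rw [exp_log_cast (hpp w hw), exp_mul_log_cast (hpp w hw)]
    exact_mod_cast (hp w hw).2
  · rw [exp_log_cast (hpp w hw)]
    have : 0 < (1 - α) * p w + α * w := by
      have := hpp w hw
      have : 0 < 1 - α := by linarith
      positivity
    exact_mod_cast this.ne'
  · have h2 : Tendsto (fun w => ((Real.log (p w) : ℝ) : ℂ)) (𝓝[>] 0) (𝓝 0) := by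
      have := hp0.log one_ne_zero
      rw [Real.log_one] at this
      exact (continuous_ofReal.tendsto 0).comp this
    exact ((hP 0).continuousAt.tendsto).comp h2
  · have h2 : Tendsto (fun w => ((p w : ℝ) : ℂ)) (𝓝[>] 0) (𝓝 1) := by
      simpa [Function.comp_def] using (continuous_ofReal.tendsto 1).comp hp0
    refine h2.congr' ?_
    filter_upwards [self_mem_nhdsWithin] with w hw
    rw [exp_log_cast (hpp w hw)]

lemma laplace_complex_level {α : ℝ} (h0 : 1 / 2 < α) (h1 : α < 1) {σ γ : ℝ → ℝ}
    (hσc : ContinuousOn σ (Ioi 0)) (hγc : ContinuousOn γ (Ioi 0))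
    (hw : ∀ w, 0 < w → γ w ∈ Ioo 0 (maxAngle α) ∧
      Real.exp (σ w) * Real.sin (γ w) = Real.exp (α * σ w) * Real.sin (auxAngle α (γ w)) ∧
      Real.exp (σ w) * Real.cos (γ w) + Real.exp (α * σ w) * Real.cos (auxAngle α (γ w)) = w)
    (hσ0 : Tendsto σ (𝓝[>] 0) atBot) (hσ1 : Tendsto σ atTop atTop) (hγ1 : Tendsto γ atTop (𝓝 0))
    {r : ℝ} (hr : 0 < r) :
    (∀ w, 0 < w → exp (σ w + γ w * I) - turnPhase α * exp (α * (σ w + γ w * I)) = w) ∧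
    expPowInt α (turnPhase α * ((r ^ (1 - α) : ℝ) : ℂ)) / r =
      r * ∫ w in Ioi (0:ℝ), exp (σ w + γ w * I) * exp (-r * w) := by
  have hα : 0 < α := by linarith
  obtain ⟨h2, h3, -, -⟩ := angle_facts h0 h1
  have hu : ∀ w, 0 < w → exp (σ w + γ w * I) - turnPhase α * exp (α * (σ w + γ w * I)) = w := by
    intro w hw0
    obtain ⟨-, e1, e2⟩ := hw w hw0
    rw [turnPhase_mul_exp, exp_add, exp_mul_I, ← ofReal_exp, ← ofReal_cos, ← ofReal_sin]
    apply Complex.ext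
    · simp [-ofReal_exp, -ofReal_cos, -ofReal_sin]; linarith
    · simp [-ofReal_exp, -ofReal_cos, -ofReal_sin]; linarith
  refine ⟨hu, ?_⟩
  obtain ⟨P, hP, hPl, hPr, -⟩ := exists_logKernel_primitive hα h1 hr (turnPhase α)
  have hV : ∀ w, 0 < w → |γ w| ≤ Real.pi := fun w hw0 => by
    have := (hw w hw0).1
    rw [abs_of_pos this.1]; linarith [this.2]
  -- extend the curve by zero angle outside the positive reals, where it plays no role
  set q : ℝ → ℂ := fun w => σ w + ((if 0 < w then γ w else 0 : ℝ) : ℂ) * I with hq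
  have hqw : ∀ w, 0 < w → q w = σ w + γ w * I := fun w hw0 => by simp [hq, hw0]
  have hqre : ∀ w, (q w).re = σ w := fun w => by simp [hq]
  have hqim : ∀ w, |(q w).im| ≤ Real.pi := fun w => by
    by_cases h : 0 < w
    · rw [hqw w h]; simpa using hV w h
    · simp [hq, h, Real.pi_pos.le]
  have hqc : ContinuousOn q (Ioi 0) := by
    have : ContinuousOn (fun w => (σ w : ℂ) + γ w * I) (Ioi 0) :=
      (continuous_ofReal.comp_continuousOn hσc).add
        ((continuous_ofReal.comp_continuousOn hγc).mul continuousOn_const)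
    exact this.congr fun w hw0 => hqw w hw0
  have key := integral_level_curve hα h1 (norm_turnPhase α) hqc
    (fun w hw0 => by rw [hqw w hw0]; exact hu w hw0) (fun w hw0 h => ?_) hr hP (P₀ := 0) (t₀ := 0)
    (tendsto_primitive_left hα hr hP hPl (p := q) (by simpa only [hqre] using hσ0) hqim)
    ?_ (tendsto_primitive_right hP hPr (p := q) (by simpa only [hqre] using hσ1) hqim
      ((tendsto_exp_sub_exp_atBot' hα h1 hr (show (0:ℝ) < 1 / 2 by norm_num)).comp hσ1) ?_)
  · rw [sub_zero, add_zero] at key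
    rw [← key]
    congr 1
    refine setIntegral_congr_fun measurableSet_Ioi fun w hw0 => ?_
    simp only [hqw w hw0]
  · have him := congrArg Complex.im h
    rw [hqw w hw0, exp_add, exp_mul_I, ← ofReal_exp, ← ofReal_cos, ← ofReal_sin] at him
    have hs := (sin_angle_pos h0 h1 (hw w hw0).1).1
    have : 0 < (1 - α) * (Real.exp (σ w) * Real.sin (γ w)) := by
      have : 0 < 1 - α := by linarith
      positivity
    simp [-ofReal_exp, -ofReal_cos, -ofReal_sin] at him
    rcases him with h | h <;> nlinarith
  · rw [tendsto_zero_iff_norm_tendsto_zero]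
    refine (Real.tendsto_exp_atBot.comp hσ0).congr fun w => ?_
    rw [norm_exp, hqre]; rfl
  · have hev := hγ1.eventually (Iio_mem_nhds (show (0:ℝ) < Real.pi / 3 by positivity))
    filter_upwards [hev, eventually_gt_atTop 0] with w hw1 hw0 x hx
    obtain ⟨hxre, b, hb, hxim⟩ := mem_segment_re_vertical hx
    rw [hqre] at hxre
    have hγ := (hw w hw0).1.1
    have hqi : (q w).im = γ w := by rw [hqw w hw0]; simp
    rw [hqi] at hxim
    refine (norm_logKernel_le hr.le _ _).trans ?_
    rw [hxre, norm_turnPhase, one_mul]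
    have hcos : 1 / 2 ≤ Real.cos x.im := by
      rw [← Real.cos_pi_div_three]
      have hw2 : γ w < Real.pi / 3 := hw1
      apply Real.cos_le_cos_of_nonneg_of_le_pi
      · rw [hxim]; exact mul_nonneg hb.1 hγ.le
      · linarith [Real.pi_pos]
      · rw [hxim]; nlinarith [hb.1, hb.2]
    have he := Real.exp_pos (σ w)
    simp only [Function.comp]
    apply Real.exp_le_exp.2
    have h5 : -(Real.exp (σ w) * Real.cos x.im - Real.exp (α * σ w)) ≤
      Real.exp (α * σ w) - 1 / 2 * Real.exp (σ w) := by nlinarith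
    have := mul_le_mul_of_nonneg_left h5 hr.le
    linarith

lemma cot_lt_cot_of_lt {a b : ℝ} (ha : 0 < a) (hab : a < b) (hb : b < Real.pi) :
    Real.cos b / Real.sin b < Real.cos a / Real.sin a := by
  have h1 : 0 < Real.sin a := Real.sin_pos_of_pos_of_lt_pi ha (by linarith)
  have h2 : 0 < Real.sin b := Real.sin_pos_of_pos_of_lt_pi (by linarith) hb
  have h3 : 0 < Real.sin (b - a) := Real.sin_pos_of_pos_of_lt_pi (by linarith) (by linarith)
  rw [Real.sin_sub] at h3
  rw [div_lt_div_iff₀ h2 h1]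
  linarith

/-- A strictly monotone combination of logarithms of sines which vanishes at the phases of the
difference of the two level curves. -/
noncomputable def phaseFun (α φ γ : ℝ) : ℝ :=
  Real.log (Real.sin (auxAngle α γ - φ)) - α * Real.log (Real.sin (γ + φ)) -
    (1 - α) * Real.log (Real.sin φ)

lemma hasDerivAt_phaseFun {α : ℝ} {a b φ γ s : ℝ}
    (h1 : Real.sin (auxAngle α (γ + s * b) - (φ + s * a)) ≠ 0)
    (h2 : Real.sin (γ + s * b + (φ + s * a)) ≠ 0) (h3 : Real.sin (φ + s * a) ≠ 0) :
    HasDerivAt (fun s => phaseFun α (φ + s * a) (γ + s * b))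
      (Real.cos (auxAngle α (γ + s * b) - (φ + s * a)) * (-α * b - a) /
          Real.sin (auxAngle α (γ + s * b) - (φ + s * a)) -
        α * (Real.cos (γ + s * b + (φ + s * a)) * (b + a) / Real.sin (γ + s * b + (φ + s * a))) -
        (1 - α) * (Real.cos (φ + s * a) * a / Real.sin (φ + s * a))) s := by
  have ha : HasDerivAt (fun s => φ + s * a) a s := by
    simpa using ((hasDerivAt_id s).mul_const a).const_add φ
  have hb : HasDerivAt (fun s => γ + s * b) b s := by
    simpa using ((hasDerivAt_id s).mul_const b).const_add γ
  have hc : HasDerivAt (fun s => auxAngle α (γ + s * b)) (-α * b) s :=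
    ((hb.const_mul α).const_sub (Real.pi * (2 * α - 1))).congr_deriv (by ring)
  exact (((hc.sub ha).sin.log h1).sub (((hb.add ha).sin.log h2).const_mul α)).sub
    ((ha.sin.log h3).const_mul (1 - α))

lemma phase_le_of_phaseFun_eq_zero {α : ℝ} (h0 : 1 / 2 < α) (h1 : α < 1) {φ₁ φ₂ γ₁ γ₂ : ℝ}
    (hγ₁ : γ₁ ∈ Ioo 0 (maxAngle α)) (hγ₂ : γ₂ ∈ Ioo 0 (maxAngle α))
    (hφ₁ : φ₁ ∈ Ioo 0 (auxAngle α γ₁)) (hφ₂ : φ₂ ∈ Ioo 0 (auxAngle α γ₂))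
    (hF₁ : phaseFun α φ₁ γ₁ = 0) (hF₂ : phaseFun α φ₂ γ₂ = 0) (hγ : γ₂ ≤ γ₁) : φ₁ ≤ φ₂ := by
  by_contra! hφ
  have hα : 0 < α := by linarith
  set a := φ₁ - φ₂ with ha
  set b := γ₁ - γ₂ with hb
  have hdom : ∀ s ∈ Icc (0:ℝ) 1, 0 < φ₂ + s * a ∧ φ₂ + s * a < γ₂ + s * b + (φ₂ + s * a) ∧
      γ₂ + s * b + (φ₂ + s * a) < Real.pi - (auxAngle α (γ₂ + s * b) - (φ₂ + s * a)) ∧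
      0 < auxAngle α (γ₂ + s * b) - (φ₂ + s * a) := by
    intro s hs
    have e0 : 0 < γ₂ + s * b := by have := hγ₂.1; have : 0 ≤ s * b := mul_nonneg hs.1 (by linarith)
                                   linarith
    have e1 : γ₂ + s * b < maxAngle α := by
      have : s * b ≤ 1 * b := mul_le_mul_of_nonneg_right hs.2 (by linarith)
      have := hγ₁.2; linarith
    obtain ⟨-, -, -, h5⟩ := angle_facts h0 h1
    have e2 := (h5 _ e0 e1).2
    have e3 : 0 < φ₂ + s * a := by have := hφ₂.1; have : 0 ≤ s * a := mul_nonneg hs.1 (by linarith)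
                                   linarith
    refine ⟨e3, by linarith, by linarith, ?_⟩
    have : auxAngle α (γ₂ + s * b) - (φ₂ + s * a) =
        (1 - s) * (auxAngle α γ₂ - φ₂) + s * (auxAngle α γ₁ - φ₁) := by
      unfold auxAngle; rw [ha, hb]; ring
    rw [this]
    have q1 := hφ₁.2
    have q2 := hφ₂.2
    rcases hs.1.eq_or_lt with h | h
    · rw [← h]; linarith
    · have : 0 ≤ (1 - s) * (auxAngle α γ₂ - φ₂) := mul_nonneg (by linarith [hs.2]) (by linarith)
      have : 0 < s * (auxAngle α γ₁ - φ₁) := mul_pos h (by linarith)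
      linarith
  have hsin : ∀ s ∈ Icc (0:ℝ) 1, 0 < Real.sin (auxAngle α (γ₂ + s * b) - (φ₂ + s * a)) ∧
      0 < Real.sin (γ₂ + s * b + (φ₂ + s * a)) ∧ 0 < Real.sin (φ₂ + s * a) := by
    intro s hs
    obtain ⟨e1, e2, e3, e4⟩ := hdom s hs
    refine ⟨?_, ?_, ?_⟩ <;> apply Real.sin_pos_of_pos_of_lt_pi <;> linarith
  have hd := fun s hs => hasDerivAt_phaseFun (hsin s hs).1.ne' (hsin s hs).2.1.ne'
    (hsin s hs).2.2.ne'
  obtain ⟨s, hs, hs'⟩ := exists_hasDerivAt_eq_zero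
    (f := fun s => phaseFun α (φ₂ + s * a) (γ₂ + s * b)) one_pos
    (fun s hs => (hd s hs).continuousAt.continuousWithinAt)
    (by simp only [zero_mul, add_zero, one_mul]; rw [ha, hb, add_sub_cancel, add_sub_cancel, hF₁, hF₂])
    (fun s hs => hd s (Ioo_subset_Icc_self hs))
  have hs2 := Ioo_subset_Icc_self hs
  obtain ⟨e1, e2, e3, e4⟩ := hdom s hs2
  have c1 := cot_lt_cot_of_lt (e1.trans e2) e3 (by linarith)
  have c2 := cot_lt_cot_of_lt e1 e2 (by linarith)
  rw [Real.cos_pi_sub, Real.sin_pi_sub] at c1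
  set A := Real.cos (φ₂ + s * a) / Real.sin (φ₂ + s * a) with hA
  set B := Real.cos (γ₂ + s * b + (φ₂ + s * a)) / Real.sin (γ₂ + s * b + (φ₂ + s * a)) with hB
  set D := Real.cos (auxAngle α (γ₂ + s * b) - (φ₂ + s * a)) /
    Real.sin (auxAngle α (γ₂ + s * b) - (φ₂ + s * a)) with hD
  have hs'' : D * (-α * b - a) - α * (B * (b + a)) - (1 - α) * (A * a) = 0 := by
    rw [← hs', hA, hB, hD]; ring
  rw [neg_div, ← hD] at c1
  have k1 : 0 < α * (b + a) * (B + D) := by apply mul_pos (mul_pos hα _) <;> linarith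
  have k2 : 0 < (1 - α) * a * (A + D) := by apply mul_pos (mul_pos _ _) <;> linarith
  nlinarith

lemma exists_phase {α : ℝ} (h0 : 1 / 2 < α) (h1 : α < 1) {p σ γ w : ℝ}
    (hp : 1 < p ∧ p - p ^ α = w) (hγ : γ ∈ Ioo 0 (maxAngle α))
    (hs : Real.exp σ * Real.sin γ = Real.exp (α * σ) * Real.sin (auxAngle α γ))
    (hc : Real.exp σ * Real.cos γ + Real.exp (α * σ) * Real.cos (auxAngle α γ) = w) :
    ∃ φ ∈ Ioo 0 (auxAngle α γ), phaseFun α φ γ = 0 ∧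
      (p - Real.exp σ * Real.cos γ) / (Real.exp σ * Real.sin γ) = Real.cos φ / Real.sin φ := by
  obtain ⟨sg, sb, sbg⟩ := sin_angle_pos h0 h1 hγ
  obtain ⟨-, hmp, -, h5⟩ := angle_facts h0 h1
  obtain ⟨h6, h7⟩ := h5 γ hγ.1 hγ.2
  have hg1 := hγ.1
  have hg2 := hγ.2
  set X := Real.exp σ * Real.cos γ with hX
  set Y := Real.exp σ * Real.sin γ with hY
  have hYp : 0 < Y := by positivity
  have hp0 : 0 < p := one_pos.trans hp.1
  set z : ℂ := ⟨p - X, Y⟩ with hz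
  set φ := z.arg with hφ
  set R := ‖z‖ with hR
  have hRp : 0 < R := norm_pos_iff.2 fun h => hYp.ne' (by simpa [hz] using congrArg Complex.im h)
  have hRc : R * Real.cos φ = p - X := Complex.norm_mul_cos_arg z
  have hRs : R * Real.sin φ = Y := Complex.norm_mul_sin_arg z
  have hφs : 0 < Real.sin φ := pos_of_mul_pos_right (hRs ▸ hYp) hRp.le
  have hφ0 : 0 < φ := by
    by_contra! h
    have := Real.sin_nonpos_of_nonpos_of_neg_pi_le h (Complex.neg_pi_lt_arg z).le
    linarith
  have hφp : φ < Real.pi := by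
    refine lt_of_le_of_ne (Complex.arg_le_pi z) fun h => ?_
    rw [h, Real.sin_pi] at hφs; exact lt_irrefl _ hφs
  have i1 : p * Real.sin φ = Real.exp σ * Real.sin (γ + φ) := by
    apply mul_left_cancel₀ hRp.ne'
    rw [Real.sin_add]
    linear_combination (p - X) * hRs - Y * hRc + (R * Real.sin φ) * hX - (R * Real.cos φ) * hY
  have i2 : p ^ α * Real.sin φ = Real.exp (α * σ) * Real.sin (auxAngle α γ - φ) := by
    apply mul_left_cancel₀ hRp.ne'
    rw [Real.sin_sub]
    have hpw : p ^ α = p - w := by linarith [hp.2]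
    have e : R * (Real.exp (α * σ) * (Real.sin (auxAngle α γ) * Real.cos φ -
        Real.cos (auxAngle α γ) * Real.sin φ)) = Real.exp (α * σ) * Real.sin (auxAngle α γ) * (p - X)
        - Real.exp (α * σ) * Real.cos (auxAngle α γ) * Y := by rw [← hRc, ← hRs]; ring
    rw [e, ← hs, hpw, ← hc]
    linear_combination (p - X - Real.exp (α * σ) * Real.cos (auxAngle α γ)) * hRs
  have s1 : 0 < Real.sin (γ + φ) :=
    pos_of_mul_pos_right (i1 ▸ mul_pos hp0 hφs) (Real.exp_pos _).le
  have s2 : 0 < Real.sin (auxAngle α γ - φ) :=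
    pos_of_mul_pos_right (i2 ▸ mul_pos (Real.rpow_pos_of_pos hp0 _) hφs) (Real.exp_pos _).le
  have k2 : φ < auxAngle α γ := by
    by_contra! h
    have := Real.sin_nonpos_of_nonpos_of_neg_pi_le (x := auxAngle α γ - φ) (by linarith)
      (by linarith)
    linarith
  refine ⟨φ, ⟨hφ0, k2⟩, ?_, ?_⟩
  · have l1 := congrArg Real.log i1
    have l2 := congrArg Real.log i2
    rw [Real.log_mul hp0.ne' hφs.ne', Real.log_mul (Real.exp_pos _).ne' s1.ne', Real.log_exp] at l1
    rw [Real.log_mul (Real.rpow_pos_of_pos hp0 _).ne' hφs.ne',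
      Real.log_mul (Real.exp_pos _).ne' s2.ne', Real.log_exp, Real.log_rpow hp0] at l2
    unfold phaseFun
    linear_combination α * l1 - l2
  · rw [← hRc, ← hRs, mul_div_mul_left _ _ hRp.ne']

/-- The cotangent of the phase of the difference of the two level curves is antitone. -/
lemma antitoneOn_phase_cot {α : ℝ} (h0 : 1 / 2 < α) (h1 : α < 1) {p σ γ : ℝ → ℝ}
    (hp : ∀ w, 0 < w → 1 < p w ∧ p w - p w ^ α = w) (hγ : StrictAntiOn γ (Ioi 0))
    (hw : ∀ w, 0 < w → γ w ∈ Ioo 0 (maxAngle α) ∧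
      Real.exp (σ w) * Real.sin (γ w) = Real.exp (α * σ w) * Real.sin (auxAngle α (γ w)) ∧
      Real.exp (σ w) * Real.cos (γ w) + Real.exp (α * σ w) * Real.cos (auxAngle α (γ w)) = w) :
    AntitoneOn (fun w => (p w - Real.exp (σ w) * Real.cos (γ w)) /
      (Real.exp (σ w) * Real.sin (γ w))) (Ioi 0) := by
  intro w₁ hw₁ w₂ hw₂ h
  obtain ⟨g1, s1, c1⟩ := hw w₁ hw₁
  obtain ⟨g2, s2, c2⟩ := hw w₂ hw₂
  obtain ⟨φ₁, m1, f1, q1⟩ := exists_phase h0 h1 (hp w₁ hw₁) g1 s1 c1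
  obtain ⟨φ₂, m2, f2, q2⟩ := exists_phase h0 h1 (hp w₂ hw₂) g2 s2 c2
  have := phase_le_of_phaseFun_eq_zero h0 h1 g1 g2 m1 m2 f1 f2 (hγ.antitoneOn hw₁ hw₂ h)
  simp only
  rw [q1, q2]
  rcases this.eq_or_lt with e | e
  · rw [e]
  · obtain ⟨-, hmp, -, h5⟩ := angle_facts h0 h1
    exact (cot_lt_cot_of_lt m1.1 e (by linarith [m2.2, (h5 _ g2.1 g2.2).2, g2.1])).le

lemma exists_sign_change {Y e : ℝ → ℝ} (hY : ∀ w, 0 < w → 0 < Y w)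
    (hq : AntitoneOn (fun w => e w / Y w) (Ioi 0)) (k : ℝ) {c : ℝ} (hc : 0 < c) :
    ∃ K : ℝ, ∀ w, 0 < w → 0 ≤ (Real.exp (-c * w) - K) * (e w - k * Y w) := by
  set S := {w : ℝ | 0 < w ∧ k ≤ e w / Y w} with hS
  have hpos : ∀ w, 0 < w → k ≤ e w / Y w → 0 ≤ e w - k * Y w := fun w hw h => by
    rw [le_div_iff₀ (hY w hw)] at h; linarith
  by_cases hb : BddAbove S
  · refine ⟨Real.exp (-c * sSup S), fun w hw => ?_⟩
    rcases lt_trichotomy w (sSup S) with h | h | h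
    · have hne : S.Nonempty := by
        by_contra hne
        rw [not_nonempty_iff_eq_empty] at hne
        rw [hne, Real.sSup_empty] at h
        linarith
      obtain ⟨s, hs, hws⟩ := exists_lt_of_lt_csSup hne h
      refine mul_nonneg ?_ (hpos w hw (hs.2.trans (hq hw hs.1 hws.le)))
      rw [sub_nonneg, Real.exp_le_exp]
      nlinarith
    · rw [← h, sub_self, zero_mul]
    · have hw' : e w / Y w < k := by
        by_contra! h'
        exact (not_le.2 h) (le_csSup hb ⟨hw, h'⟩)
      rw [div_lt_iff₀ (hY w hw)] at hw'
      refine mul_nonneg_of_nonpos_of_nonpos ?_ (by linarith)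
      rw [sub_nonpos, Real.exp_le_exp]
      nlinarith
  · refine ⟨0, fun w hw => ?_⟩
    rw [not_bddAbove_iff] at hb
    obtain ⟨s, hs, hws⟩ := hb w
    rw [sub_zero]
    exact mul_nonneg (Real.exp_pos _).le (hpos w hw (hs.2.trans (hq hw hs.1 hws.le)))

/-- The quotient of two Laplace transforms is monotone if the quotient of the densities is
antitone. -/
lemma laplace_mul_le_mul {Y e : ℝ → ℝ} (hY : ∀ w, 0 < w → 0 < Y w)
    (hq : AntitoneOn (fun w => e w / Y w) (Ioi 0))
    (hYi : ∀ r : ℝ, 0 < r → IntegrableOn (fun w => Y w * Real.exp (-r * w)) (Ioi 0))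
    (hei : ∀ r : ℝ, 0 < r → IntegrableOn (fun w => e w * Real.exp (-r * w)) (Ioi 0))
    {r s : ℝ} (hr : 0 < r) (hrs : r < s) (hn : 0 < ∫ w in Ioi (0:ℝ), Y w * Real.exp (-r * w)) :
    (∫ w in Ioi (0:ℝ), Y w * Real.exp (-s * w)) * (∫ w in Ioi (0:ℝ), e w * Real.exp (-r * w)) ≤
    (∫ w in Ioi (0:ℝ), Y w * Real.exp (-r * w)) * ∫ w in Ioi (0:ℝ), e w * Real.exp (-s * w) := by
  set n := ∫ w in Ioi (0:ℝ), Y w * Real.exp (-r * w) with hnd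
  set d := ∫ w in Ioi (0:ℝ), e w * Real.exp (-r * w) with hdd
  obtain ⟨K, hK⟩ := exists_sign_change hY hq (d / n) (sub_pos.2 hrs)
  have hs : 0 < s := hr.trans hrs
  have h1 : 0 ≤ ∫ w in Ioi (0:ℝ), ((e w * Real.exp (-s * w) - d / n * (Y w * Real.exp (-s * w))) -
      K * (e w * Real.exp (-r * w) - d / n * (Y w * Real.exp (-r * w)))) := by
    refine setIntegral_nonneg measurableSet_Ioi fun w hw => ?_
    have h2 : Real.exp (-s * w) = Real.exp (-(s - r) * w) * Real.exp (-r * w) := by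
      rw [← Real.exp_add]; ring_nf
    rw [h2]
    have := mul_nonneg (hK w hw) (Real.exp_pos (-r * w)).le
    linarith
  have i1 : ∀ r : ℝ, 0 < r → IntegrableOn
      (fun w => e w * Real.exp (-r * w) - d / n * (Y w * Real.exp (-r * w))) (Ioi 0) :=
    fun r hr => (hei r hr).sub ((hYi r hr).const_mul _)
  rw [integral_sub (i1 s hs) ((i1 r hr).const_mul _), integral_const_mul,
    integral_sub (hei s hs) ((hYi s hs).const_mul _),
    integral_sub (hei r hr) ((hYi r hr).const_mul _), integral_const_mul, integral_const_mul,
    ← hnd, ← hdd, div_mul_cancel₀ _ hn.ne', sub_self, mul_zero, sub_zero, sub_nonneg,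
    div_mul_eq_mul_div, div_le_iff₀ hn] at h1
  linarith

lemma continuous_exp_rpow_sub {α : ℝ} (h0 : 0 < α) (r : ℝ) :
    Continuous fun t : ℝ => Real.exp (-r * (t - t ^ α)) - 1 := by
  have := Real.continuous_rpow_const h0.le
  fun_prop

lemma rpow_sub_nonneg {α t : ℝ} (h1 : α < 1) (ht : t ∈ Icc (0:ℝ) 1) (h0 : 0 < α) :
    0 ≤ t ^ α - t := by
  rcases ht.1.eq_or_lt with h | h
  · rw [← h, Real.zero_rpow h0.ne']; simp
  · have := Real.rpow_le_rpow_of_exponent_ge h ht.2 h1.le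
    rw [Real.rpow_one] at this; linarith

lemma initial_integral_nonneg {α : ℝ} (h0 : 0 < α) (h1 : α < 1) {r : ℝ} (hr : 0 < r) :
    0 ≤ ∫ t in (0:ℝ)..1, (Real.exp (-r * (t - t ^ α)) - 1) := by
  refine intervalIntegral.integral_nonneg zero_le_one fun t ht => ?_
  rw [sub_nonneg, Real.one_le_exp_iff]
  nlinarith [rpow_sub_nonneg h1 ht h0]

lemma initial_integral_div_mono {α : ℝ} (h0 : 0 < α) (h1 : α < 1) {r s : ℝ} (hr : 0 < r)
    (hrs : r < s) :
    (∫ t in (0:ℝ)..1, (Real.exp (-r * (t - t ^ α)) - 1)) / r ≤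
      (∫ t in (0:ℝ)..1, (Real.exp (-s * (t - t ^ α)) - 1)) / s := by
  rw [← intervalIntegral.integral_div, ← intervalIntegral.integral_div]
  refine intervalIntegral.integral_mono_on zero_le_one
    ((continuous_exp_rpow_sub h0 r).div_const r).continuousOn.intervalIntegrable
    ((continuous_exp_rpow_sub h0 s).div_const s).continuousOn.intervalIntegrable fun t ht => ?_
  rcases (rpow_sub_nonneg h1 ht h0).eq_or_lt with h | h
  · have : t - t ^ α = 0 := by linarith
    simp [this]
  · have hs : 0 < s := hr.trans hrs
    have := convexOn_exp.secant_mono (mem_univ (0:ℝ)) (mem_univ (r * (t ^ α - t)))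
      (mem_univ (s * (t ^ α - t))) (mul_pos hr h).ne' (mul_pos hs h).ne' (by nlinarith)
    rw [sub_zero, sub_zero, Real.exp_zero, ← div_div, ← div_div,
      div_le_div_iff_of_pos_right h] at this
    rwa [show -r * (t - t ^ α) = r * (t ^ α - t) by ring,
      show -s * (t - t ^ α) = s * (t ^ α - t) by ring]

lemma tendsto_initial_integral_div {α : ℝ} (h0 : 0 < α) (h1 : α < 1) :
    Tendsto (fun r : ℝ => (∫ t in (0:ℝ)..1, (Real.exp (-r * (t - t ^ α)) - 1)) / r) atTop atTop := by
  have hc : Continuous fun t : ℝ => (t ^ α - t) ^ 2 / 2 := by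
    have := Real.continuous_rpow_const h0.le
    fun_prop
  have hpos : 0 < ∫ t in (0:ℝ)..1, (t ^ α - t) ^ 2 / 2 := by
    refine intervalIntegral.intervalIntegral_pos_of_pos_on hc.continuousOn.intervalIntegrable
      (fun t ht => ?_) one_pos
    have : t ^ (1:ℝ) < t ^ α := Real.rpow_lt_rpow_of_exponent_gt ht.1 ht.2 h1
    rw [Real.rpow_one] at this
    have := sub_pos.2 this
    positivity
  refine tendsto_atTop_mono' _ ?_ (tendsto_id.atTop_mul_const hpos)
  filter_upwards [eventually_gt_atTop 0] with r hr
  rw [id, ← intervalIntegral.integral_const_mul, ← intervalIntegral.integral_div]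
  refine intervalIntegral.integral_mono_on zero_le_one
    (continuous_const.mul hc).continuousOn.intervalIntegrable
    ((continuous_exp_rpow_sub h0 r).div_const r).continuousOn.intervalIntegrable fun t ht => ?_
  have hh := rpow_sub_nonneg h1 ht h0
  have := Real.quadratic_le_exp_of_nonneg (mul_nonneg hr.le hh)
  rw [show -r * (t - t ^ α) = r * (t ^ α - t) by ring, le_div_iff₀ hr]
  nlinarith [mul_nonneg hr.le hh]

/-- The cotangent of the argument of `J(r^{1-α}) - J(e^{-2πiα}r^{1-α})`. -/
noncomputable def phaseRatio (α r : ℝ) : ℝ :=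
  (expPowInt α (turnPhase α * ((r ^ (1 - α) : ℝ) : ℂ))).im /
    ((expPowInt α ((r ^ (1 - α) : ℝ) : ℂ)).re -
      (expPowInt α (turnPhase α * ((r ^ (1 - α) : ℝ) : ℂ))).re)

lemma turnPhase_re (α : ℝ) : (turnPhase α).re = Real.cos (2 * Real.pi * α) := by
  unfold turnPhase
  have : (-(2 * Real.pi * α : ℂ) * I) = ((-(2 * Real.pi * α) : ℝ) : ℂ) * I := by push_cast; ring
  rw [this, exp_ofReal_mul_I_re, Real.cos_neg]

lemma turnPhase_im (α : ℝ) : (turnPhase α).im = -Real.sin (2 * Real.pi * α) := by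
  unfold turnPhase
  have : (-(2 * Real.pi * α : ℂ) * I) = ((-(2 * Real.pi * α) : ℝ) : ℂ) * I := by push_cast; ring
  rw [this, exp_ofReal_mul_I_im, Real.sin_neg]

lemma turnPhase_re_lt {α : ℝ} (h0 : 0 < α) (h1 : α < 1) : (turnPhase α).re < 1 := by
  rw [turnPhase_re, show 2 * Real.pi * α = 2 * (Real.pi * α) by ring, Real.cos_two_mul']
  have : 0 < Real.sin (Real.pi * α) := Real.sin_pos_of_pos_of_lt_pi (by positivity)
    (by nlinarith [Real.pi_pos])
  nlinarith [Real.sin_sq_add_cos_sq (Real.pi * α)]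

lemma phaseRatio_den_pos {α : ℝ} (h0 : 0 < α) (h1 : α < 1) {r : ℝ} (hr : 0 < r) :
    0 < (expPowInt α ((r ^ (1 - α) : ℝ) : ℂ)).re -
      (expPowInt α (turnPhase α * ((r ^ (1 - α) : ℝ) : ℂ))).re := by
  have hx : 0 < r ^ (1 - α) := Real.rpow_pos_of_pos hr _
  have := expPowInt_re_lt h0 h1 (q := turnPhase α * ((r ^ (1 - α) : ℝ) : ℂ)) (x := r ^ (1 - α)) (by
    rw [re_mul_ofReal]; nlinarith [turnPhase_re_lt h0 h1])
  linarith

/-- The densities whose Laplace transforms give the numerator and denominator of `phaseRatio`. -/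
lemma exists_phaseRatio_laplace {α : ℝ} (h0 : 1 / 2 < α) (h1 : α < 1) : ∃ Y e : ℝ → ℝ,
    (∀ w, 0 < w → 0 < Y w) ∧ AntitoneOn (fun w => e w / Y w) (Ioi 0) ∧
    (∀ r : ℝ, 0 < r → IntegrableOn (fun w => Y w * Real.exp (-r * w)) (Ioi 0)) ∧
    (∀ r : ℝ, 0 < r → IntegrableOn (fun w => e w * Real.exp (-r * w)) (Ioi 0)) ∧
    ∀ r : ℝ, 0 < r → 0 < (∫ t in (0:ℝ)..1, (Real.exp (-r * (t - t ^ α)) - 1)) / r +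
        (∫ w in Ioi (0:ℝ), e w * Real.exp (-r * w)) ∧
      phaseRatio α r = (∫ w in Ioi (0:ℝ), Y w * Real.exp (-r * w)) /
      ((∫ t in (0:ℝ)..1, (Real.exp (-r * (t - t ^ α)) - 1)) / r +
        ∫ w in Ioi (0:ℝ), e w * Real.exp (-r * w)) := by
  have hα : 0 < α := by linarith
  obtain ⟨σ, γ, hσc, hγc, hγa, hw, hσ0, hσ1, hγ1⟩ := exists_level_curve h0 h1
  obtain ⟨p, hpc, hp, hp0, hp1⟩ := exists_real_level hα h1
  obtain ⟨C, hC, hCb⟩ := norm_exp_level_curve_le hα h1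
  set f : ℝ → ℂ := fun w => exp (σ w + γ w * I) with hf
  have hfc : ContinuousOn f (Ioi 0) := by
    have := continuous_ofReal.comp_continuousOn hσc
    have := continuous_ofReal.comp_continuousOn hγc
    exact (ContinuousOn.add ‹_› (ContinuousOn.mul ‹_› continuousOn_const)).cexp
  have hfre : ∀ w, (f w).re = Real.exp (σ w) * Real.cos (γ w) := fun w => by
    simp [hf, exp_re]
  have hfim : ∀ w, (f w).im = Real.exp (σ w) * Real.sin (γ w) := fun w => by
    simp [hf, exp_im]
  have hfi : ∀ r : ℝ, 0 < r → IntegrableOn (fun w : ℝ => f w * exp (-r * w)) (Ioi 0) := fun r hr =>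
    integrableOn_mul_exp_of_norm_le hfc (fun w hw' => hCb _ _ w (norm_turnPhase α) hw'
      ((laplace_complex_level h0 h1 hσc hγc hw hσ0 hσ1 hγ1 hr).1 w hw')) hr
  have hpi : ∀ r : ℝ, 0 < r → IntegrableOn (fun w : ℝ => (p w : ℂ) * exp (-r * w)) (Ioi 0) :=
    fun r hr => integrableOn_mul_exp_of_norm_le (continuous_ofReal.comp_continuousOn hpc)
      (fun w hw' => by
        have hpw : 0 < p w := one_pos.trans (hp w hw').1
        have := hCb 1 (Real.log (p w) : ℝ) w (by simp) hw' (by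
          rw [one_mul, exp_log_cast hpw, exp_mul_log_cast hpw, ← ofReal_sub, (hp w hw').2])
        rwa [exp_log_cast hpw] at this) hr
  have hex : ∀ r w : ℝ, exp (-r * w) = ((Real.exp (-r * w) : ℝ) : ℂ) := fun r w => by simp
  refine ⟨fun w => (f w).im, fun w => p w - (f w).re, fun w hw' => ?_, ?_, fun r hr => ?_,
    fun r hr => ?_, fun r hr => ?_⟩
  · simp only [hfim]; exact mul_pos (Real.exp_pos _) (sin_angle_pos h0 h1 (hw w hw').1).1
  · simp only [hfre, hfim]
    exact antitoneOn_phase_cot h0 h1 hp hγa hw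
  · refine (hfi r hr).im.congr (ae_of_all _ fun w => ?_)
    simp only [hex]; exact im_mul_ofReal _ _
  · refine ((hpi r hr).re.sub (hfi r hr).re).congr (ae_of_all _ fun w => ?_)
    simp only [hex, Pi.sub_apply]
    change ((p w : ℂ) * _).re - (f w * _).re = _
    rw [re_mul_ofReal, re_mul_ofReal, ofReal_re]; ring
  · have e1 := laplace_real_level hα h1 hpc hp hp0 hp1 hr
    have e2 := (laplace_complex_level h0 h1 hσc hγc hw hσ0 hσ1 hγ1 hr).2
    set A := ∫ t in (0:ℝ)..1, (Real.exp (-r * (t - t ^ α)) - 1) with hA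
    have hr' : (r:ℂ) ≠ 0 := ofReal_ne_zero.2 hr.ne'
    rw [div_eq_iff hr'] at e1 e2
    have iP : (∫ w in Ioi (0:ℝ), (p w : ℂ) * exp (-r * w)) =
        ((∫ w in Ioi (0:ℝ), p w * Real.exp (-r * w) : ℝ) : ℂ) := by
      rw [← integral_complex_ofReal]; simp
    have iX : (∫ w in Ioi (0:ℝ), f w * exp (-r * w)).re =
        ∫ w in Ioi (0:ℝ), (f w).re * Real.exp (-r * w) := by
      rw [← RCLike.re_eq_complex_re, ← integral_re (hfi r hr)]
      simp only [hex, RCLike.re_eq_complex_re, re_mul_ofReal]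
    have iY : (∫ w in Ioi (0:ℝ), f w * exp (-r * w)).im =
        ∫ w in Ioi (0:ℝ), (f w).im * Real.exp (-r * w) := by
      rw [← RCLike.im_eq_complex_im, ← integral_im (hfi r hr)]
      simp only [hex, RCLike.im_eq_complex_im, im_mul_ofReal]
    have iD : (∫ w in Ioi (0:ℝ), (p w - (f w).re) * Real.exp (-r * w)) =
        (∫ w in Ioi (0:ℝ), p w * Real.exp (-r * w)) -
          ∫ w in Ioi (0:ℝ), (f w).re * Real.exp (-r * w) := by
      rw [← integral_sub]
      · simp only [sub_mul]
      · refine (hpi r hr).re.congr (ae_of_all _ fun w => ?_)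
        simp only [hex]; exact re_mul_ofReal _ _
      · refine (hfi r hr).re.congr (ae_of_all _ fun w => ?_)
        simp only [hex]; exact re_mul_ofReal _ _
    rw [iP] at e1
    have j1 := congrArg Complex.re e1
    have j2 := congrArg Complex.re e2
    have j3 := congrArg Complex.im e2
    rw [← ofReal_mul, ← ofReal_add, ← ofReal_mul, ofReal_re] at j1
    rw [re_mul_ofReal, re_ofReal_mul, iX] at j2
    rw [im_mul_ofReal, im_ofReal_mul, iY] at j3
    have hden := phaseRatio_den_pos hα h1 hr
    unfold phaseRatio
    rw [j1, j2] at hden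
    rw [j1, j2, j3, iD]
    have : (r * (∫ w in Ioi (0:ℝ), p w * Real.exp (-r * w)) + A) * r -
        r * (∫ w in Ioi (0:ℝ), (f w).re * Real.exp (-r * w)) * r = r ^ 2 * (A / r +
        ((∫ w in Ioi (0:ℝ), p w * Real.exp (-r * w)) -
          ∫ w in Ioi (0:ℝ), (f w).re * Real.exp (-r * w))) := by field_simp; ring
    rw [this] at hden ⊢
    refine ⟨pos_of_mul_pos_right hden (pow_pos hr 2).le, ?_⟩
    rw [show r * (∫ w in Ioi (0:ℝ), (f w).im * Real.exp (-r * w)) * r =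
      r ^ 2 * ∫ w in Ioi (0:ℝ), (f w).im * Real.exp (-r * w) by ring,
      mul_div_mul_left _ _ (pow_pos hr 2).ne']

lemma setIntegral_Ioi_pos {f : ℝ → ℝ} (hf : ∀ w, 0 < w → 0 < f w) (hi : IntegrableOn f (Ioi 0)) :
    0 < ∫ w in Ioi (0:ℝ), f w := by
  rw [setIntegral_pos_iff_support_of_nonneg_ae _ hi]
  · have : Ioi (0:ℝ) ⊆ Function.support f ∩ Ioi 0 := fun w hw => ⟨(hf w hw).ne', hw⟩
    exact lt_of_lt_of_le (by simp) (measure_mono this)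
  · exact (ae_restrict_iff' measurableSet_Ioi).2 (ae_of_all _ fun w hw => (hf w hw).le)

lemma phaseRatio_antitone_and_tendsto {α : ℝ} (h0 : 1 / 2 < α) (h1 : α < 1) :
    AntitoneOn (phaseRatio α) (Ioi 0) ∧ Tendsto (phaseRatio α) atTop (𝓝 0) := by
  have hα : 0 < α := by linarith
  obtain ⟨Y, e, hY, hq, hYi, hei, hR⟩ := exists_phaseRatio_laplace h0 h1
  have hn : ∀ r : ℝ, 0 < r → 0 < ∫ w in Ioi (0:ℝ), Y w * Real.exp (-r * w) := fun r hr =>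
    setIntegral_Ioi_pos (fun w hw => mul_pos (hY w hw) (Real.exp_pos _)) (hYi r hr)
  have hnm : ∀ r s : ℝ, 0 < r → r ≤ s → (∫ w in Ioi (0:ℝ), Y w * Real.exp (-s * w)) ≤
      ∫ w in Ioi (0:ℝ), Y w * Real.exp (-r * w) := fun r s hr hrs => by
    refine setIntegral_mono_on (hYi s (hr.trans_le hrs)) (hYi r hr) measurableSet_Ioi
      fun w hw => mul_le_mul_of_nonneg_left (Real.exp_le_exp.2 ?_) (hY w hw).le
    have : 0 < w := hw
    nlinarith
  have hA := tendsto_initial_integral_div hα h1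
  have hd : ∀ r : ℝ, 1 ≤ r → -(∫ w in Ioi (0:ℝ), |e w| * Real.exp (-1 * w)) ≤
      ∫ w in Ioi (0:ℝ), e w * Real.exp (-r * w) := fun r hr => by
    have hab : ∀ s : ℝ, 0 < s → IntegrableOn (fun w => |e w| * Real.exp (-s * w)) (Ioi 0) :=
      fun s hs => (hei s hs).abs.congr (ae_of_all _ fun w => by
        simp only [abs_mul, Real.abs_exp])
    rw [← integral_neg]
    refine setIntegral_mono_on (hab 1 one_pos).neg (hei r (by linarith)) measurableSet_Ioi
      fun w hw => ?_
    have hw' : 0 < w := hw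
    have h2 : Real.exp (-r * w) ≤ Real.exp (-1 * w) := Real.exp_le_exp.2 (by nlinarith)
    have h3 : -|e w| * Real.exp (-r * w) ≤ e w * Real.exp (-r * w) :=
      mul_le_mul_of_nonneg_right (neg_abs_le _) (Real.exp_pos _).le
    nlinarith [abs_nonneg (e w), mul_le_mul_of_nonneg_left h2 (abs_nonneg (e w))]
  have hden := fun r hr => (hR r hr).1
  refine ⟨fun r hr s hs hrs => ?_, ?_⟩
  · rcases hrs.eq_or_lt with h | h
    · rw [h]
    rw [(hR r hr).2, (hR s hs).2, div_le_div_iff₀ (hden s hs) (hden r hr)]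
    have k1 := laplace_mul_le_mul hY hq hYi hei hr h (hn r hr)
    have k2 := mul_le_mul (hnm r s hr hrs) (initial_integral_div_mono hα h1 hr h)
      (div_nonneg (initial_integral_nonneg hα h1 hr) (le_of_lt hr)) (hn r hr).le
    rw [mul_add, mul_add]
    exact add_le_add k2 k1
  · refine squeeze_zero' (g := fun r => (∫ w in Ioi (0:ℝ), Y w * Real.exp (-1 * w)) /
      ((∫ t in (0:ℝ)..1, (Real.exp (-r * (t - t ^ α)) - 1)) / r +
        ∫ w in Ioi (0:ℝ), e w * Real.exp (-r * w))) ?_ ?_ ?_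
    · filter_upwards [eventually_gt_atTop 0] with r hr
      rw [(hR r hr).2]; exact (div_pos (hn r hr) (hden r hr)).le
    · filter_upwards [eventually_ge_atTop 1] with r hr
      rw [(hR r (by linarith)).2]
      exact div_le_div_of_nonneg_right (hnm 1 r one_pos hr) (hden r (by linarith)).le
    · refine tendsto_const_nhds.div_atTop (tendsto_atTop_mono' _ ?_
        (tendsto_atTop_add_const_right _ (-(∫ w in Ioi (0:ℝ), |e w| * Real.exp (-1 * w))) hA))
      filter_upwards [eventually_ge_atTop 1] with r hr
      have := hd r hr
      linarith

lemma integral_sub_expPow {α : ℝ} (h0 : 0 < α) (h1 : α < 1) (a b z : ℂ) :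
    (∫ y in Ioi (0:ℝ), ((exp (a * (y:ℂ) ^ (α:ℂ)) - exp (b * (y:ℂ) ^ (α:ℂ))) / z) * exp (-(y:ℂ))) =
      (expPowInt α a - expPowInt α b) / z := by
  unfold expPowInt
  rw [← integral_sub (integrableOn_expPow h0 h1 a) (integrableOn_expPow h0 h1 b), ← integral_div]
  refine setIntegral_congr_fun measurableSet_Ioi fun y hy => ?_
  have hy' : 0 < y := hy
  rw [← ofReal_cpow hy'.le, exp_sub, exp_sub, exp_neg]
  field_simp

lemma GalphaPlus_eq {α : ℝ} (h0 : 0 < α) (h1 : α < 1) {r : ℝ} (hr : 0 < r) :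
    GalphaPlus α r = (2 * Real.pi * I)⁻¹ * ((expPowInt α ((r ^ (1 - α) : ℝ) : ℂ) -
      expPowInt α (turnPhase α * ((r ^ (1 - α) : ℝ) : ℂ))) / r) := by
  unfold GalphaPlus
  rw [integral_sub_expPow h0 h1, turnPhase, ofReal_cpow hr.le]
  push_cast
  rfl

lemma expPowInt_ofReal_im (α x : ℝ) : (expPowInt α (x:ℂ)).im = 0 := by
  rw [expPowInt_ofReal, ofReal_im]

lemma arg_neg_sub_mul_I {N D c : ℝ} (hD : 0 < D) (hc : 0 < c) :
    (c * (-N - D * I) : ℂ).arg = -(Real.pi / 2) - Real.arctan (N / D) := by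
  set a := Real.arctan (N / D) with ha
  have hca : 0 < Real.cos a := Real.cos_arctan_pos _
  have hN : N = D / Real.cos a * Real.sin a := by
    have : Real.tan a = N / D := Real.tan_arctan _
    rw [Real.tan_eq_sin_div_cos] at this
    field_simp at this ⊢
    linarith
  have e : (c * (-N - D * I) : ℂ) = ((c * (D / Real.cos a) : ℝ) : ℂ) *
      (Complex.cos ((-(Real.pi / 2) - a : ℝ) : ℂ) + Complex.sin ((-(Real.pi / 2) - a : ℝ) : ℂ) * I) := by
    rw [← ofReal_cos, ← ofReal_sin, show -(Real.pi / 2) - a = -(a + Real.pi / 2) by ring,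
      Real.cos_neg, Real.sin_neg, Real.cos_add_pi_div_two, Real.sin_add_pi_div_two]
    have hN' : (N:ℂ) = D / Real.cos a * Real.sin a := by exact_mod_cast hN
    have : (Real.cos a : ℂ) ≠ 0 := ofReal_ne_zero.2 hca.ne'
    rw [hN']
    push_cast
    have : Complex.cos (a:ℂ) ≠ 0 := by rwa [← ofReal_cos]
    field_simp
    ring
  have h1 := Real.neg_pi_div_two_lt_arctan (N / D)
  have h2 := Real.arctan_lt_pi_div_two (N / D)
  rw [e, Complex.arg_mul_cos_add_sin_mul_I (by positivity) ⟨by linarith, by linarith [Real.pi_pos]⟩]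

lemma thetaFun_eq {α : ℝ} (h0 : 0 < α) (h1 : α < 1) {r : ℝ} (hr : 0 < r) :
    thetaFun α r = 1 / 2 + Real.arctan (phaseRatio α r) / Real.pi := by
  unfold thetaFun phaseRatio
  set z := expPowInt α (turnPhase α * ((r ^ (1 - α) : ℝ) : ℂ)) with hz
  have hD := phaseRatio_den_pos h0 h1 hr
  set x := (expPowInt α ((r ^ (1 - α) : ℝ) : ℂ)).re with hx
  have e : GalphaPlus α r = (((2 * Real.pi * r)⁻¹ : ℝ) : ℂ) * (-(z.im : ℂ) - ((x - z.re : ℝ) : ℂ) * I) := by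
    have hxx : expPowInt α ((r ^ (1 - α) : ℝ) : ℂ) = x :=
      Complex.ext (by simp [hx]) (by simp [expPowInt_ofReal_im])
    rw [GalphaPlus_eq h0 h1 hr, hxx, ← hz]
    nth_rw 1 [← re_add_im z]
    have : (Real.pi : ℂ) ≠ 0 := ofReal_ne_zero.2 Real.pi_ne_zero
    have : (r : ℂ) ≠ 0 := ofReal_ne_zero.2 hr.ne'
    push_cast
    field_simp
    ring_nf
    simp only [I_sq]
    ring
  rw [e, arg_neg_sub_mul_I hD (by positivity)]
  have := Real.pi_ne_zero
  field_simp
  ring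

lemma phaseRatio_half {r : ℝ} : phaseRatio (1 / 2) r = 0 := by
  have : turnPhase (1 / 2) = -1 := by
    unfold turnPhase
    rw [← exp_neg_pi_mul_I]; congr 1; push_cast; ring
  unfold phaseRatio
  rw [this, neg_one_mul, ← ofReal_neg, expPowInt_ofReal_im, zero_div]

lemma phaseRatio_antitone_and_tendsto' {α : ℝ} (h0 : 1 / 2 ≤ α) (h1 : α < 1) :
    AntitoneOn (phaseRatio α) (Ioi 0) ∧ Tendsto (phaseRatio α) atTop (𝓝 0) := by
  rcases h0.eq_or_lt with h | h
  · subst h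
    have : phaseRatio (1 / 2) = fun _ => 0 := funext fun _ => phaseRatio_half
    rw [this]
    exact ⟨antitoneOn_const, tendsto_const_nhds⟩
  · exact phaseRatio_antitone_and_tendsto h h1

lemma tendsto_phaseRatio_zero {α : ℝ} (h0 : 0 < α) (h1 : α < 1) :
    Tendsto (phaseRatio α) (𝓝[>] 0) (𝓝 (Real.tan (Real.pi * α - Real.pi / 2))) := by
  obtain ⟨c, hc, hd⟩ := expPowInt_deriv_zero_pos h0 h1
  have hd0 : HasDerivAt (fun x : ℝ => expPowInt α (x:ℂ)) c 0 :=
    HasDerivAt.comp_ofReal (by simpa using hd)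
  have hd1 : HasDerivAt (fun x : ℝ => expPowInt α (turnPhase α * (x:ℂ))) (c * turnPhase α) 0 := by
    have h2 : HasDerivAt (fun z : ℂ => turnPhase α * z) (turnPhase α) ((0:ℝ):ℂ) := by
      simpa using (hasDerivAt_id (0:ℂ)).const_mul (turnPhase α)
    have h3 : HasDerivAt (expPowInt α) c (turnPhase α * ((0:ℝ):ℂ)) := by simpa using hd
    exact (HasDerivAt.comp ((0:ℝ):ℂ) h3 h2).comp_ofReal
  have hs : Tendsto (fun x : ℝ => (x:ℂ)⁻¹ * (expPowInt α (x:ℂ) - expPowInt α (turnPhase α * (x:ℂ))))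
      (𝓝[>] 0) (𝓝 (c - c * turnPhase α)) := by
    have := (hasDerivAt_iff_tendsto_slope.1 (hd0.sub hd1)).mono_left
      (nhdsWithin_mono (0:ℝ) (fun x (hx : 0 < x) => hx.ne'))
    refine this.congr fun x => ?_
    simp [slope]
  have hre := (continuous_re.tendsto _).comp hs
  have him := (continuous_im.tendsto _).comp hs
  have hlim : Real.tan (Real.pi * α - Real.pi / 2) =
      -(c - c * turnPhase α).im / (c - c * turnPhase α).re := by
    have hsin : 0 < Real.sin (Real.pi * α) := Real.sin_pos_of_pos_of_lt_pi (by positivity)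
      (by nlinarith [Real.pi_pos])
    rw [sub_im, sub_re, im_ofReal_mul, re_ofReal_mul, turnPhase_re, turnPhase_im, ofReal_im,
      ofReal_re, show 2 * Real.pi * α = 2 * (Real.pi * α) by ring, Real.sin_two_mul,
      Real.cos_two_mul', Real.tan_eq_sin_div_cos, Real.sin_sub_pi_div_two, Real.cos_sub_pi_div_two]
    have : c - c * (Real.cos (Real.pi * α) ^ 2 - Real.sin (Real.pi * α) ^ 2) =
        2 * c * Real.sin (Real.pi * α) ^ 2 := by
      linear_combination (-c) * Real.sin_sq_add_cos_sq (Real.pi * α)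
    rw [this]
    field_simp
    ring
  have hre0 : (c - c * turnPhase α).re ≠ 0 := by
    rw [sub_re, re_ofReal_mul, ofReal_re]
    nlinarith [turnPhase_re_lt h0 h1]
  have hpow : Tendsto (fun r : ℝ => r ^ (1 - α)) (𝓝[>] 0) (𝓝[>] 0) := by
    refine tendsto_nhdsWithin_iff.2 ⟨?_, ?_⟩
    · have := (Real.continuous_rpow_const (q := 1 - α) (by linarith)).tendsto 0
      rw [Real.zero_rpow (by linarith)] at this
      exact this.mono_left nhdsWithin_le_nhds
    · filter_upwards [self_mem_nhdsWithin] with r hr using Real.rpow_pos_of_pos hr _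
  rw [hlim]
  refine (((him.neg.div hre hre0).comp hpow)).congr' ?_
  filter_upwards [self_mem_nhdsWithin] with r hr
  have hx : 0 < r ^ (1 - α) := Real.rpow_pos_of_pos hr _
  simp only [phaseRatio, Function.comp, Pi.div_apply]
  rw [← ofReal_inv, im_ofReal_mul, re_ofReal_mul, sub_im, sub_re, expPowInt_ofReal_im, zero_sub,
    mul_neg, neg_neg, mul_div_mul_left _ _ (inv_pos.2 hx).ne']

lemma continuousOn_thetaFun {α : ℝ} (h0 : 0 < α) (h1 : α < 1) :
    ContinuousOn (thetaFun α) (Ioi 0) := by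
  have hJ := (differentiable_expPowInt h0 h1).continuous
  have hpow : ContinuousOn (fun r : ℝ => ((r ^ (1 - α) : ℝ) : ℂ)) (Ioi 0) :=
    (continuous_ofReal.comp (Real.continuous_rpow_const (by linarith))).continuousOn
  have h2 := hJ.comp_continuousOn hpow
  have h3 := hJ.comp_continuousOn ((continuousOn_const (c := turnPhase α)).mul hpow)
  have hR : ContinuousOn (phaseRatio α) (Ioi 0) :=
    (continuous_im.comp_continuousOn h3).div
      ((continuous_re.comp_continuousOn h2).sub (continuous_re.comp_continuousOn h3))
      fun r hr => (phaseRatio_den_pos h0 h1 hr).ne'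
  refine ((continuousOn_const (c := (1/2:ℝ))).add
    ((Real.continuous_arctan.comp_continuousOn hR).div_const Real.pi)).congr fun r hr => ?_
  exact thetaFun_eq h0 h1 hr

lemma antitoneOn_thetaFun {α : ℝ} (h0 : 1 / 2 ≤ α) (h1 : α < 1) :
    AntitoneOn (thetaFun α) (Ioi 0) := by
  intro r hr s hs hrs
  have hα : 0 < α := by linarith
  rw [thetaFun_eq hα h1 hr, thetaFun_eq hα h1 hs]
  have := Real.arctan_strictMono.monotone ((phaseRatio_antitone_and_tendsto' h0 h1).1 hr hs hrs)
  gcongr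

lemma tendsto_thetaFun_atTop {α : ℝ} (h0 : 1 / 2 ≤ α) (h1 : α < 1) :
    Tendsto (thetaFun α) atTop (𝓝 (1 / 2)) := by
  have hα : 0 < α := by linarith
  have := ((Real.continuous_arctan.tendsto _).comp
    (phaseRatio_antitone_and_tendsto' h0 h1).2).div_const Real.pi |>.const_add (1 / 2)
  rw [Real.arctan_zero, zero_div, add_zero] at this
  refine this.congr' ?_
  filter_upwards [eventually_gt_atTop 0] with r hr using (thetaFun_eq hα h1 hr).symm

lemma tendsto_thetaFun_zero {α : ℝ} (h0 : 0 < α) (h1 : α < 1) :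
    Tendsto (thetaFun α) (𝓝[>] 0) (𝓝 α) := by
  have := ((Real.continuous_arctan.tendsto _).comp
    (tendsto_phaseRatio_zero h0 h1)).div_const Real.pi |>.const_add (1 / 2)
  have hp := Real.pi_pos
  rw [Real.arctan_tan (by nlinarith) (by nlinarith),
    show 1 / 2 + (Real.pi * α - Real.pi / 2) / Real.pi = α by field_simp; ring] at this
  refine this.congr' ?_
  filter_upwards [self_mem_nhdsWithin] with r hr using (thetaFun_eq h0 h1 hr).symm

lemma half_le_thetaFun {α : ℝ} (h0 : 1 / 2 ≤ α) (h1 : α < 1) {r : ℝ} (hr : 0 < r) :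
    1 / 2 ≤ thetaFun α r := by
  refine le_of_tendsto (tendsto_thetaFun_atTop h0 h1) ?_
  filter_upwards [eventually_ge_atTop r] with s hs
  exact antitoneOn_thetaFun h0 h1 hr (hr.trans_le hs) hs

lemma thetaFun_le {α : ℝ} (h0 : 1 / 2 ≤ α) (h1 : α < 1) {r : ℝ} (hr : 0 < r) :
    thetaFun α r ≤ α := by
  refine ge_of_tendsto (tendsto_thetaFun_zero (by linarith) h1) ?_
  filter_upwards [self_mem_nhdsWithin, nhdsWithin_le_nhds (Iio_mem_nhds hr)] with s hs hs'
  exact antitoneOn_thetaFun h0 h1 hs hr (le_of_lt hs')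

/-- The difference `J(-e^{-iπα}z^{1-α}) - J(-e^{iπα}z^{1-α})` in the logarithmic coordinate
`z = e^ζ`. -/
noncomputable def jumpFun (α : ℝ) (ζ : ℂ) : ℂ :=
  expPowInt α (-exp (-(Real.pi * α : ℂ) * I) * exp ((1 - α) * ζ)) -
    expPowInt α (-exp ((Real.pi * α : ℂ) * I) * exp ((1 - α) * ζ))

lemma differentiable_jumpFun {α : ℝ} (h0 : 0 < α) (h1 : α < 1) : Differentiable ℂ (jumpFun α) := by
  have hJ := differentiable_expPowInt h0 h1
  have he : Differentiable ℂ fun ζ : ℂ => exp ((1 - α) * ζ) := by fun_prop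
  exact (hJ.comp (he.const_mul (-exp (-(Real.pi * α : ℂ) * I)))).sub
    (hJ.comp (he.const_mul (-exp ((Real.pi * α : ℂ) * I))))

lemma conj_exp_phase (α : ℝ) : starRingEnd ℂ (exp ((Real.pi * α : ℂ) * I)) =
    exp (-(Real.pi * α : ℂ) * I) := by
  rw [← exp_conj]; simp

lemma jumpFun_conj (α : ℝ) (ζ : ℂ) : jumpFun α (starRingEnd ℂ ζ) = -starRingEnd ℂ (jumpFun α ζ) := by
  have e : exp ((1 - α) * starRingEnd ℂ ζ) = starRingEnd ℂ (exp ((1 - α) * ζ)) := by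
    rw [← exp_conj]; simp
  have c2 : exp ((Real.pi * α : ℂ) * I) = starRingEnd ℂ (exp (-(Real.pi * α : ℂ) * I)) := by
    rw [← conj_exp_phase, conj_conj]
  have h1 : expPowInt α (-exp (-(Real.pi * α : ℂ) * I) * starRingEnd ℂ (exp ((1 - α) * ζ))) =
      starRingEnd ℂ (expPowInt α (-exp ((Real.pi * α : ℂ) * I) * exp ((1 - α) * ζ))) := by
    rw [← expPowInt_conj, map_mul, map_neg, conj_exp_phase]
  have h2 : expPowInt α (-exp ((Real.pi * α : ℂ) * I) * starRingEnd ℂ (exp ((1 - α) * ζ))) =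
      starRingEnd ℂ (expPowInt α (-exp (-(Real.pi * α : ℂ) * I) * exp ((1 - α) * ζ))) := by
    rw [← expPowInt_conj, map_mul, map_neg, ← c2]
  unfold jumpFun
  rw [e, h1, h2, map_sub]
  ring

lemma exists_norm_jumpFun_le {α : ℝ} (h0 : 0 < α) (h1 : α < 1) : ∃ C, 0 ≤ C ∧ ∀ ζ : ℂ,
    ‖jumpFun α ζ‖ ≤ C * (1 + Real.exp ζ.re) * Real.exp (decayRate α * Real.exp ζ.re) := by
  obtain ⟨C, hC, hb⟩ := exists_expPowInt_re_le h0 h1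
  refine ⟨2 * C, by positivity, fun ζ => ?_⟩
  have hx : (Real.exp ζ.re) ^ (1 - α) = Real.exp ((1 - α) * ζ.re) := by
    rw [← Real.exp_mul]; ring_nf
  have hn : ∀ q : ℂ, ‖q‖ = 1 → ‖expPowInt α (-q * exp ((1 - α) * ζ))‖ ≤
      C * (1 + Real.exp ζ.re) * Real.exp (decayRate α * Real.exp ζ.re) := by
    intro q hq
    refine (norm_expPowInt_le h0 h1 (x := (Real.exp ζ.re) ^ (1 - α)) ?_).trans
      (hb _ (Real.exp_pos _))
    refine (re_le_norm _).trans (le_of_eq ?_)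
    rw [norm_mul, norm_neg, hq, one_mul, norm_exp, hx]
    congr 1
    simp
  have q1 : ‖exp ((Real.pi * α : ℂ) * I)‖ = 1 := by
    rw [← ofReal_mul, norm_exp_ofReal_mul_I]
  have q2 : ‖exp (-(Real.pi * α : ℂ) * I)‖ = 1 := by
    rw [← ofReal_mul, ← ofReal_neg, norm_exp_ofReal_mul_I]
  refine (norm_sub_le _ _).trans ((add_le_add (hn _ q2) (hn _ q1)).trans (le_of_eq ?_))
  ring

lemma exists_norm_jumpFun_real_le {α : ℝ} (h0 : 1 / 2 ≤ α) (h1 : α < 1) : ∃ C, 0 ≤ C ∧ ∀ t : ℝ,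
    ‖jumpFun α t‖ ≤ C * (1 + Real.exp t) * Real.exp (-decayRate α * Real.exp t) := by
  have hα : 0 < α := by linarith
  obtain ⟨C, hC, hb⟩ := exists_norm_jumpFun_le hα h1
  obtain ⟨C', hC', hb'⟩ := exists_im_expPowInt_le h0 h1
  have hδ := decayRate_pos hα h1
  refine ⟨C * Real.exp (2 * decayRate α) + 2 * C', by positivity, fun t => ?_⟩
  have hE := Real.exp_pos t
  have hE' := Real.exp_pos (-decayRate α * Real.exp t)
  rcases le_total 1 (Real.exp t) with h | h
  · have hx : ((Real.exp t) ^ (1 - α) : ℝ) = Real.exp ((1 - α) * t) := by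
      rw [← Real.exp_mul]; ring_nf
    have e : exp ((1 - α) * (t:ℂ)) = (((Real.exp t) ^ (1 - α) : ℝ) : ℂ) := by
      rw [hx]; push_cast; rfl
    have hM : ‖jumpFun α t‖ =
        2 * |(expPowInt α (-exp (Real.pi * α * I) * (((Real.exp t) ^ (1 - α) : ℝ) : ℂ))).im| := by
      have h2 : expPowInt α (-exp (-(Real.pi * α : ℂ) * I) * (((Real.exp t) ^ (1 - α) : ℝ) : ℂ)) =
          starRingEnd ℂ (expPowInt α (-exp ((Real.pi * α : ℂ) * I) *
            (((Real.exp t) ^ (1 - α) : ℝ) : ℂ))) := by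
        rw [← expPowInt_conj, map_mul, map_neg, conj_exp_phase, conj_ofReal]
      unfold jumpFun
      rw [e, h2, ← norm_neg, neg_sub, Complex.sub_conj]
      simp
    rw [hM]
    have := hb' _ h
    have k : C' * Real.exp t * Real.exp (-decayRate α * Real.exp t) ≤
        C' * (1 + Real.exp t) * Real.exp (-decayRate α * Real.exp t) := by
      gcongr; linarith
    have k2 : 0 ≤ C * Real.exp (2 * decayRate α) * (1 + Real.exp t) *
      Real.exp (-decayRate α * Real.exp t) := by positivity
    nlinarith
  · have := hb t
    rw [ofReal_re] at this
    refine this.trans ?_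
    have k : Real.exp (decayRate α * Real.exp t) ≤
        Real.exp (2 * decayRate α) * Real.exp (-decayRate α * Real.exp t) := by
      rw [← Real.exp_add, Real.exp_le_exp]; nlinarith
    calc C * (1 + Real.exp t) * Real.exp (decayRate α * Real.exp t)
        ≤ C * (1 + Real.exp t) * (Real.exp (2 * decayRate α) *
          Real.exp (-decayRate α * Real.exp t)) := by gcongr
      _ ≤ _ := by
        have : 0 ≤ 2 * C' * (1 + Real.exp t) * Real.exp (-decayRate α * Real.exp t) := by positivity
        nlinarith

lemma one_add_exp_re_le {ζ : ℂ} (h : 0 ≤ ζ.im) (h' : ζ.im ≤ Real.pi) :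
    1 + Real.exp ζ.re ≤ 2 * ‖exp ζ + I‖ := by
  have him : 0 ≤ (exp ζ).im := by
    rw [exp_im]; exact mul_nonneg (Real.exp_pos _).le (Real.sin_nonneg_of_nonneg_of_le_pi h h')
  have hE := Real.exp_pos ζ.re
  have h1 : ‖exp ζ + I‖ ^ 2 = (exp ζ).re ^ 2 + ((exp ζ).im + 1) ^ 2 := by
    rw [← normSq_eq_norm_sq, normSq_apply]; simp; ring
  have h2 : Real.exp ζ.re ^ 2 = (exp ζ).re ^ 2 + (exp ζ).im ^ 2 := by
    rw [← norm_exp, ← normSq_eq_norm_sq, normSq_apply]; ring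
  refine abs_le_of_sq_le_sq' ?_ (by positivity) |>.2
  nlinarith [sq_nonneg (Real.exp ζ.re - 1)]

/-- The quotient to which the Phragmén–Lindelöf principle is applied. -/
noncomputable def stripFun (α : ℝ) (ζ : ℂ) : ℂ :=
  jumpFun α ζ * exp (decayRate α * exp ζ) / (exp ζ + I)

lemma norm_exp_mul_exp (a : ℝ) (ζ : ℂ) :
    ‖exp (a * exp ζ)‖ = Real.exp (a * (Real.exp ζ.re * Real.cos ζ.im)) := by
  rw [norm_exp, re_ofReal_mul, exp_re]

lemma norm_exp_I_mul_exp (a : ℝ) (ζ : ℂ) :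
    ‖exp (a * I * exp ζ)‖ = Real.exp (-a * (Real.exp ζ.re * Real.sin ζ.im)) := by
  rw [norm_exp, mul_assoc, re_ofReal_mul, I_mul_re, exp_im]
  ring_nf

lemma exists_norm_stripFun_le {α : ℝ} (h0 : 1 / 2 ≤ α) (h1 : α < 1) : ∃ C, 0 ≤ C ∧
    (∀ ζ : ℂ, 0 ≤ ζ.im → ζ.im ≤ Real.pi → ‖stripFun α ζ‖ ≤
      C * Real.exp (decayRate α * (1 + Real.cos ζ.im) * Real.exp ζ.re)) ∧
    ∀ ζ : ℂ, ζ.im = 0 → ‖stripFun α ζ‖ ≤ C := by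
  have hα : 0 < α := by linarith
  obtain ⟨C, hC, hb⟩ := exists_norm_jumpFun_le hα h1
  obtain ⟨C', hC', hb'⟩ := exists_norm_jumpFun_real_le h0 h1
  have hδ := decayRate_pos hα h1
  refine ⟨2 * C + 2 * C', by positivity, fun ζ h2 h3 => ?_, fun ζ h2 => ?_⟩
  · have hd := one_add_exp_re_le h2 h3
    have hE := Real.exp_pos ζ.re
    have hdp : 0 < ‖exp ζ + I‖ := by linarith
    unfold stripFun
    rw [norm_div, div_le_iff₀ hdp, norm_mul, norm_exp_mul_exp]
    calc ‖jumpFun α ζ‖ * Real.exp (decayRate α * (Real.exp ζ.re * Real.cos ζ.im))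
        ≤ C * (1 + Real.exp ζ.re) * Real.exp (decayRate α * Real.exp ζ.re) *
          Real.exp (decayRate α * (Real.exp ζ.re * Real.cos ζ.im)) := by gcongr; exact hb ζ
      _ = C * (1 + Real.exp ζ.re) *
          Real.exp (decayRate α * (1 + Real.cos ζ.im) * Real.exp ζ.re) := by
        rw [mul_assoc, ← Real.exp_add]; ring_nf
      _ ≤ C * (2 * ‖exp ζ + I‖) *
          Real.exp (decayRate α * (1 + Real.cos ζ.im) * Real.exp ζ.re) := by gcongr
      _ ≤ _ := by
        have : 0 ≤ 2 * C' * Real.exp (decayRate α * (1 + Real.cos ζ.im) * Real.exp ζ.re) *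
          ‖exp ζ + I‖ := by positivity
        nlinarith
  · have hd := one_add_exp_re_le h2.ge (by rw [h2]; exact Real.pi_pos.le)
    have hE := Real.exp_pos ζ.re
    have hdp : 0 < ‖exp ζ + I‖ := by linarith
    have hζ : ζ = (ζ.re : ℂ) := Complex.ext (by simp) (by simp [h2])
    have hj := hb' ζ.re
    rw [← hζ] at hj
    unfold stripFun
    rw [norm_div, div_le_iff₀ hdp, norm_mul, norm_exp_mul_exp, h2, Real.cos_zero, mul_one]
    calc ‖jumpFun α ζ‖ * Real.exp (decayRate α * Real.exp ζ.re)
        ≤ C' * (1 + Real.exp ζ.re) * Real.exp (-decayRate α * Real.exp ζ.re) *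
          Real.exp (decayRate α * Real.exp ζ.re) := by gcongr
      _ = C' * (1 + Real.exp ζ.re) := by
        rw [mul_assoc, ← Real.exp_add]; simp
      _ ≤ C' * (2 * ‖exp ζ + I‖) := by gcongr
      _ ≤ _ := by
        have : 0 ≤ 2 * C * ‖exp ζ + I‖ := by positivity
        nlinarith

lemma diffContOnCl_strip {f : ℂ → ℂ} {a b : ℝ}
    (hf : ∀ ζ : ℂ, a ≤ ζ.im → ζ.im ≤ b → DifferentiableAt ℂ f ζ) :
    DiffContOnCl ℂ f (im ⁻¹' Ioo a b) := by
  refine DifferentiableOn.diffContOnCl fun ζ hζ => ?_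
  have : closure (im ⁻¹' Ioo a b) ⊆ im ⁻¹' Icc a b :=
    closure_minimal (preimage_mono Ioo_subset_Icc_self) (isClosed_Icc.preimage continuous_im)
  exact (hf ζ (this hζ).1 (this hζ).2).differentiableWithinAt

lemma differentiableAt_stripFun {α : ℝ} (h0 : 0 < α) (h1 : α < 1) {ζ : ℂ} (h : 0 ≤ ζ.im)
    (h' : ζ.im ≤ Real.pi) : DifferentiableAt ℂ (stripFun α) ζ := by
  have hd : exp ζ + I ≠ 0 := fun h2 => by
    have := one_add_exp_re_le h h'
    rw [h2, norm_zero] at this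
    linarith [Real.exp_pos ζ.re]
  have := (differentiable_jumpFun h0 h1) ζ
  unfold stripFun
  fun_prop (disch := exact hd)

lemma exists_norm_stripFun_le_const {α : ℝ} (h0 : 1 / 2 ≤ α) (h1 : α < 1) : ∃ C, 0 ≤ C ∧
    ∀ ζ : ℂ, 0 ≤ ζ.im → ζ.im < Real.pi → ‖stripFun α ζ‖ ≤ C := by
  have hα : 0 < α := by linarith
  obtain ⟨C, hC, hb, hb'⟩ := exists_norm_stripFun_le h0 h1
  have hδ := decayRate_pos hα h1
  refine ⟨C, hC, fun ζ hζ0 hζ1 => ?_⟩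
  set κ : ℝ → ℝ := fun ψ => decayRate α * (Real.cos (ψ / 2) / Real.sin (ψ / 2)) with hκ
  have key : ∀ ψ, ζ.im ≤ ψ → 0 < ψ → ψ < Real.pi →
      ‖stripFun α ζ‖ ≤ C * Real.exp (κ ψ * (Real.exp ζ.re * Real.sin ζ.im)) := by
    intro ψ h2 h3 h4
    have hs : 0 < Real.sin (ψ / 2) := Real.sin_pos_of_pos_of_lt_pi (by linarith) (by linarith)
    have hc : 0 < Real.cos (ψ / 2) := Real.cos_pos_of_mem_Ioo ⟨by linarith, by linarith⟩
    have hκ0 : 0 < κ ψ := by simp only [hκ]; positivity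
    have hκe : κ ψ * Real.sin ψ = decayRate α * (1 + Real.cos ψ) := by
      have e1 : Real.sin ψ = 2 * Real.sin (ψ / 2) * Real.cos (ψ / 2) := by
        rw [← Real.sin_two_mul]; ring_nf
      have e2 : Real.cos ψ = 2 * Real.cos (ψ / 2) ^ 2 - 1 := by
        rw [← Real.cos_two_mul]; ring_nf
      simp only [hκ]; rw [e1, e2]; field_simp; ring
    have hPL := PhragmenLindelof.horizontal_strip (a := 0) (b := ψ) (C := C) (z := ζ)
      (f := fun ζ => stripFun α ζ * exp (κ ψ * I * exp ζ)) ?_ ?_ ?_ ?_ hζ0 h2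
    · rw [norm_mul, norm_exp_I_mul_exp] at hPL
      have := Real.exp_pos (κ ψ * (Real.exp ζ.re * Real.sin ζ.im))
      calc ‖stripFun α ζ‖ = ‖stripFun α ζ‖ * Real.exp (-κ ψ * (Real.exp ζ.re * Real.sin ζ.im)) *
            Real.exp (κ ψ * (Real.exp ζ.re * Real.sin ζ.im)) := by
            rw [mul_assoc, ← Real.exp_add]; simp
        _ ≤ _ := by gcongr
    · refine diffContOnCl_strip fun z hz hz' => ?_
      have := differentiableAt_stripFun hα h1 hz (hz'.trans h4.le)
      fun_prop
    · refine ⟨1, ?_, 2 * decayRate α, ?_⟩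
      · rw [sub_zero, lt_div_iff₀ h3]; linarith
      · refine Asymptotics.IsBigO.of_bound C ?_
        refine eventually_inf_principal.2 (Eventually.of_forall fun z hz => ?_)
        have hz1 : 0 < z.im := hz.1
        have hz2 : z.im < ψ := hz.2
        rw [norm_mul, norm_exp_I_mul_exp, Real.norm_eq_abs, Real.abs_exp, one_mul]
        have hsz : 0 ≤ Real.sin z.im :=
          Real.sin_nonneg_of_nonneg_of_le_pi hz1.le (hz2.trans h4).le
        have f1 : Real.exp (-κ ψ * (Real.exp z.re * Real.sin z.im)) ≤ 1 := by
          rw [Real.exp_le_one_iff]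
          have : 0 ≤ κ ψ * (Real.exp z.re * Real.sin z.im) := by positivity
          linarith
        have f2 : Real.exp (decayRate α * (1 + Real.cos z.im) * Real.exp z.re) ≤
            Real.exp (2 * decayRate α * Real.exp |z.re|) := by
          rw [Real.exp_le_exp]
          have k1 : Real.exp z.re ≤ Real.exp |z.re| := Real.exp_le_exp.2 (le_abs_self _)
          have k2 : decayRate α * (1 + Real.cos z.im) ≤ 2 * decayRate α := by
            nlinarith [Real.cos_le_one z.im]
          exact mul_le_mul k2 k1 (Real.exp_pos _).le (by positivity)
        calc ‖stripFun α z‖ * Real.exp (-κ ψ * (Real.exp z.re * Real.sin z.im))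
            ≤ C * Real.exp (2 * decayRate α * Real.exp |z.re|) * 1 := by
              refine mul_le_mul ?_ f1 (Real.exp_pos _).le (by positivity)
              exact (hb z hz1.le (hz2.trans h4).le).trans (by gcongr)
          _ = _ := mul_one _
    · intro z hz
      rw [norm_mul, norm_exp_I_mul_exp, hz]
      simpa using hb' z hz
    · intro z hz
      rw [norm_mul, norm_exp_I_mul_exp]
      refine (mul_le_mul_of_nonneg_right (hb z (by linarith) (by linarith))
        (Real.exp_pos _).le).trans (le_of_eq ?_)
      rw [mul_assoc, ← Real.exp_add, hz, ← hκe]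
      ring_nf
      simp
  have hlim : Tendsto (fun ψ => C * Real.exp (κ ψ * (Real.exp ζ.re * Real.sin ζ.im)))
      (𝓝[<] Real.pi) (𝓝 C) := by
    have hc : ContinuousAt (fun ψ => C * Real.exp (κ ψ * (Real.exp ζ.re * Real.sin ζ.im)))
        Real.pi := by
      have : ContinuousAt κ Real.pi := by
        refine continuousAt_const.mul (ContinuousAt.div (by fun_prop) (by fun_prop) ?_)
        rw [Real.sin_pi_div_two]; exact one_ne_zero
      fun_prop
    have h2 := hc.tendsto
    have h3 : κ Real.pi = 0 := by simp [hκ]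
    rw [h3, zero_mul, Real.exp_zero, mul_one] at h2
    exact h2.mono_left nhdsWithin_le_nhds
  refine ge_of_tendsto hlim ?_
  filter_upwards [self_mem_nhdsWithin, nhdsWithin_le_nhds (Ioi_mem_nhds hζ1),
    nhdsWithin_le_nhds (Ioi_mem_nhds Real.pi_pos)] with ψ h2 h3 h4
  exact key ψ (le_of_lt h3) h4 h2

/-- The function `z^α e^{δ z} G_α(z)` in the logarithmic coordinate `z = e^ζ`. -/
noncomputable def pickFun (α : ℝ) (ζ : ℂ) : ℂ :=
  exp ((α - 1) * ζ) * jumpFun α ζ * exp (decayRate α * exp ζ) / (2 * Real.pi * I)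

lemma differentiable_pickFun {α : ℝ} (h0 : 0 < α) (h1 : α < 1) : Differentiable ℂ (pickFun α) := by
  have := differentiable_jumpFun h0 h1
  unfold pickFun
  fun_prop

lemma pickFun_conj (α : ℝ) (ζ : ℂ) : pickFun α (starRingEnd ℂ ζ) = starRingEnd ℂ (pickFun α ζ) := by
  unfold pickFun
  simp only [map_div₀, map_mul, jumpFun_conj, ← exp_conj, map_sub, map_one, conj_ofReal, conj_I,
    map_ofNat]
  rw [mul_neg, mul_neg, neg_mul, div_neg, neg_div]

lemma pickFun_ofReal_im (α t : ℝ) : (pickFun α t).im = 0 := by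
  have := pickFun_conj α t
  rw [conj_ofReal] at this
  exact conj_eq_iff_im.1 this.symm

lemma pickFun_add_pi {α : ℝ} (h0 : 0 < α) (h1 : α < 1) (t : ℝ) :
    pickFun α (t + Real.pi * I) =
      ((Real.exp (α * t) * Real.exp (-decayRate α * Real.exp t) * ‖GalphaPlus α (Real.exp t)‖ : ℝ) : ℂ)
        * exp ((Real.pi * (α - thetaFun α (Real.exp t)) : ℝ) * I) := by
  have hr := Real.exp_pos t
  have hG := GalphaPlus_eq h0 h1 hr
  have hx : ((Real.exp t) ^ (1 - α) : ℝ) = Real.exp ((1 - α) * t) := by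
    rw [← Real.exp_mul]; ring_nf
  have harg : GalphaPlus α (Real.exp t) = ‖GalphaPlus α (Real.exp t)‖ *
      exp ((-(Real.pi * thetaFun α (Real.exp t)) : ℝ) * I) := by
    have : -(Real.pi * thetaFun α (Real.exp t)) = (GalphaPlus α (Real.exp t)).arg := by
      unfold thetaFun
      have := Real.pi_ne_zero
      field_simp
    rw [this, norm_mul_exp_arg_mul_I]
  have e1 : -exp (-(Real.pi * α : ℂ) * I) * exp ((1 - α) * (t + Real.pi * I)) =
      turnPhase α * (((Real.exp t) ^ (1 - α) : ℝ) : ℂ) := by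
    rw [hx, turnPhase, ofReal_exp, neg_mul, ← exp_add, ← exp_add, ← neg_one_mul, ← exp_neg_pi_mul_I,
      ← exp_add]
    congr 1; push_cast; ring
  have e2 : -exp ((Real.pi * α : ℂ) * I) * exp ((1 - α) * (t + Real.pi * I)) =
      (((Real.exp t) ^ (1 - α) : ℝ) : ℂ) := by
    rw [hx, ofReal_exp, neg_mul, ← exp_add, ← neg_one_mul, ← exp_neg_pi_mul_I,
      ← exp_add]
    congr 1; push_cast; ring
  have e3 : exp (t + Real.pi * I) = -(Real.exp t : ℂ) := by
    rw [exp_add, exp_pi_mul_I, ofReal_exp]; ring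
  have e4 : exp ((α - 1) * (t + Real.pi * I)) = -(exp (α * t) * exp (Real.pi * α * I) / Real.exp t) := by
    rw [ofReal_exp, ← exp_add, ← exp_sub, ← neg_one_mul, ← exp_neg_pi_mul_I, ← exp_add]
    congr 1; ring
  have hne : (Real.exp t : ℂ) ≠ 0 := ofReal_ne_zero.2 hr.ne'
  have step : pickFun α (t + Real.pi * I) = exp (α * t) * exp (-decayRate α * Real.exp t) *
      (exp (Real.pi * α * I) * GalphaPlus α (Real.exp t)) := by
    unfold pickFun jumpFun
    rw [e1, e2, e3, e4, hG, mul_neg, neg_mul]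
    have : (2 * Real.pi * I : ℂ) ≠ 0 := by simp [Real.pi_ne_zero]
    field_simp
    ring
  have e5 : exp ((Real.pi * (α - thetaFun α (Real.exp t)) : ℝ) * I) = exp (Real.pi * α * I) *
      exp ((-(Real.pi * thetaFun α (Real.exp t)) : ℝ) * I) := by
    rw [← exp_add]; congr 1; push_cast; ring
  rw [step, e5]
  nth_rw 1 [harg]
  push_cast
  ring

lemma GalphaPlus_ne_zero {α : ℝ} (h0 : 0 < α) (h1 : α < 1) {r : ℝ} (hr : 0 < r) :
    GalphaPlus α r ≠ 0 := by
  have hd := phaseRatio_den_pos h0 h1 hr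
  rw [GalphaPlus_eq h0 h1 hr]
  refine mul_ne_zero (by simp [Real.pi_ne_zero]) (div_ne_zero (fun h => ?_) (by simpa using hr.ne'))
  have := congrArg Complex.re h
  rw [sub_re, zero_re] at this
  linarith

lemma exists_norm_pickFun_le {α : ℝ} (h0 : 1 / 2 ≤ α) (h1 : α < 1) : ∃ C, 0 ≤ C ∧
    ∀ ζ : ℂ, 0 ≤ ζ.im → ζ.im < Real.pi → ‖pickFun α ζ‖ ≤ C * Real.exp (α * |ζ.re|) := by
  obtain ⟨C, hC, hb⟩ := exists_norm_stripFun_le_const h0 h1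
  have hp := Real.pi_pos
  refine ⟨2 * C / (2 * Real.pi), by positivity, fun ζ hζ hζ' => ?_⟩
  have hd := one_add_exp_re_le hζ hζ'.le
  have hE := Real.exp_pos ζ.re
  have hne : exp ζ + I ≠ 0 := norm_pos_iff.1 (by linarith)
  have e : pickFun α ζ = exp ((α - 1) * ζ) * (stripFun α ζ * (exp ζ + I)) / (2 * Real.pi * I) := by
    unfold pickFun stripFun
    field_simp
  have h2 : ‖exp ζ + I‖ ≤ 1 + Real.exp ζ.re := by
    refine (norm_add_le _ _).trans (le_of_eq ?_)
    rw [norm_exp, norm_I, add_comm]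
  have h3 : ‖exp ((α - 1) * ζ)‖ = Real.exp ((α - 1) * ζ.re) := by
    rw [norm_exp, ← ofReal_one, ← ofReal_sub, re_ofReal_mul]
  have h4 : ‖(2 * Real.pi * I : ℂ)‖ = 2 * Real.pi := by
    simp [abs_of_pos hp]
  have h5 : Real.exp ((α - 1) * ζ.re) * (1 + Real.exp ζ.re) ≤ 2 * Real.exp (α * |ζ.re|) := by
    rw [mul_add, mul_one, ← Real.exp_add]
    have k1 : Real.exp ((α - 1) * ζ.re) ≤ Real.exp (α * |ζ.re|) :=
      Real.exp_le_exp.2 (by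
        rcases abs_cases ζ.re with ⟨h, h'⟩ | ⟨h, h'⟩ <;> rw [h] <;> nlinarith)
    have k2 : Real.exp ((α - 1) * ζ.re + ζ.re) ≤ Real.exp (α * |ζ.re|) :=
      Real.exp_le_exp.2 (by
        rcases abs_cases ζ.re with ⟨h, h'⟩ | ⟨h, h'⟩ <;> rw [h] <;> nlinarith)
    linarith
  rw [e, norm_div, norm_mul, norm_mul, h3, h4, div_mul_eq_mul_div]
  refine div_le_div_of_nonneg_right ?_ (by positivity)
  calc Real.exp ((α - 1) * ζ.re) * (‖stripFun α ζ‖ * ‖exp ζ + I‖)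
      ≤ Real.exp ((α - 1) * ζ.re) * (C * (1 + Real.exp ζ.re)) := by
        gcongr
        exact hb ζ hζ hζ'
    _ ≤ 2 * C * Real.exp (α * |ζ.re|) := by nlinarith

lemma pickFun_im_nonneg {α : ℝ} (h0 : 1 / 2 ≤ α) (h1 : α < 1) {ζ : ℂ} (hζ : 0 ≤ ζ.im)
    (hζ' : ζ.im ≤ Real.pi) : 0 ≤ (pickFun α ζ).im := by
  have hα : 0 < α := by linarith
  have hp := Real.pi_pos
  obtain ⟨C, hC, hb⟩ := exists_norm_pickFun_le h0 h1
  have hn : ∀ z, ‖exp (I * pickFun α z)‖ = Real.exp (-(pickFun α z).im) := fun z => by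
    rw [norm_exp, I_mul_re]
  have hPL := PhragmenLindelof.horizontal_strip (a := 0) (b := Real.pi) (C := 1) (z := ζ)
    (f := fun ζ => exp (I * pickFun α ζ)) ?_ ?_ ?_ ?_ hζ hζ'
  · rw [hn, Real.exp_le_one_iff] at hPL
    linarith
  · refine diffContOnCl_strip fun z _ _ => ?_
    have := differentiable_pickFun hα h1 z
    fun_prop
  · refine ⟨α, ?_, C, ?_⟩
    · rw [sub_zero, div_self hp.ne']; exact h1
    · refine Asymptotics.IsBigO.of_bound 1 ?_
      refine eventually_inf_principal.2 (Eventually.of_forall fun z hz => ?_)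
      rw [hn, Real.norm_eq_abs, Real.abs_exp, one_mul, Real.exp_le_exp]
      exact (neg_le_abs _).trans ((abs_im_le_norm _).trans (hb z hz.1.le hz.2))
  · intro z hz
    have : z = (z.re : ℂ) := Complex.ext (by simp) (by simp [hz])
    rw [hn, this, pickFun_ofReal_im]; simp
  · intro z hz
    have : z = (z.re : ℂ) + Real.pi * I := Complex.ext (by simp) (by simp [hz])
    rw [hn, this, pickFun_add_pi hα h1, im_ofReal_mul, exp_ofReal_mul_I_im, Real.exp_le_one_iff]
    have hr := Real.exp_pos z.re
    have t1 := half_le_thetaFun h0 h1 hr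
    have t2 := thetaFun_le h0 h1 hr
    have : 0 ≤ Real.sin (Real.pi * (α - thetaFun α (Real.exp z.re))) :=
      Real.sin_nonneg_of_nonneg_of_le_pi (mul_nonneg hp.le (by linarith)) (by nlinarith)
    rw [neg_nonpos]
    positivity

lemma hasDerivAt_pickFun_re {α : ℝ} (h0 : 1 / 2 ≤ α) (h1 : α < 1) (t : ℝ) :
    HasDerivAt (fun t : ℝ => (pickFun α t).re) (deriv (pickFun α) t).re t ∧
      0 ≤ (deriv (pickFun α) t).re := by
  have hd := (differentiable_pickFun (by linarith) h1 (t:ℂ)).hasDerivAt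
  refine ⟨hd.real_of_complex, ?_⟩
  have h2 : HasDerivAt (fun ε : ℝ => pickFun α (t + ε * I)) (deriv (pickFun α) t * I) 0 := by
    have h3 : HasDerivAt (fun z : ℂ => (t:ℂ) + z * I) I ((0:ℝ):ℂ) := by
      simpa using ((hasDerivAt_id (0:ℂ)).mul_const I).const_add (t:ℂ)
    have h4 : HasDerivAt (pickFun α) (deriv (pickFun α) t) ((t:ℂ) + ((0:ℝ):ℂ) * I) := by simpa using hd
    exact (HasDerivAt.comp ((0:ℝ):ℂ) h4 h3).comp_ofReal
  have hs := (hasDerivAt_iff_tendsto_slope.1 h2).mono_left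
      (nhdsWithin_mono (0:ℝ) (fun x (hx : x ∈ Ioi 0) => (ne_of_gt hx : x ≠ 0)))
  have hlim := (continuous_im.tendsto _).comp hs
  rw [mul_I_im] at hlim
  refine ge_of_tendsto hlim ?_
  filter_upwards [self_mem_nhdsWithin, nhdsWithin_le_nhds (Iio_mem_nhds Real.pi_pos)] with ε h5 h6
  have h5' : 0 < ε := h5
  have h6' : ε < Real.pi := h6
  simp only [Function.comp, slope, vsub_eq_sub, sub_zero, ofReal_zero, zero_mul, add_zero,
    smul_im, sub_im, pickFun_ofReal_im, smul_eq_mul]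
  refine mul_nonneg (inv_pos.2 h5').le (pickFun_im_nonneg h0 h1 ?_ ?_) <;> simp
  · exact h5'.le
  · exact h6'.le

lemma tendsto_pickFun_atBot {α : ℝ} (h0 : 0 < α) (h1 : α < 1) : ∃ L : ℝ, 0 < L ∧
    Tendsto (fun t : ℝ => (pickFun α t).re) atBot (𝓝 L) := by
  obtain ⟨c, hc, hd⟩ := expPowInt_deriv_zero_pos h0 h1
  have hp := Real.pi_pos
  have hsin : 0 < Real.sin (Real.pi * α) := Real.sin_pos_of_pos_of_lt_pi (by positivity)
    (by nlinarith [Real.pi_pos])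
  refine ⟨c * Real.sin (Real.pi * α) / Real.pi, by positivity, ?_⟩
  have hdq : ∀ q : ℂ, HasDerivAt (fun x : ℝ => expPowInt α (q * (x:ℂ))) (c * q) 0 := fun q => by
    have h2 : HasDerivAt (fun z : ℂ => q * z) q ((0:ℝ):ℂ) := by
      simpa using (hasDerivAt_id (0:ℂ)).const_mul q
    have h3 : HasDerivAt (expPowInt α) c (q * ((0:ℝ):ℂ)) := by simpa using hd
    exact (HasDerivAt.comp ((0:ℝ):ℂ) h3 h2).comp_ofReal
  set q₁ := -exp (-(Real.pi * α : ℂ) * I) with hq₁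
  set q₂ := -exp ((Real.pi * α : ℂ) * I) with hq₂
  have hs : Tendsto (fun x : ℝ => (x:ℂ)⁻¹ * (expPowInt α (q₁ * (x:ℂ)) - expPowInt α (q₂ * (x:ℂ))))
      (𝓝[>] 0) (𝓝 (c * q₁ - c * q₂)) := by
    have := (hasDerivAt_iff_tendsto_slope.1 ((hdq q₁).sub (hdq q₂))).mono_left
      (nhdsWithin_mono (0:ℝ) (fun x (hx : 0 < x) => hx.ne'))
    refine this.congr fun x => ?_
    simp [slope]
  have hpow : Tendsto (fun t : ℝ => Real.exp ((1 - α) * t)) atBot (𝓝[>] 0) := by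
    refine tendsto_nhdsWithin_iff.2 ⟨?_, Eventually.of_forall fun t => Real.exp_pos _⟩
    exact Real.tendsto_exp_atBot.comp (tendsto_id.const_mul_atBot (by linarith))
  have hexp : Tendsto (fun t : ℝ => exp (decayRate α * exp (t:ℂ)) / (2 * Real.pi * I)) atBot
      (𝓝 (1 / (2 * Real.pi * I))) := by
    have h2 : Tendsto (fun t : ℝ => ((Real.exp t : ℝ) : ℂ)) atBot (𝓝 0) := by
      have := (continuous_ofReal.tendsto 0).comp Real.tendsto_exp_atBot
      rwa [ofReal_zero] at this
    have h3 := (continuous_exp.tendsto _).comp (h2.const_mul (decayRate α : ℂ))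
    rw [mul_zero, exp_zero] at h3
    exact (h3.congr fun t => by simp).div_const _
  have hlim := (continuous_re.tendsto _).comp ((hs.comp hpow).mul hexp)
  have hval : ((c * q₁ - c * q₂) * (1 / (2 * Real.pi * I))).re =
      c * Real.sin (Real.pi * α) / Real.pi := by
    have : (c * q₁ - c * q₂) * (1 / (2 * Real.pi * I)) =
        ((c * Real.sin (Real.pi * α) / Real.pi : ℝ) : ℂ) := by
      rw [hq₁, hq₂, exp_mul_I, exp_mul_I, Complex.cos_neg, Complex.sin_neg]
      have : (Real.pi : ℂ) ≠ 0 := ofReal_ne_zero.2 hp.ne'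
      push_cast
      field_simp
      ring
    rw [this, ofReal_re]
  rw [hval] at hlim
  refine hlim.congr fun t => ?_
  simp only [Function.comp]
  congr 1
  unfold pickFun jumpFun
  have e : exp ((1 - α) * (t:ℂ)) = ((Real.exp ((1 - α) * t) : ℝ) : ℂ) := by push_cast; rfl
  have e2 : exp ((α - 1) * (t:ℂ)) = ((Real.exp ((1 - α) * t) : ℝ) : ℂ)⁻¹ := by
    rw [← e, ← exp_neg]; congr 1; ring
  rw [e, e2]
  ring

lemma pickFun_ofReal_re_pos {α : ℝ} (h0 : 1 / 2 ≤ α) (h1 : α < 1) (t : ℝ) :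
    0 < (pickFun α t).re := by
  obtain ⟨L, hL, hlim⟩ := tendsto_pickFun_atBot (by linarith) h1
  have hm : Monotone fun t : ℝ => (pickFun α t).re :=
    monotone_of_deriv_nonneg (fun t => (hasDerivAt_pickFun_re h0 h1 t).1.differentiableAt)
      fun t => by rw [(hasDerivAt_pickFun_re h0 h1 t).1.deriv]; exact (hasDerivAt_pickFun_re h0 h1 t).2
  exact hL.trans_le (hm.le_of_tendsto hlim t)

lemma pickFun_mem_slitPlane_of_pos {α : ℝ} (h0 : 1 / 2 ≤ α) (h1 : α < 1) {ζ : ℂ} (hζ : 0 < ζ.im)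
    (hζ' : ζ.im < Real.pi) : pickFun α ζ ∈ slitPlane := by
  have hd := differentiable_pickFun (α := α) (by linarith) h1
  set U := im ⁻¹' Ioo 0 Real.pi with hU
  have hUo : IsOpen U := isOpen_Ioo.preimage continuous_im
  have hUc : IsPreconnected U := by
    have : Convex ℝ U := (convex_Ioo 0 Real.pi).linear_preimage imLm
    exact this.isPreconnected
  have han : AnalyticOnNhd ℂ (pickFun α) U := fun z _ => hd.analyticAt z
  rcases han.is_constant_or_isOpen hUc with ⟨v, hv⟩ | ho
  · have hlim : Tendsto (fun ε : ℝ => pickFun α (ε * I)) (𝓝[>] 0) (𝓝 (pickFun α 0)) := by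
      have : Continuous fun ε : ℝ => pickFun α (ε * I) := by
        have := hd.continuous
        fun_prop
      have h2 := this.tendsto 0
      rw [ofReal_zero, zero_mul] at h2
      exact h2.mono_left nhdsWithin_le_nhds
    have hc : Tendsto (fun ε : ℝ => pickFun α (ε * I)) (𝓝[>] 0) (𝓝 v) := by
      refine tendsto_const_nhds.congr' ?_
      filter_upwards [self_mem_nhdsWithin, nhdsWithin_le_nhds (Iio_mem_nhds Real.pi_pos)]
        with ε h5 h6
      exact (hv _ (by simp [hU]; exact ⟨h5, h6⟩)).symm
    rw [hv ζ ⟨hζ, hζ'⟩, tendsto_nhds_unique hc hlim]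
    left
    have := pickFun_ofReal_re_pos h0 h1 0
    rwa [ofReal_zero] at this
  · right
    intro him
    have hI := ho U subset_rfl hUo
    have hmem : pickFun α ζ ∈ pickFun α '' U := ⟨ζ, ⟨hζ, hζ'⟩, rfl⟩
    obtain ⟨ε, hε, hball⟩ := Metric.isOpen_iff.1 hI _ hmem
    have : pickFun α ζ - (ε / 2 : ℝ) * I ∈ Metric.ball (pickFun α ζ) ε := by
      rw [Metric.mem_ball, dist_eq_norm, sub_sub_cancel_left, norm_neg, norm_mul, norm_I, mul_one,
        norm_real, Real.norm_eq_abs, abs_of_pos (by positivity)]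
      linarith
    obtain ⟨z, hz, hz'⟩ := hball this
    have h2 := pickFun_im_nonneg h0 h1 hz.1.le hz.2.le
    rw [hz', sub_im, him, im_ofReal_mul, I_im] at h2
    linarith

lemma pickFun_mem_slitPlane {α : ℝ} (h0 : 1 / 2 ≤ α) (h1 : α < 1) {ζ : ℂ} (hζ : |ζ.im| < Real.pi) :
    pickFun α ζ ∈ slitPlane := by
  rw [abs_lt] at hζ
  rcases lt_trichotomy ζ.im 0 with h | h | h
  · have h2 := pickFun_mem_slitPlane_of_pos h0 h1 (ζ := starRingEnd ℂ ζ) (by simpa using h)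
      (by rw [conj_im]; linarith)
    rw [pickFun_conj] at h2
    simpa [mem_slitPlane_iff] using h2
  · have : ζ = (ζ.re : ℂ) := Complex.ext (by simp) (by simp [h])
    left
    rw [this]
    exact pickFun_ofReal_re_pos h0 h1 _
  · exact pickFun_mem_slitPlane_of_pos h0 h1 h hζ.2

/-- A class of nonnegative functions closed under `f ↦ -f'` consists of completely monotone
functions. -/
lemma completelyMonotone_of_class {S : (ℝ → ℝ) → Prop} (hpos : ∀ f, S f → ∀ w, 0 < w → 0 ≤ f w)
    (hder : ∀ f, S f → ∃ g, S g ∧ ∀ w, 0 < w → HasDerivAt f (-g w) w) {f : ℝ → ℝ} (hf : S f) :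
    CompletelyMonotone f := by
  constructor
  · rw [contDiffOn_infty]
    intro n
    induction n generalizing f with
    | zero =>
      obtain ⟨g, -, hd⟩ := hder f hf
      exact contDiffOn_zero.2 fun w hw => (hd w hw).continuousAt.continuousWithinAt
    | succ n ih =>
      obtain ⟨g, hg, hd⟩ := hder f hf
      push_cast
      rw [contDiffOn_succ_iff_deriv_of_isOpen isOpen_Ioi]
      refine ⟨fun w hw => (hd w hw).differentiableAt.differentiableWithinAt, by simp, ?_⟩
      exact (ih hg).neg.congr fun w hw => (hd w hw).deriv
  · intro n
    have : ∃ g, S g ∧ ∀ w, 0 < w → iteratedDeriv n f w = (-1) ^ n * g w := by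
      induction n with
      | zero => exact ⟨f, hf, fun w _ => by simp⟩
      | succ n ih =>
        obtain ⟨g, hg, hgi⟩ := ih
        obtain ⟨g', hg', hd⟩ := hder g hg
        refine ⟨g', hg', fun w hw => ?_⟩
        have he : iteratedDeriv n f =ᶠ[𝓝 w] fun w => (-1) ^ n * g w := by
          filter_upwards [Ioi_mem_nhds hw] with x hx using hgi x hx
        rw [iteratedDeriv_succ, he.deriv_eq, ((hd w hw).const_mul _).deriv]
        ring
    obtain ⟨g, hg, hgi⟩ := this
    intro w hw
    rw [hgi w hw, ← mul_assoc, ← mul_pow]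
    simpa using hpos g hg w hw

/-- Sums and products of the members of a sequence of functions and of one further function. -/
inductive ChainClass (A : ℕ → ℝ → ℝ) (E : ℝ → ℝ) : (ℝ → ℝ) → Prop
  | chain (k : ℕ) : ChainClass A E (A k)
  | base : ChainClass A E E
  | add {f g : ℝ → ℝ} : ChainClass A E f → ChainClass A E g → ChainClass A E (f + g)
  | mul {f g : ℝ → ℝ} : ChainClass A E f → ChainClass A E g → ChainClass A E (f * g)

lemma completelyMonotone_of_deriv_eq_mul {A : ℕ → ℝ → ℝ} {E : ℝ → ℝ}
    (hA : ∀ k w, 0 < w → 0 ≤ A k w) (hA' : ∀ k w, 0 < w → HasDerivAt (A k) (-A (k + 1) w) w)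
    (hE : ∀ w, 0 < w → 0 ≤ E w) (hE' : ∀ w, 0 < w → HasDerivAt E (-(A 0 w * E w)) w) :
    CompletelyMonotone E := by
  refine completelyMonotone_of_class (S := ChainClass A E) (fun f hf => ?_) (fun f hf => ?_)
    ChainClass.base
  · induction hf with
    | chain k => exact hA k
    | base => exact hE
    | add _ _ h1 h2 => exact fun w hw => add_nonneg (h1 w hw) (h2 w hw)
    | mul _ _ h1 h2 => exact fun w hw => mul_nonneg (h1 w hw) (h2 w hw)
  · induction hf with
    | chain k => exact ⟨A (k + 1), .chain _, hA' k⟩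
    | base => exact ⟨A 0 * E, (ChainClass.chain 0).mul .base, hE'⟩
    | add _ _ h1 h2 =>
      obtain ⟨f', hf', df⟩ := h1
      obtain ⟨g', hg', dg⟩ := h2
      refine ⟨f' + g', hf'.add hg', fun w hw => ((df w hw).add (dg w hw)).congr_deriv ?_⟩
      simp only [Pi.add_apply]; ring
    | @mul f g h3 h4 h1 h2 =>
      obtain ⟨f', hf', df⟩ := h1
      obtain ⟨g', hg', dg⟩ := h2
      refine ⟨f' * g + f * g', (hf'.mul h4).add (h3.mul hg'),
        fun w hw => ((df w hw).mul (dg w hw)).congr_deriv ?_⟩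
      simp only [Pi.add_apply, Pi.mul_apply]; ring

/-- The sequence of signed derivatives of the Stieltjes-type transform `∫ (b(s)+w)⁻¹ dν(s)`. -/
noncomputable def stieltjesChain (ν : Measure ℝ) (b : ℝ → ℝ) (k : ℕ) (w : ℝ) : ℝ :=
  k.factorial * ∫ s in Ioi (0:ℝ), ((b s + w) ^ (k + 1))⁻¹ ∂ν

lemma aestronglyMeasurable_inv_pow (ν : Measure ℝ) {b : ℝ → ℝ} (hbm : Measurable b) (k : ℕ) (w : ℝ) :
    AEStronglyMeasurable (fun s => ((b s + w) ^ (k + 1))⁻¹) (ν.restrict (Ioi 0)) := by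
  exact (((hbm.add_const w).pow_const _).inv).aestronglyMeasurable

lemma integrableOn_inv_pow (ν : Measure ℝ) [IsFiniteMeasure ν] {b : ℝ → ℝ}
    (hbm : Measurable b) (hb : ∀ s, 0 < s → 0 ≤ b s) (k : ℕ) {w : ℝ}
    (hw : 0 < w) : IntegrableOn (fun s => ((b s + w) ^ (k + 1))⁻¹) (Ioi 0) ν := by
  refine Integrable.mono' (integrable_const ((w ^ (k + 1))⁻¹)) (aestronglyMeasurable_inv_pow ν hbm k w)
    ((ae_restrict_iff' measurableSet_Ioi).2 (ae_of_all _ fun s hs => ?_))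
  have := hb s hs
  rw [Real.norm_eq_abs, abs_of_nonneg (by positivity)]
  gcongr
  linarith

lemma stieltjesChain_nonneg (ν : Measure ℝ) {b : ℝ → ℝ} (hb : ∀ s, 0 < s → 0 ≤ b s)
    (k : ℕ) {w : ℝ} (hw : 0 < w) :
    0 ≤ stieltjesChain ν b k w := by
  refine mul_nonneg (by positivity) (setIntegral_nonneg measurableSet_Ioi fun s hs => ?_)
  have := hb s hs
  positivity

lemma hasDerivAt_stieltjesChain (ν : Measure ℝ) [IsFiniteMeasure ν] {b : ℝ → ℝ}
    (hbm : Measurable b) (hb : ∀ s, 0 < s → 0 ≤ b s) (k : ℕ) {w : ℝ}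
    (hw : 0 < w) : HasDerivAt (stieltjesChain ν b k) (-stieltjesChain ν b (k + 1) w) w := by
  have hd : ∀ s x : ℝ, 0 < s → 0 < x → HasDerivAt (fun x => ((b s + x) ^ (k + 1))⁻¹)
      (-((k + 1 : ℝ) * ((b s + x) ^ (k + 2))⁻¹)) x := by
    intro s x hs hx
    have hp : 0 < b s + x := by have := hb s hs; linarith
    have h2 : HasDerivAt (fun x => b s + x) 1 x := (hasDerivAt_id x).const_add (b s)
    have h3 := (h2.pow (k + 1)).inv (pow_pos hp _).ne'
    refine h3.congr_deriv ?_
    simp only [Pi.pow_apply, add_tsub_cancel_right, mul_one]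
    push_cast
    field_simp
    ring
  have key := hasDerivAt_integral_of_dominated_loc_of_deriv_le (μ := ν.restrict (Ioi 0))
    (F := fun x s => ((b s + x) ^ (k + 1))⁻¹)
    (F' := fun x s => -((k + 1 : ℝ) * ((b s + x) ^ (k + 2))⁻¹)) (x₀ := w)
    (bound := fun _ => (k + 1 : ℝ) * ((w / 2) ^ (k + 2))⁻¹) (Ioi_mem_nhds (half_lt_self hw))
    (Eventually.of_forall fun x => aestronglyMeasurable_inv_pow ν hbm k x)
    (integrableOn_inv_pow ν hbm hb k hw)
    (((aestronglyMeasurable_inv_pow ν hbm (k + 1) w).const_mul _).neg) ?_ (integrable_const _) ?_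
  · refine (key.2.const_mul (k.factorial : ℝ)).congr_deriv ?_
    unfold stieltjesChain
    rw [integral_neg, integral_const_mul, Nat.factorial_succ]
    push_cast
    ring
  · refine (ae_restrict_iff' measurableSet_Ioi).2 (ae_of_all _ fun s hs x hx => ?_)
    have := hb s hs
    have hx' : w / 2 < x := hx
    have hx0 : 0 < x := by linarith
    rw [norm_neg, Real.norm_eq_abs, abs_of_nonneg (by positivity)]
    gcongr
    linarith
  · refine (ae_restrict_iff' measurableSet_Ioi).2 (ae_of_all _ fun s hs x hx => ?_)
    have hx' : w / 2 < x := hx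
    exact hd s x hs (by linarith)

/-- A function whose logarithmic derivative is a Stieltjes transform is hyperbolically completely
monotone. -/
lemma HCM_of_stieltjes (ν : Measure ℝ) [IsFiniteMeasure ν] {a : ℝ} {Λ : ℝ → ℝ}
    (hΛ : ∀ t, HasDerivAt Λ (∫ s in Ioi (0:ℝ), Real.exp t / (s + Real.exp t) ∂ν) t) {H : ℝ → ℝ}
    (hH : ∀ x, 0 < x → H x = x ^ a * Real.exp (-Λ (Real.log x))) : HCM H := by
  intro u hu
  set b : ℝ → ℝ := fun s => s / u + u / s with hbd
  have hbm : Measurable b := by fun_prop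
  have hb : ∀ s, 0 < s → 0 ≤ b s := fun s hs => by simp only [hbd]; positivity
  set Ψ := stieltjesChain ν b 0 with hΨ
  have hΨd : ∀ w, 0 < w → HasDerivAt Ψ (-stieltjesChain ν b 1 w) w := fun w hw =>
    hasDerivAt_stieltjesChain ν hbm hb 0 hw
  have hΨc : ContinuousOn Ψ (Ioi 0) := fun w hw => (hΨd w hw).continuousAt.continuousWithinAt
  set ψ : ℝ → ℝ := fun w => ∫ t in (2:ℝ)..w, Ψ t with hψ
  have hψd : ∀ w, 0 < w → HasDerivAt ψ (Ψ w) w := fun w hw => by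
    have hsub : uIcc 2 w ⊆ Ioi 0 := fun x hx => by
      have := hx.1
      exact lt_of_lt_of_le (lt_min two_pos hw) this
    exact intervalIntegral.integral_hasDerivAt_right (hΨc.mono hsub).intervalIntegrable
      (hΨc.stronglyMeasurableAtFilter isOpen_Ioi w hw) (hΨd w hw).continuousAt
  set E : ℝ → ℝ := fun w => u ^ (2 * a) * Real.exp (-(2 * Λ (Real.log u))) * Real.exp (-ψ w) with hE
  refine ⟨E, completelyMonotone_of_deriv_eq_mul (A := stieltjesChain ν b)
    (fun k w hw => stieltjesChain_nonneg ν hb k hw)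
    (fun k w hw => hasDerivAt_stieltjesChain ν hbm hb k hw) (fun w _ => ?_) (fun w hw => ?_),
    fun v hv => ?_⟩
  · have := Real.rpow_nonneg hu.le (2 * a)
    simp only [hE]; positivity
  · refine (((hψd w hw).neg.exp).const_mul (u ^ (2 * a) * Real.exp (-(2 * Λ (Real.log u))))).congr_deriv
      ?_
    simp only [hE, hΨ, Pi.neg_apply]; ring
  · set k : ℝ → ℝ := fun t => Λ (Real.log u + t) + Λ (Real.log u - t) -
      ψ (Real.exp t + Real.exp (-t)) with hk
    have hkd : ∀ t, HasDerivAt k 0 t := fun t => by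
      have d1 : HasDerivAt (fun t => Λ (Real.log u + t)) _ t :=
        HasDerivAt.comp_const_add (Real.log u) t (hΛ (Real.log u + t))
      have d2 : HasDerivAt (fun t => Λ (Real.log u - t)) _ t :=
        HasDerivAt.comp_const_sub (Real.log u) t (hΛ (Real.log u - t))
      have d3 : HasDerivAt (fun t : ℝ => Real.exp t + Real.exp (-t)) (Real.exp t - Real.exp (-t)) t := by
        exact ((Real.hasDerivAt_exp t).add (hasDerivAt_neg t).exp).congr_deriv (by ring)
      have hw : 0 < Real.exp t + Real.exp (-t) := by positivity
      have d4 := HasDerivAt.comp t (hψd _ hw) d3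
      refine ((d1.add d2).sub d4).congr_deriv ?_
      have hint : ∀ c : ℝ, 0 < c → IntegrableOn (fun s => c / (s + c)) (Ioi 0) ν := fun c hc => by
        refine Integrable.mono' (integrable_const 1)
          (measurable_const.div (measurable_id.add_const c)).aestronglyMeasurable
          ((ae_restrict_iff' measurableSet_Ioi).2 (ae_of_all _ fun s hs => ?_))
        have hs' : 0 < s := hs
        rw [Real.norm_eq_abs, abs_of_nonneg (by positivity), div_le_one (by positivity)]
        linarith
      rw [← sub_eq_add_neg, ← integral_sub (hint _ (Real.exp_pos _)) (hint _ (Real.exp_pos _)), hΨ,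
        stieltjesChain, Nat.factorial_zero, Nat.cast_one, one_mul, mul_comm, ← integral_const_mul,
        sub_eq_zero]
      refine setIntegral_congr_fun measurableSet_Ioi fun s hs => ?_
      have hs' : 0 < s := hs
      simp only [hbd, zero_add, pow_one]
      rw [sub_eq_add_neg (Real.log u) t, Real.exp_add, Real.exp_add, Real.exp_log hu, Real.exp_neg]
      have := Real.exp_pos t
      field_simp
      ring
    have hkc : k (Real.log v) = k 0 :=
      is_const_of_deriv_eq_zero (fun t => (hkd t).differentiableAt) (fun t => (hkd t).deriv) _ _
    simp only [hk, add_zero, sub_zero, Real.exp_zero, Real.exp_neg, Real.exp_log hv] at hkc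
    have hψ2 : ψ (1 + 1⁻¹) = 0 := by simp only [hψ]; norm_num
    rw [hψ2] at hkc
    rw [hH _ (mul_pos hu hv), hH _ (div_pos hu hv), Real.log_mul hu.ne' hv.ne',
      Real.log_div hu.ne' hv.ne']
    have hpw : (u * v) ^ a * (u / v) ^ a = u ^ (2 * a) := by
      rw [← Real.mul_rpow (by positivity) (by positivity),
        show u * v * (u / v) = u ^ (2:ℝ) by rw [Real.rpow_two]; field_simp, ← Real.rpow_mul hu.le]
    simp only [hE]
    rw [← hpw, mul_mul_mul_comm, mul_assoc ((u * v) ^ a * _), ← Real.exp_add, ← Real.exp_add, one_div]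
    congr 2
    linarith

/-- The real part of the derivative at the centre of a disc as a boundary integral of the imaginary
part. -/
lemma integral_im_mul_sin {f : ℂ → ℂ} {R : ℝ} (hR : 0 < R)
    (hf : DiffContOnCl ℂ f (Metric.ball 0 R)) :
    ∫ η in (0:ℝ)..2 * Real.pi, (f (circleMap 0 R η)).im * Real.sin η = Real.pi * R * (deriv f 0).re := by
  have hc : Continuous fun η : ℝ => f (circleMap 0 R η) := by
    refine hf.continuousOn_ball.comp_continuous (continuous_circleMap 0 R) fun η => ?_
    exact Metric.sphere_subset_closedBall (circleMap_mem_sphere 0 hR.le η)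
  have hRc : (R : ℂ) ≠ 0 := by exact_mod_cast hR.ne'
  have h1 : ∫ η in (0:ℝ)..2 * Real.pi, exp (-(η * I)) * f (circleMap 0 R η)
      = 2 * Real.pi * R * deriv f 0 := by
    have h := hf.deriv_eq_smul_circleIntegral hR
    have e : (∮ z in C(0, R), (1 / (z - 0) ^ 2) • f z)
        = I / R * ∫ η in (0:ℝ)..2 * Real.pi, exp (-(η * I)) * f (circleMap 0 R η) := by
      rw [circleIntegral, ← intervalIntegral.integral_const_mul]
      refine intervalIntegral.integral_congr fun η _ => ?_
      simp only [deriv_circleMap, circleMap, zero_add, sub_zero, smul_eq_mul, exp_neg]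
      have := exp_ne_zero (η * I)
      field_simp
    rw [e, smul_eq_mul, div_mul_eq_mul_div, div_eq_iff hRc] at h
    refine mul_left_cancel₀ I_ne_zero ?_
    rw [h]
    ring
  have h2 : ∫ η in (0:ℝ)..2 * Real.pi, exp (η * I) * f (circleMap 0 R η) = 0 := by
    have h := hf.circleIntegral_eq_zero hR.le
    have e : (∮ z in C(0, R), f z)
        = I * R * ∫ η in (0:ℝ)..2 * Real.pi, exp (η * I) * f (circleMap 0 R η) := by
      rw [circleIntegral, ← intervalIntegral.integral_const_mul]
      refine intervalIntegral.integral_congr fun η _ => ?_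
      simp only [deriv_circleMap, circleMap, zero_add, smul_eq_mul]
      ring
    rw [e] at h
    simpa [hR.ne'] using h
  have hc1 : Continuous fun η : ℝ => exp (-(η * I)) * f (circleMap 0 R η) :=
    (by fun_prop : Continuous fun η : ℝ => exp (-(η * I))).mul hc
  have hc2 : Continuous fun η : ℝ => exp (η * I) * f (circleMap 0 R η) :=
    (by fun_prop : Continuous fun η : ℝ => exp (η * I)).mul hc
  have h3 : ∫ η in (0:ℝ)..2 * Real.pi, (exp (-(η * I)) * f (circleMap 0 R η)
      - exp (η * I) * f (circleMap 0 R η)) = 2 * Real.pi * R * deriv f 0 := by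
    rw [intervalIntegral.integral_sub (hc1.intervalIntegrable _ _)
      (hc2.intervalIntegrable _ _), h1, h2, sub_zero]
  have h4 := congrArg re h3
  have hc3 : Continuous fun η : ℝ => exp (-(η * I)) * f (circleMap 0 R η)
      - exp (η * I) * f (circleMap 0 R η) := hc1.sub hc2
  rw [← reCLM_apply, ← ContinuousLinearMap.intervalIntegral_comp_comm _
    (hc3.intervalIntegrable _ _)] at h4
  have h5 : (2 * Real.pi * R * deriv f 0 : ℂ).re = 2 * (Real.pi * R * (deriv f 0).re) := by
    rw [show (2 * Real.pi * R * deriv f 0 : ℂ) = ((2 * Real.pi * R : ℝ) : ℂ) * deriv f 0 by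
      push_cast; ring, re_ofReal_mul]
    ring
  rw [h5] at h4
  have h6 : ∀ η : ℝ, reCLM (exp (-(η * I)) * f (circleMap 0 R η) - exp (η * I) * f (circleMap 0 R η))
      = 2 * ((f (circleMap 0 R η)).im * Real.sin η) := fun η => by
    rw [reCLM_apply, ← sub_mul, ← neg_mul, ← ofReal_neg, exp_mul_I, exp_mul_I, ← ofReal_cos,
      ← ofReal_sin, ← ofReal_cos, ← ofReal_sin, Real.cos_neg, Real.sin_neg]
    simp [-ofReal_cos, -ofReal_sin]
    ring
  simp only [h6, intervalIntegral.integral_const_mul] at h4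
  linarith

/-- The Cayley transform of the unit disc onto the right half plane. -/
noncomputable def cayleyMap (ξ : ℂ) : ℂ := (1 + ξ) / (1 - ξ)

lemma cayleyMap_re_pos {ξ : ℂ} (hξ : ‖ξ‖ < 1) : 0 < (cayleyMap ξ).re := by
  have h1 : 1 - ξ ≠ 0 := fun h => by
    rw [sub_eq_zero] at h
    rw [← h, norm_one] at hξ
    exact lt_irrefl _ hξ
  have h2 : 0 < normSq (1 - ξ) := normSq_pos.2 h1
  rw [cayleyMap, div_re, ← add_div]
  refine div_pos ?_ h2
  have h3 : normSq ξ < 1 := by rw [normSq_eq_norm_sq]; nlinarith [norm_nonneg ξ]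
  rw [normSq_apply] at h3
  simp only [add_re, one_re, sub_re, add_im, one_im, sub_im]
  nlinarith

lemma differentiableAt_cayleyMap {ξ : ℂ} (h : ξ ≠ 1) : DifferentiableAt ℂ cayleyMap ξ := by
  unfold cayleyMap
  have : 1 - ξ ≠ 0 := sub_ne_zero.2 h.symm
  fun_prop (disch := exact this)

lemma hasDerivAt_cayleyMap_zero : HasDerivAt cayleyMap 2 0 := by
  have h := ((hasDerivAt_id (0:ℂ)).const_add 1).div ((hasDerivAt_id (0:ℂ)).const_sub 1) (by simp)
  refine h.congr_deriv ?_
  norm_num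

lemma cayleyMap_circle (η : ℝ) :
    cayleyMap (circleMap 0 1 η) = ((Real.sin η / (1 - Real.cos η) : ℝ) : ℂ) * I := by
  by_cases h : Real.cos η = 1
  · have hs : Real.sin η = 0 := by
      have := Real.sin_sq_add_cos_sq η
      rw [h] at this
      nlinarith
    have : circleMap 0 1 η = 1 := by
      rw [circleMap, exp_mul_I, ← ofReal_cos, ← ofReal_sin, h, hs]; simp
    simp [cayleyMap, this, h]
  · have h1 : (1:ℝ) - Real.cos η ≠ 0 := fun h2 => h (by linarith)
    have h1c : (1:ℂ) - Real.cos η ≠ 0 := by exact_mod_cast h1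
    have h3 : circleMap 0 1 η = Real.cos η + Real.sin η * I := by
      rw [circleMap, exp_mul_I, ← ofReal_cos, ← ofReal_sin]; simp
    have h4 : 1 - circleMap 0 1 η ≠ 0 := fun h5 => by
      have := congrArg re h5
      rw [h3] at this
      simp [-ofReal_cos, -ofReal_sin] at this
      exact h1 this
    rw [cayleyMap, div_eq_iff h4, h3]
    have h6 : ((Real.sin η : ℝ):ℂ) ^ 2 + (Real.cos η : ℝ) ^ 2 = 1 := by
      exact_mod_cast Real.sin_sq_add_cos_sq η
    push_cast [-ofReal_cos, -ofReal_sin]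
    field_simp
    linear_combination (-h6 + (Real.sin η : ℂ) ^ 2 * I_sq)

/-- The function `α - θ_α`, which is the boundary argument of `pickFun`, divided by `π`. -/
noncomputable def argDensity (α s : ℝ) : ℝ := α - thetaFun α s

lemma arg_pickFun_add_pi {α : ℝ} (h0 : 1 / 2 ≤ α) (h1 : α < 1) (t : ℝ) :
    pickFun α (t + Real.pi * I) ∈ slitPlane ∧
      (pickFun α (t + Real.pi * I)).arg = Real.pi * argDensity α (Real.exp t) := by
  have hp := Real.pi_pos
  have hα : 0 < α := by linarith
  have ha := half_le_thetaFun h0 h1 (Real.exp_pos t)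
  have hb := thetaFun_le h0 h1 (Real.exp_pos t)
  have hr : 0 < Real.exp (α * t) * Real.exp (-decayRate α * Real.exp t) *
      ‖GalphaPlus α (Real.exp t)‖ := by
    have := norm_pos_iff.2 (GalphaPlus_ne_zero hα h1 (Real.exp_pos t))
    positivity
  rw [argDensity, pickFun_add_pi hα h1]
  have e : (((Real.exp (α * t) * Real.exp (-decayRate α * Real.exp t) *
      ‖GalphaPlus α (Real.exp t)‖ : ℝ) : ℂ)
        * exp ((Real.pi * (α - thetaFun α (Real.exp t)) : ℝ) * I)).arg
      = Real.pi * (α - thetaFun α (Real.exp t)) := by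
    rw [exp_mul_I, arg_mul_cos_add_sin_mul_I hr]
    constructor <;> nlinarith
  refine ⟨mem_slitPlane_iff_arg.2 ⟨?_, mul_ne_zero (by exact_mod_cast hr.ne') (exp_ne_zero _)⟩, e⟩
  rw [e]
  nlinarith

/-- The logarithm of `pickFun` on the strip `|Im ζ| < π`, transported to the unit disc. -/
noncomputable def discLog (α t : ℝ) (ξ : ℂ) : ℂ := log (pickFun α (t + 2 * log (cayleyMap ξ)))

lemma abs_im_strip_lt {t : ℝ} {ξ : ℂ} (hξ : ‖ξ‖ < 1) :
    |((t:ℂ) + 2 * log (cayleyMap ξ)).im| < Real.pi := by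
  have h := abs_arg_lt_pi_div_two_iff.2 (Or.inl (cayleyMap_re_pos hξ))
  have e : ((t:ℂ) + 2 * log (cayleyMap ξ)).im = 2 * (cayleyMap ξ).arg := by
    rw [add_im, ofReal_im, zero_add, ← log_im]
    simp
  rw [e, abs_mul, abs_two]
  linarith

lemma hasDerivAt_discLog {α : ℝ} (h0 : 1 / 2 ≤ α) (h1 : α < 1) (t : ℝ) {ξ c : ℂ} (hξ : ‖ξ‖ < 1)
    (hc : HasDerivAt cayleyMap c ξ) :
    HasDerivAt (discLog α t) (deriv (pickFun α) (t + 2 * log (cayleyMap ξ)) *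
      (2 * (c / cayleyMap ξ)) / pickFun α (t + 2 * log (cayleyMap ξ))) ξ := by
  have hs : cayleyMap ξ ∈ slitPlane := Or.inl (cayleyMap_re_pos hξ)
  have hl := ((hc.clog hs).const_mul 2).const_add (t:ℂ)
  have hQ := (differentiable_pickFun (α := α) (by linarith) h1 (t + 2 * log (cayleyMap ξ))).hasDerivAt
  have hcomp : HasDerivAt (fun ξ => pickFun α (t + 2 * log (cayleyMap ξ))) _ ξ :=
    HasDerivAt.comp (h₂ := pickFun α) ξ hQ hl
  exact hcomp.clog (pickFun_mem_slitPlane h0 h1 (abs_im_strip_lt hξ))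

lemma ne_one_of_norm_lt {ξ : ℂ} (hξ : ‖ξ‖ < 1) : ξ ≠ 1 := fun h => by
  rw [h, norm_one] at hξ; exact lt_irrefl _ hξ

lemma differentiableOn_discLog {α : ℝ} (h0 : 1 / 2 ≤ α) (h1 : α < 1) (t : ℝ) :
    DifferentiableOn ℂ (discLog α t) (Metric.ball 0 1) := fun ξ hξ => by
  rw [mem_ball_zero_iff] at hξ
  exact (hasDerivAt_discLog h0 h1 t hξ
    (differentiableAt_cayleyMap (ne_one_of_norm_lt hξ)).hasDerivAt).differentiableAt.differentiableWithinAt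

lemma deriv_discLog_re {α : ℝ} (h0 : 1 / 2 ≤ α) (h1 : α < 1) (t : ℝ) :
    (deriv (discLog α t) 0).re = 4 * ((deriv (pickFun α) t).re / (pickFun α t).re) := by
  have h := (hasDerivAt_discLog h0 h1 t (by simp) hasDerivAt_cayleyMap_zero).deriv
  have e : cayleyMap 0 = 1 := by simp [cayleyMap]
  rw [e, log_one, mul_zero, add_zero, div_one] at h
  have h2 : pickFun α t = ((pickFun α t).re : ℝ) := by
    apply Complex.ext <;> simp [pickFun_ofReal_im]
  rw [h, h2, div_ofReal_re, show (2 * 2 : ℂ) = ((4:ℝ):ℂ) by norm_num, re_mul_ofReal, ← h2]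
  ring

lemma argDensity_nonneg {α s : ℝ} (h0 : 1 / 2 ≤ α) (h1 : α < 1) (hs : 0 < s) :
    0 ≤ argDensity α s := sub_nonneg.2 (thetaFun_le h0 h1 hs)

/-- The radial limits of the imaginary part of `discLog`. -/
lemma tendsto_discLog_im {α : ℝ} (h0 : 1 / 2 ≤ α) (h1 : α < 1) (t : ℝ) {η : ℝ}
    (hη : Real.sin η ≠ 0) :
    Tendsto (fun R : ℝ => (discLog α t (circleMap 0 R η)).im * Real.sin η) (𝓝[<] 1)
      (𝓝 (Real.pi * argDensity α (Real.exp t * ((1 + Real.cos η) / (1 - Real.cos η))) *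
        |Real.sin η|)) := by
  have hsc := Real.sin_sq_add_cos_sq η
  have hs2 : 0 < Real.sin η ^ 2 := by positivity
  have hcos : 0 < 1 - Real.cos η := by nlinarith
  set c := Real.sin η / (1 - Real.cos η) with hc
  have hc0 : c ≠ 0 := div_ne_zero hη hcos.ne'
  have hc2 : c ^ 2 = (1 + Real.cos η) / (1 - Real.cos η) := by
    rw [hc, div_pow, div_eq_div_iff (by positivity) hcos.ne']
    linear_combination (1 - Real.cos η) * hsc
  have hslit : (c : ℂ) * I ∈ slitPlane := Or.inr (by simpa using hc0)
  have hcay := cayleyMap_circle η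
  rw [← hc] at hcay
  have hne : circleMap 0 1 η ≠ 1 := fun h => by
    have := congrArg re h
    rw [circleMap, exp_mul_I, ← ofReal_cos, ← ofReal_sin] at this
    simp [-ofReal_cos, -ofReal_sin] at this
    linarith
  have hcm : Continuous fun R : ℝ => circleMap 0 R η := by unfold circleMap; fun_prop
  have l1 : Tendsto (fun R : ℝ => (t:ℂ) + 2 * log (cayleyMap (circleMap 0 R η))) (𝓝 1)
      (𝓝 (t + 2 * log (c * I))) := by
    have a1 : Tendsto (fun R : ℝ => cayleyMap (circleMap 0 R η)) (𝓝 1) (𝓝 (c * I)) := by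
      rw [← hcay]
      exact ((differentiableAt_cayleyMap hne).continuousAt).tendsto.comp hcm.continuousAt
    exact ((a1.clog hslit).const_mul 2).const_add _
  have l2 := ((differentiable_pickFun (α := α) (by linarith) h1).continuous.tendsto _).comp l1
  have hexp : Real.exp (t + 2 * Real.log |c|) = Real.exp t * c ^ 2 := by
    rw [Real.exp_add, mul_comm 2, ← Real.rpow_def_of_pos (abs_pos.2 hc0), Real.rpow_two, sq_abs]
  obtain ⟨hA, hB⟩ := arg_pickFun_add_pi h0 h1 (t + 2 * Real.log |c|)
  rw [hexp, hc2] at hB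
  have key : pickFun α (t + 2 * log (c * I)) ∈ slitPlane ∧
      (pickFun α (t + 2 * log (c * I))).arg * Real.sin η = Real.pi * argDensity α (Real.exp t *
        ((1 + Real.cos η) / (1 - Real.cos η))) * |Real.sin η| := by
    rcases lt_or_gt_of_ne hη with hneg | hpos
    · have hcn : c < 0 := div_neg_of_neg_of_pos hneg hcos
      have e : (t:ℂ) + 2 * log (c * I) =
          starRingEnd ℂ (((t + 2 * Real.log |c| : ℝ) : ℂ) + Real.pi * I) := by
        have : log (c * I) = ((Real.log |c| : ℝ) : ℂ) + ((-(Real.pi / 2) : ℝ) : ℂ) * I := by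
          rw [show (c:ℂ) * I = ((-c : ℝ) : ℂ) * (-I) by push_cast; ring,
            log_ofReal_mul (by linarith) (by simp), log_neg_I, abs_of_neg hcn]
          push_cast; ring
        rw [this]
        simp only [map_add, map_mul, conj_ofReal, conj_I]
        push_cast; ring
      rw [e, pickFun_conj]
      have hne' := (mem_slitPlane_iff_arg.1 hA).1
      refine ⟨?_, ?_⟩
      · rw [mem_slitPlane_iff] at hA ⊢
        simpa using hA
      · rw [arg_conj, if_neg hne', hB, abs_of_neg hneg]; ring
    · have hcp : 0 < c := div_pos hpos hcos
      have e : (t:ℂ) + 2 * log (c * I) = ((t + 2 * Real.log |c| : ℝ) : ℂ) + Real.pi * I := by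
        rw [log_ofReal_mul hcp I_ne_zero, log_I, abs_of_pos hcp]
        push_cast; ring
      rw [e, hB, abs_of_pos hpos]
      exact ⟨hA, rfl⟩
  have l3 := (((continuousAt_arg key.1).tendsto.comp l2).mul_const (Real.sin η)).mono_left
    (nhdsWithin_le_nhds (s := Iio 1))
  rw [key.2] at l3
  refine l3.congr fun R => ?_
  simp [discLog, log_im]

lemma integral_argDensity {α : ℝ} (h0 : 1 / 2 ≤ α) (h1 : α < 1) (t : ℝ) :
    ∫ η in (0:ℝ)..2 * Real.pi, argDensity α (Real.exp t * ((1 + Real.cos η) / (1 - Real.cos η))) *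
      |Real.sin η| = 4 * ((deriv (pickFun α) t).re / (pickFun α t).re) := by
  have hp := Real.pi_pos
  have hd := differentiableOn_discLog h0 h1 t
  have hR : ∀ᶠ R : ℝ in 𝓝[<] 1, 0 < R ∧ R < 1 := Ioo_mem_nhdsLT one_pos
  have hdc : ∀ R : ℝ, R < 1 → DiffContOnCl ℂ (discLog α t) (Metric.ball 0 R) := fun R h =>
    hd.diffContOnCl_ball (Metric.closedBall_subset_ball h)
  have hsin : ∀ᵐ η : ℝ, Real.sin η ≠ 0 := by
    have hcount : {η : ℝ | Real.sin η = 0}.Countable := by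
      have : {η : ℝ | Real.sin η = 0} ⊆ range fun n : ℤ => (n : ℝ) * Real.pi := fun η hη => by
        obtain ⟨n, hn⟩ := Real.sin_eq_zero_iff.1 hη
        exact ⟨n, hn⟩
      exact (countable_range _).mono this
    have := hcount.ae_notMem volume
    filter_upwards [this] with η h using h
  have lim1 := intervalIntegral.tendsto_integral_filter_of_dominated_convergence (μ := volume)
    (a := 0) (b := 2 * Real.pi) (l := 𝓝[<] (1:ℝ))
    (F := fun R η => (discLog α t (circleMap 0 R η)).im * Real.sin η)
    (f := fun η => Real.pi * argDensity α (Real.exp t * ((1 + Real.cos η) / (1 - Real.cos η))) *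
        |Real.sin η|) (fun _ => Real.pi) ?_ ?_ intervalIntegrable_const ?_
  · have lim2 : Tendsto (fun R : ℝ => Real.pi * R * (deriv (discLog α t) 0).re) (𝓝[<] 1)
        (𝓝 (Real.pi * 1 * (deriv (discLog α t) 0).re)) :=
      (Continuous.tendsto (by fun_prop) 1).mono_left nhdsWithin_le_nhds
    have hu := tendsto_nhds_unique lim1 (lim2.congr' (by
      filter_upwards [hR] with R h using (integral_im_mul_sin h.1 (hdc R h.2)).symm))
    simp only [mul_assoc, intervalIntegral.integral_const_mul, one_mul] at hu
    rw [← deriv_discLog_re h0 h1]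
    simpa [hp.ne'] using hu
  · filter_upwards [hR] with R h
    have hc : Continuous fun η : ℝ => discLog α t (circleMap 0 R η) :=
      (hdc R h.2).continuousOn_ball.comp_continuous (continuous_circleMap 0 R) fun η =>
        Metric.sphere_subset_closedBall (circleMap_mem_sphere 0 h.1.le η)
    exact ((continuous_im.comp hc).mul Real.continuous_sin).aestronglyMeasurable
  · filter_upwards with R
    filter_upwards with η _
    rw [norm_mul, discLog, log_im, Real.norm_eq_abs, Real.norm_eq_abs]
    exact (mul_le_mul (abs_arg_le_pi _) (Real.abs_sin_le_one η) (abs_nonneg _) hp.le).trans_eq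
      (mul_one _)
  · filter_upwards [hsin] with η hη _ using tendsto_discLog_im h0 h1 t hη

lemma integrableOn_Icc_of_continuousOn_Ioo {g : ℝ → ℝ} {a b C : ℝ} (hg : ContinuousOn g (Ioo a b))
    (hC : ∀ u ∈ Ioo a b, |g u| ≤ C) : IntegrableOn g (Icc a b) := by
  rw [integrableOn_Icc_iff_integrableOn_Ioo]
  exact Integrable.mono' (integrable_const C) (hg.aestronglyMeasurable measurableSet_Ioo)
    ((ae_restrict_iff' measurableSet_Ioo).2 (ae_of_all _ hC))

lemma integral_comp_cos_mul_abs_sin {g : ℝ → ℝ} {C : ℝ} (hg : ContinuousOn g (Ioo (-1) 1))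
    (hC : ∀ u ∈ Ioo (-1:ℝ) 1, |g u| ≤ C) :
    ∫ η in (0:ℝ)..2 * Real.pi, g (Real.cos η) * |Real.sin η| = 2 * ∫ u in (-1:ℝ)..1, g u := by
  have hp := Real.pi_pos
  have hC0 : 0 ≤ C := (abs_nonneg _).trans (hC 0 (by norm_num))
  have hmaps : MapsTo Real.cos (Ioo 0 Real.pi) (Ioo (-1) 1) := fun η hη => by
    have hs := Real.sin_pos_of_pos_of_lt_pi hη.1 hη.2
    have := Real.sin_sq_add_cos_sq η
    have hs2 : 0 < Real.sin η ^ 2 := by positivity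
    constructor <;> nlinarith
  have hgc : ContinuousOn (fun η => g (Real.cos η)) (Ioo 0 Real.pi) :=
    hg.comp Real.continuous_cos.continuousOn hmaps
  have hint : ∀ f : ℝ → ℝ, Continuous f → (∀ η, |f η| ≤ 1) →
      IntegrableOn (fun η => g (Real.cos η) * f η) (Icc 0 Real.pi) := fun f hf hf1 => by
    refine integrableOn_Icc_of_continuousOn_Ioo (C := C) (hgc.mul hf.continuousOn) fun η hη => ?_
    rw [abs_mul]
    exact (mul_le_mul (hC _ (hmaps hη)) (hf1 η) (abs_nonneg _) hC0).trans_eq (mul_one C)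
  have hhalf : ∫ η in (0:ℝ)..Real.pi, g (Real.cos η) * |Real.sin η| = ∫ u in (-1:ℝ)..1, g u := by
    have h := intervalIntegral.integral_comp_mul_deriv''' (a := 0) (b := Real.pi) (f := Real.cos)
      (f' := fun η => -Real.sin η) (g := g) Real.continuous_cos.continuousOn
      (fun η _ => (Real.hasDerivAt_cos η).hasDerivWithinAt) ?_ ?_ ?_
    · rw [Real.cos_zero, Real.cos_pi, intervalIntegral.integral_symm (-1) 1] at h
      rw [← neg_inj, ← h, ← intervalIntegral.integral_neg]
      refine intervalIntegral.integral_congr fun η hη => ?_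
      rw [uIcc_of_le hp.le] at hη
      simp only [Function.comp_apply]
      rw [abs_of_nonneg (Real.sin_nonneg_of_mem_Icc hη)]
      ring
    · rw [min_eq_left hp.le, max_eq_right hp.le]
      exact hg.mono hmaps.image_subset
    · refine (integrableOn_Icc_of_continuousOn_Ioo hg hC).mono_set ?_
      rintro _ ⟨η, -, rfl⟩
      exact Real.cos_mem_Icc η
    · rw [uIcc_of_le hp.le]
      exact hint _ Real.continuous_sin.neg fun η => by rw [abs_neg]; exact Real.abs_sin_le_one η
  have hrefl : ∀ η : ℝ, g (Real.cos (2 * Real.pi - η)) * |Real.sin (2 * Real.pi - η)| =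
      g (Real.cos η) * |Real.sin η| := fun η => by
    rw [Real.cos_two_pi_sub, Real.sin_two_pi_sub, abs_neg]
  have hi1 : IntervalIntegrable (fun η => g (Real.cos η) * |Real.sin η|) volume 0 Real.pi := by
    rw [intervalIntegrable_iff_integrableOn_Icc_of_le hp.le]
    exact hint _ Real.continuous_sin.abs fun η => by rw [abs_abs]; exact Real.abs_sin_le_one η
  have hi2 : IntervalIntegrable (fun η => g (Real.cos η) * |Real.sin η|) volume Real.pi
      (2 * Real.pi) := by
    have h := (hi1.comp_sub_left (2 * Real.pi)).symm
    simp only [hrefl, sub_zero] at h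
    rwa [show 2 * Real.pi - Real.pi = Real.pi by ring] at h
  have hhalf2 : ∫ η in Real.pi..2 * Real.pi, g (Real.cos η) * |Real.sin η|
      = ∫ u in (-1:ℝ)..1, g u := by
    rw [← hhalf]
    have h := intervalIntegral.integral_comp_sub_left (a := 0) (b := Real.pi)
      (fun η => g (Real.cos η) * |Real.sin η|) (2 * Real.pi)
    simp only [hrefl, sub_zero] at h
    rw [h]
    congr 1
    ring
  rw [← intervalIntegral.integral_add_adjacent_intervals hi1 hi2, hhalf, hhalf2]
  ring

/-- The Stieltjes function equal to `α - θ_α` on `(0,∞)` and to `0` on `(-∞,0]`. -/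
noncomputable def argStieltjes {α : ℝ} (h0 : 1 / 2 ≤ α) (h1 : α < 1) : StieltjesFunction ℝ where
  toFun s := if 0 < s then argDensity α s else 0
  mono' := fun s s' h => by
    dsimp only
    split_ifs with h2 h3 h3
    · exact sub_le_sub_left (antitoneOn_thetaFun h0 h1 h2 h3 h) α
    · exact absurd (h2.trans_le h) h3
    · exact argDensity_nonneg h0 h1 h3
    · exact le_rfl
  right_continuous' := fun s => by
    rcases lt_trichotomy s 0 with hs | rfl | hs
    · refine ContinuousAt.continuousWithinAt ?_
      refine continuousAt_const.congr (f := fun _ => (0:ℝ)) ?_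
      filter_upwards [Iio_mem_nhds hs] with x hx
      rw [if_neg (not_lt.2 (le_of_lt hx))]
    · rw [← continuousWithinAt_Ioi_iff_Ici, ContinuousWithinAt, if_neg (lt_irrefl _)]
      have h := (tendsto_thetaFun_zero (by linarith) h1).const_sub α
      rw [sub_self] at h
      refine h.congr' ?_
      filter_upwards [self_mem_nhdsWithin] with x hx
      rw [if_pos (mem_Ioi.1 hx), argDensity]
    · refine ContinuousAt.continuousWithinAt ?_
      have h : ContinuousAt (argDensity α) s := continuousAt_const.sub
        ((continuousOn_thetaFun (by linarith) h1).continuousAt (Ioi_mem_nhds hs))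
      refine h.congr ?_
      filter_upwards [Ioi_mem_nhds hs] with x hx
      rw [if_pos (mem_Ioi.1 hx)]

lemma argStieltjes_apply {α : ℝ} (h0 : 1 / 2 ≤ α) (h1 : α < 1) (s : ℝ) :
    argStieltjes h0 h1 s = if 0 < s then argDensity α s else 0 := rfl

lemma argDensity_le_one {α s : ℝ} (h0 : 1 / 2 ≤ α) (h1 : α < 1) (hs : 0 < s) :
    argDensity α s ≤ 1 := by
  have := half_le_thetaFun h0 h1 hs
  unfold argDensity
  linarith

instance {α : ℝ} (h0 : 1 / 2 ≤ α) (h1 : α < 1) : IsFiniteMeasure (argStieltjes h0 h1).measure := by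
  refine StieltjesFunction.isFiniteMeasure_of_forall_abs_le _ (C := 1) fun s => ?_
  rw [argStieltjes_apply]
  split_ifs with h
  · rw [abs_of_nonneg (argDensity_nonneg h0 h1 h)]
    exact argDensity_le_one h0 h1 h
  · simp

lemma argDensity_eq_measureReal {α s : ℝ} (h0 : 1 / 2 ≤ α) (h1 : α < 1) (hs : 0 < s) :
    argDensity α s = (argStieltjes h0 h1).measure.real (Ioc 0 s) := by
  rw [measureReal_def, StieltjesFunction.measure_Ioc, argStieltjes_apply, argStieltjes_apply,
    if_pos hs, if_neg (lt_irrefl _), sub_zero, ENNReal.toReal_ofReal (argDensity_nonneg h0 h1 hs)]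

/-- The Stieltjes transform of `ν` in terms of its distribution function. -/
lemma integral_measureReal_Ioc (ν : Measure ℝ) [IsFiniteMeasure ν] {x : ℝ} (hx : 0 < x) :
    ∫ u in (-1:ℝ)..1, ν.real (Ioc 0 (x * ((1 + u) / (1 - u)))) =
      2 * ∫ s in Ioi (0:ℝ), x / (s + x) ∂ν := by
  set S : Set (ℝ × ℝ) := {p | p.2 * (1 - p.1) ≤ x * (1 + p.1)} with hS
  have hSm : MeasurableSet S := (isClosed_le (by fun_prop) (by fun_prop)).measurableSet
  have hi : Integrable (Function.uncurry fun u s : ℝ => S.indicator (fun _ => (1:ℝ)) (u, s))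
      ((volume.restrict (Ioo (-1:ℝ) 1)).prod (ν.restrict (Ioi 0))) :=
    (integrable_const (1:ℝ)).indicator hSm
  have hsw := integral_integral_swap hi
  rw [intervalIntegral.integral_of_le (by norm_num), integral_Ioc_eq_integral_Ioo,
    ← integral_const_mul]
  have hL : ∀ u ∈ Ioo (-1:ℝ) 1, ν.real (Ioc 0 (x * ((1 + u) / (1 - u)))) =
      ∫ s in Ioi 0, S.indicator (fun _ => (1:ℝ)) (u, s) ∂ν := fun u hu => by
    have hu1 : 0 < 1 - u := by linarith [hu.2]
    have e : (fun s => S.indicator (fun _ => (1:ℝ)) (u, s)) =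
        (Iic (x * ((1 + u) / (1 - u)))).indicator fun _ => (1:ℝ) := by
      ext s
      have : (u, s) ∈ S ↔ s ∈ Iic (x * ((1 + u) / (1 - u))) := by
        rw [mem_Iic, ← mul_div_assoc, le_div_iff₀ hu1]
        rfl
      by_cases h : (u, s) ∈ S
      · rw [indicator_of_mem h, indicator_of_mem (this.1 h)]
      · rw [indicator_of_notMem h, indicator_of_notMem (fun h2 => h (this.2 h2))]
    rw [e, integral_indicator_const _ measurableSet_Iic, smul_eq_mul, mul_one,
      measureReal_restrict_apply measurableSet_Iic, inter_comm, Ioi_inter_Iic]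
  have hR : ∀ s ∈ Ioi (0:ℝ), 2 * (x / (s + x)) =
      ∫ u in Ioo (-1:ℝ) 1, S.indicator (fun _ => (1:ℝ)) (u, s) := fun s hs => by
    have hs' : 0 < s := hs
    have hsx : 0 < s + x := by linarith
    have e : (fun u => S.indicator (fun _ => (1:ℝ)) (u, s)) =
        (Ici ((s - x) / (s + x))).indicator fun _ => (1:ℝ) := by
      ext u
      have : (u, s) ∈ S ↔ u ∈ Ici ((s - x) / (s + x)) := by
        rw [mem_Ici, div_le_iff₀ hsx]
        constructor
        · intro h
          have h : s * (1 - u) ≤ x * (1 + u) := h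
          linarith
        · intro h
          have : s * (1 - u) ≤ x * (1 + u) := by linarith
          exact this
      by_cases h : (u, s) ∈ S
      · rw [indicator_of_mem h, indicator_of_mem (this.1 h)]
      · rw [indicator_of_notMem h, indicator_of_notMem (fun h2 => h (this.2 h2))]
    have h1 : -1 < (s - x) / (s + x) := by rw [lt_div_iff₀ hsx]; linarith
    have h2 : (s - x) / (s + x) < 1 := by rw [div_lt_iff₀ hsx]; linarith
    have e2 : Ici ((s - x) / (s + x)) ∩ Ioo (-1) 1 = Ico ((s - x) / (s + x)) 1 := by
      ext u
      simp only [mem_inter_iff, mem_Ici, mem_Ioo, mem_Ico]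
      constructor
      · rintro ⟨a, b, c⟩; exact ⟨a, c⟩
      · rintro ⟨a, c⟩; exact ⟨a, by linarith, c⟩
    rw [e, integral_indicator_const _ measurableSet_Ici, smul_eq_mul, mul_one,
      measureReal_restrict_apply measurableSet_Ici, e2, Real.volume_real_Ico_of_le h2.le]
    field_simp
    ring
  rw [setIntegral_congr_fun measurableSet_Ioo hL, setIntegral_congr_fun measurableSet_Ioi hR]
  exact hsw

/-- The logarithmic derivative of `pickFun` on the real line is a Stieltjes transform. -/
lemma logDeriv_pickFun_eq {α : ℝ} (h0 : 1 / 2 ≤ α) (h1 : α < 1) (t : ℝ) :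
    (deriv (pickFun α) t).re / (pickFun α t).re =
      ∫ s in Ioi (0:ℝ), Real.exp t / (s + Real.exp t) ∂(argStieltjes h0 h1).measure := by
  have hx := Real.exp_pos t
  have hpos : ∀ u ∈ Ioo (-1:ℝ) 1, 0 < Real.exp t * ((1 + u) / (1 - u)) := fun u hu => by
    have h2 : 0 < 1 + u := by linarith [hu.1]
    have h3 : 0 < 1 - u := by linarith [hu.2]
    positivity
  have hA := integral_argDensity h0 h1 t
  rw [integral_comp_cos_mul_abs_sin (C := 1)
    (g := fun u => argDensity α (Real.exp t * ((1 + u) / (1 - u))))] at hA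
  · have hB := integral_measureReal_Ioc (argStieltjes h0 h1).measure hx
    have e : ∫ u in (-1:ℝ)..1, argDensity α (Real.exp t * ((1 + u) / (1 - u))) =
        ∫ u in (-1:ℝ)..1, (argStieltjes h0 h1).measure.real
          (Ioc 0 (Real.exp t * ((1 + u) / (1 - u)))) := by
      rw [intervalIntegral.integral_of_le (by norm_num), intervalIntegral.integral_of_le (by norm_num),
        integral_Ioc_eq_integral_Ioo, integral_Ioc_eq_integral_Ioo]
      exact setIntegral_congr_fun measurableSet_Ioo fun u hu =>
        argDensity_eq_measureReal h0 h1 (hpos u hu)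
    rw [e, hB] at hA
    linarith
  · refine continuousOn_const.sub ((continuousOn_thetaFun (by linarith) h1).comp ?_ hpos)
    refine continuousOn_const.mul (ContinuousOn.div (by fun_prop) (by fun_prop) fun u hu => ?_)
    linarith [hu.2]
  · intro u hu
    rw [abs_of_nonneg (argDensity_nonneg h0 h1 (hpos u hu))]
    exact argDensity_le_one h0 h1 (hpos u hu)

lemma Galpha_ofReal {α x : ℝ} (h0 : 0 < α) (h1 : α < 1) (hx : 0 < x) :
    Galpha α x = ((x ^ (-α) * Real.exp (-(decayRate α * x)) : ℝ) : ℂ) * pickFun α (Real.log x) := by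
  have hxc : (x:ℂ) ≠ 0 := by exact_mod_cast hx.ne'
  have hlog : log (x:ℂ) = (Real.log x : ℝ) := (ofReal_log hx.le).symm
  have hJ : Galpha α x = (2 * Real.pi * I)⁻¹ * (jumpFun α (Real.log x) / x) := by
    rw [jumpFun, ← integral_sub_expPow h0 h1, Galpha]
    congr 1
    refine setIntegral_congr_fun measurableSet_Ioi fun y _ => ?_
    simp only [cpow_def_of_ne_zero hxc, hlog]
    ring_nf
  have hpow : ((x ^ (-α) : ℝ) : ℂ) * exp ((α - 1) * (Real.log x : ℝ)) = (x:ℂ)⁻¹ := by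
    rw [ofReal_cpow hx.le, cpow_def_of_ne_zero hxc, hlog, ← exp_add]
    rw [← cpow_neg_one, cpow_def_of_ne_zero hxc, hlog]
    congr 1
    push_cast
    ring
  have hdec : ((Real.exp (-(decayRate α * x)) : ℝ) : ℂ) *
      exp (decayRate α * exp ((Real.log x : ℝ) : ℂ)) = 1 := by
    rw [← ofReal_exp (Real.log x), Real.exp_log hx, ofReal_exp, ← exp_add]
    simp
  rw [hJ, pickFun, ofReal_mul]
  calc (2 * Real.pi * I)⁻¹ * (jumpFun α (Real.log x) / x)
      = (x:ℂ)⁻¹ * 1 * jumpFun α (Real.log x) / (2 * Real.pi * I) := by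
        rw [div_eq_mul_inv, div_eq_mul_inv]; ring
    _ = _ := by
        rw [← hpow, ← hdec]; ring

/-- For `α ∈ [1/2, 1)`, `θ_α` decreases from `α` to `1/2`, `G_α` is positive
on `(0,∞)`, and `x ↦ e^{-δ_α x}/G_α(x)` is hyperbolically completely monotone. -/
theorem Galpha_inverse_HCM (α : ℝ) (hα : α ∈ Set.Ico (1/2 : ℝ) 1) :
    AntitoneOn (thetaFun α) (Set.Ioi 0) ∧
    Filter.Tendsto (thetaFun α) (nhdsWithin 0 (Set.Ioi 0)) (nhds α) ∧
    Filter.Tendsto (thetaFun α) Filter.atTop (nhds (1/2)) ∧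
    (∀ x : ℝ, 0 < x → (Galpha α (x:ℂ)).im = 0 ∧ 0 < (Galpha α (x:ℂ)).re) ∧
    HCM (fun x : ℝ => Real.exp (-((1 - α) * α ^ (α / (1 - α)) * x)) / (Galpha α (x:ℂ)).re) := by
  obtain ⟨h0, h1⟩ := hα
  have hα : 0 < α := by linarith
  refine ⟨antitoneOn_thetaFun h0 h1, tendsto_thetaFun_zero hα h1, tendsto_thetaFun_atTop h0 h1,
    fun x hx => ?_, ?_⟩
  · rw [Galpha_ofReal hα h1 hx, im_ofReal_mul, re_ofReal_mul, pickFun_ofReal_im]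
    have := pickFun_ofReal_re_pos h0 h1 (Real.log x)
    exact ⟨mul_zero _, by positivity⟩
  · refine HCM_of_stieltjes (argStieltjes h0 h1).measure (a := α)
      (Λ := fun t => Real.log (pickFun α t).re) (fun t => ?_) fun x hx => ?_
    · rw [← logDeriv_pickFun_eq h0 h1]
      exact (hasDerivAt_pickFun_re h0 h1 t).1.log (pickFun_ofReal_re_pos h0 h1 t).ne'
    · have hQ := pickFun_ofReal_re_pos h0 h1 (Real.log x)
      have hxa := Real.rpow_pos_of_pos hx α
      rw [Galpha_ofReal hα h1 hx, re_ofReal_mul, Real.exp_neg (Real.log _), Real.exp_log hQ,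
        Real.rpow_neg hx.le, decayRate]
      field_simp
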